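/- (Thin Ladder Theorem) Let Y be a two-sided 2-connected ladder over a field k, with lower inside corners (a_1,b_1),…,(a_h,b_h) (h ≥ 1) and upper inside corners (c_1,d_1),…,(c_k,d_k) (k ≥ 1), such that for all 1 ≤ i ≤ h and 1 ≤ j ≤ k one has a_i > c_j or b_i > d_j (i.e., (a_i,b_i) ≰ (c_j,d_j) componentwise). Then R_2(Y) has at most two semidualizing modules up to isomorphism: among any three semidualizing R_2(Y)-modules, two are isomorphic. -/

import Mathlib

set_option maxHeartbeats 1000000
set_option synthInstance.maxHeartbeats 1000000

open CategoryTheory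

namespace LadderDet

/-- The position `p` lies in the `m × n` grid `{1,…,m} × {1,…,n}`. -/
def InGrid (m n : ℕ) (p : ℕ × ℕ) : Prop :=
  1 ≤ p.1 ∧ p.1 ≤ m ∧ 1 ≤ p.2 ∧ p.2 ≤ n

/-- `Y` is a ladder in the `m × n` grid. -/
def IsLadder (m n : ℕ) (Y : Set (ℕ × ℕ)) : Prop :=
  (∀ p ∈ Y, InGrid m n p) ∧
  ∀ i j p q : ℕ, (i, j) ∈ Y → (p, q) ∈ Y → i ≤ p → j ≤ q → (i, q) ∈ Y ∧ (p, j) ∈ Y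

/-- A ladder together with the standard nontriviality assumptions:
`(1,n), (m,1) ∈ Y` and every row and every column of the grid meets `Y`. -/
def StdLadder (m n : ℕ) (Y : Set (ℕ × ℕ)) : Prop :=
  IsLadder m n Y ∧ (1, n) ∈ Y ∧ (m, 1) ∈ Y ∧
  (∀ i, 1 ≤ i → i ≤ m → ∃ j, (i, j) ∈ Y) ∧
  (∀ j, 1 ≤ j → j ≤ n → ∃ i, (i, j) ∈ Y)

/-- Two positions differ by exactly `1` in exactly one coordinate. -/
def AdjStep (p q : ℕ × ℕ) : Prop :=
  (p.1 = q.1 ∧ (p.2 + 1 = q.2 ∨ q.2 + 1 = p.2)) ∨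
  (p.2 = q.2 ∧ (p.1 + 1 = q.1 ∨ q.1 + 1 = p.1))

/-- There is a path in `Y` from `p` to `q`. -/
def HasPath (Y : Set (ℕ × ℕ)) (p q : ℕ × ℕ) : Prop :=
  p ∈ Y ∧ q ∈ Y ∧
    Relation.ReflTransGen (fun a b => a ∈ Y ∧ b ∈ Y ∧ AdjStep a b) p q

/-- `Y` is path-connected. -/
def PathConnected (Y : Set (ℕ × ℕ)) : Prop :=
  ∀ p ∈ Y, ∀ q ∈ Y, HasPath Y p q

/-- `M` is (the set of entries of) a `t × t` minor of `Y`. -/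
def IsMinor (t : ℕ) (Y : Set (ℕ × ℕ)) (M : Set (ℕ × ℕ)) : Prop :=
  ∃ r c : Fin t → ℕ, StrictMono r ∧ StrictMono c ∧
    (∀ u v, (r u, c v) ∈ Y) ∧ M = {p | ∃ u v, p = (r u, c v)}

/-- `Y` is `t`-disconnected. -/
def TDisconnected (m n t : ℕ) (Y : Set (ℕ × ℕ)) : Prop :=
  ∃ Z₁ Z₂ : Set (ℕ × ℕ), Z₁.Nonempty ∧ Z₂.Nonempty ∧
    IsLadder m n Z₁ ∧ IsLadder m n Z₂ ∧ Z₁ ∩ Z₂ = ∅ ∧ Z₁ ∪ Z₂ = Y ∧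
    ∀ M, IsMinor t Y M → M ⊆ Z₁ ∨ M ⊆ Z₂

/-- `Y` is `t`-connected. -/
def TConnected (m n t : ℕ) (Y : Set (ℕ × ℕ)) : Prop := ¬ TDisconnected m n t Y

/-- `p` is a lower inside corner of `Y`. -/
def IsLowerCorner (Y : Set (ℕ × ℕ)) (p : ℕ × ℕ) : Prop :=
  p ∈ Y ∧ (p.1 - 1, p.2) ∈ Y ∧ (p.1, p.2 - 1) ∈ Y ∧ (p.1 - 1, p.2 - 1) ∉ Y

/-- `p` is an upper inside corner of `Y`. -/
def IsUpperCorner (Y : Set (ℕ × ℕ)) (p : ℕ × ℕ) : Prop :=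
  p ∈ Y ∧ (p.1 + 1, p.2) ∈ Y ∧ (p.1, p.2 + 1) ∈ Y ∧ (p.1 + 1, p.2 + 1) ∉ Y

/-- `Y` is one-sided: path-connected and with no lower or no upper inside corners. -/
def OneSided (Y : Set (ℕ × ℕ)) : Prop :=
  PathConnected Y ∧
  ((∀ p, ¬ IsLowerCorner Y p) ∨ (∀ p, ¬ IsUpperCorner Y p))

/-- `Y` is two-sided: path-connected with at least one lower and one upper inside corner. -/
def TwoSided (Y : Set (ℕ × ℕ)) : Prop :=
  PathConnected Y ∧ (∃ p, IsLowerCorner Y p) ∧ (∃ p, IsUpperCorner Y p)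

section Algebra

variable (k : Type) [Field k]

/-- The `t × t` minor of the generic matrix determined by rows `r` and columns `c`,
as an element of the polynomial ring `k[Y]`. -/
noncomputable def minorPoly {t : ℕ} {Y : Set (ℕ × ℕ)} (r c : Fin t → ℕ)
    (h : ∀ u v, (r u, c v) ∈ Y) : MvPolynomial Y k :=
  (Matrix.of fun u v : Fin t =>
    (MvPolynomial.X ⟨(r u, c v), h u v⟩ : MvPolynomial Y k)).det

/-- The ideal `I_t(Y) ⊆ k[Y]` generated by all `t × t` minors of `X` lying in `Y`. -/
noncomputable def minorIdeal (t : ℕ) (Y : Set (ℕ × ℕ)) : Ideal (MvPolynomial Y k) :=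
  Ideal.span {f | ∃ (r c : Fin t → ℕ) (_ : StrictMono r) (_ : StrictMono c)
    (h : ∀ u v, (r u, c v) ∈ Y), f = minorPoly k r c h}

/-- The ladder determinantal ring `R_t(Y) = k[Y]/I_t(Y)`. -/
abbrev LadderRing (t : ℕ) (Y : Set (ℕ × ℕ)) : Type :=
  MvPolynomial Y k ⧸ minorIdeal k t Y

/-- The residue `x_{ij}` of the variable `X_{ij}` in `R_t(Y)`. -/
noncomputable def xres (t : ℕ) {Y : Set (ℕ × ℕ)} (p : ℕ × ℕ) (hp : p ∈ Y) :
    LadderRing k t Y :=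
  Ideal.Quotient.mk (minorIdeal k t Y) (MvPolynomial.X ⟨p, hp⟩)

/-- The ideal of `R_2(Y)` generated by the residues of the variables in row `r`
(an ideal of type `𝔮`). -/
noncomputable def rowIdeal (Y : Set (ℕ × ℕ)) (r : ℕ) : Ideal (LadderRing k 2 Y) :=
  Ideal.span {z | ∃ q, ∃ h : (r, q) ∈ Y, z = xres k 2 (r, q) h}

/-- The ideal of `R_2(Y)` generated by the residues of the variables in column `b`
(an ideal of type `𝔮'`). -/
noncomputable def colIdeal (Y : Set (ℕ × ℕ)) (b : ℕ) : Ideal (LadderRing k 2 Y) :=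
  Ideal.span {z | ∃ p, ∃ h : (p, b) ∈ Y, z = xres k 2 (p, b) h}

/-- The ideal `𝔭` of `R_2(Y)` generated by the residues of the variables weakly
northwest of the position `(c, d)`. -/
noncomputable def cornerIdeal (Y : Set (ℕ × ℕ)) (c d : ℕ) : Ideal (LadderRing k 2 Y) :=
  Ideal.span {z | ∃ p q, ∃ h : (p, q) ∈ Y, p ≤ c ∧ q ≤ d ∧ z = xres k 2 (p, q) h}

end Algebra

/-- An ideal of `k[Y]` is a monomial ideal if it is generated by monomials. -/
def IsMonomialIdeal {k : Type} [Field k] {Y : Set (ℕ × ℕ)}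
    (M : Ideal (MvPolynomial Y k)) : Prop :=
  ∃ S : Set (Y →₀ ℕ), M = Ideal.span ((fun d => MvPolynomial.monomial d (1 : k)) '' S)

/-- A finitely generated module `C` over a commutative ring `R` is semidualizing if
the natural homothety map `R → Hom_R(C, C)` is bijective and `Ext^i_R(C, C) = 0` for
all `i ≥ 1`. -/
def IsSemidualizing {R : Type} [CommRing R] (C : ModuleCat.{0} R) : Prop :=
  Module.Finite R C ∧
  Function.Bijective (LinearMap.lsmul R C) ∧
  ∀ i : ℕ, 1 ≤ i →
    Subsingleton (((Ext R (ModuleCat.{0} R) i).obj (Opposite.op C)).obj C)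

/-- `C` has finite injective dimension: for some `n`, `Ext^i_R(M, C) = 0` for all
modules `M` and all `i > n`. -/
def HasFiniteInjDim {R : Type} [CommRing R] (C : ModuleCat.{0} R) : Prop :=
  ∃ n : ℕ, ∀ i : ℕ, n < i → ∀ M : ModuleCat.{0} R,
    Subsingleton (((Ext R (ModuleCat.{0} R) i).obj (Opposite.op M)).obj C)


/-! ### Alternating face sums on lists -/

/-- alternating sum over omitting one entry -/
def ldel {X A : Type*} [AddCommGroup A] : (List X → A) → List X → A
  | _, [] => 0
  | f, t :: l => f l - ldel (fun l' => f (t :: l')) l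

section ldel
variable {X A B : Type*} [AddCommGroup A] [AddCommGroup B]

@[simp] lemma ldel_nil (f : List X → A) : ldel f [] = 0 := by simp [ldel]

lemma ldel_cons (f : List X → A) (t : X) (l : List X) :
    ldel f (t :: l) = f l - ldel (fun l' => f (t :: l')) l := by simp [ldel]

lemma ldel_map (φ : A →+ B) (f : List X → A) (l : List X) :
    φ (ldel f l) = ldel (fun l' => φ (f l')) l := by
  induction l generalizing f with
  | nil => simp
  | cons t l ih => simp [ldel_cons, ih]

lemma ldel_sub (f g : List X → A) (l : List X) :
    ldel (fun l' => f l' - g l') l = ldel f l - ldel g l := by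
  induction l generalizing f g with
  | nil => simp
  | cons t l ih => simp only [ldel_cons, ih]; abel

lemma ldel_neg (f : List X → A) (l : List X) :
    ldel (fun l' => - f l') l = - ldel f l := by
  induction l generalizing f with
  | nil => simp
  | cons t l ih => simp only [ldel_cons, ih]; abel

lemma ldel_add (f g : List X → A) (l : List X) :
    ldel (fun l' => f l' + g l') l = ldel f l + ldel g l := by
  induction l generalizing f g with
  | nil => simp
  | cons t l ih => simp only [ldel_cons, ih]; abel

lemma ldel_congr (f g : List X → A) (l : List X)
    (h : ∀ l', l'.Sublist l → l'.length + 1 = l.length → f l' = g l') :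
    ldel f l = ldel g l := by
  induction l generalizing f g with
  | nil => simp
  | cons t l ih =>
    rw [ldel_cons, ldel_cons, h l (List.sublist_cons_self t l) (by simp)]
    congr 1
    apply ih
    intro l' h1 h2
    exact h _ (h1.cons_cons t) (by simp [← h2])

lemma ldel_eq_zero (f : List X → A) (l : List X)
    (h : ∀ l', l'.Sublist l → l'.length + 1 = l.length → f l' = 0) :
    ldel f l = 0 := by
  rw [ldel_congr f (fun _ => 0) l h]
  have := ldel_sub (fun _ => (0:A)) (fun _ => 0) l
  simpa using this

lemma ldel_ldel (f : List X → A) (l : List X) : ldel (ldel f) l = 0 := by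
  induction l generalizing f with
  | nil => simp
  | cons t l ih =>
    rw [ldel_cons]
    have : (fun l' => ldel f (t :: l')) = fun l' => f l' - ldel (fun l'' => f (t :: l'')) l' := by
      funext l'; rw [ldel_cons]
    rw [this, ldel_sub, ih]; abel

lemma ldel_append (f : List X → A) (J b : List X) :
    ldel f (J ++ b) = ldel (fun J' => f (J' ++ b)) J
      + ((-1 : ℤ) ^ J.length) • ldel (fun b' => f (J ++ b')) b := by
  induction J generalizing f with
  | nil => simp
  | cons t J ih =>
    simp only [List.cons_append, ldel_cons, ih, List.length_cons, pow_succ]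
    simp only [mul_neg, mul_one, neg_smul]
    abel

end ldel

/-! ### Exactness of relative list complexes -/

/-- exactness of the complex of functions supported on `P` -/
def LExact (k : Type*) [Field k] {X : Type*} (P : List X → Prop) : Prop :=
  ∀ (n : ℕ) (F : List X → k), (∀ L, F L ≠ 0 → P L ∧ L.length = n) →
    (∀ L, P L → ldel F L = 0) →
    ∃ H : List X → k, (∀ L, H L ≠ 0 → P L ∧ L.length + 1 = n) ∧ ∀ L, P L → ldel H L = F L

/-- convexity with respect to sublists -/
def LConvex {X : Type*} (P : List X → Prop) : Prop :=
  ∀ L₁ L₂ L₃ : List X, L₁.Sublist L₂ → L₂.Sublist L₃ → P L₁ → P L₃ → P L₂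

section exact
variable {k : Type*} [Field k] {X : Type*}

lemma LExact.congr {P Q : List X → Prop} (h : ∀ L, P L ↔ Q L) (hP : LExact k P) : LExact k Q := by
  have : P = Q := funext fun L => propext (h L)
  exact this ▸ hP

/-- the cone construction -/
def ConeP (y : X) (P₀ P₁ : List X → Prop) (L : List X) : Prop :=
  P₀ L ∨ ∃ L', L = y :: L' ∧ P₁ L'

lemma LExact.cone {y : X} {P₀ P₁ : List X → Prop} (h₀ : LExact k P₀) (h₁ : LExact k P₁)
    (hle : ∀ L, P₀ L → P₁ L) (hy : ∀ L, P₁ L → y ∉ L)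
    (hup : ∀ L L', L'.Sublist L → P₀ L' → P₁ L → P₀ L) :
    LExact k (ConeP y P₀ P₁) := by
  classical
  intro n F hF hcyc
  have hy0 : ∀ L, P₀ L → y ∉ L := fun L h => hy L (hle L h)
  -- part without y
  set F0 : List X → k := fun L => if P₀ L then F L else 0 with hF0
  have key : ∀ (K : List X → k), (∀ L, K L ≠ 0 → ConeP y P₀ P₁ L) → ∀ L, P₁ L →
      ldel K L = ldel (fun L => if P₀ L then K L else 0) L := by
    intro K hK L hL
    apply ldel_congr
    intro L' hs _
    by_cases hp : P₀ L'
    · simp [hp]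
    · simp only [hp, if_false]
      by_contra hne
      rcases hK L' hne with h | ⟨L'', rfl, h⟩
      · exact hp h
      · exact hy L hL (hs.subset (by simp))
  obtain ⟨G0, hG0, hG0'⟩ := h₀ n F0 (by
      intro L hL
      by_cases hp : P₀ L
      · refine ⟨hp, ?_⟩
        simp only [hF0, hp, if_true] at hL
        exact (hF L hL).2
      · simp [hF0, hp] at hL) (by
      intro L hL
      rw [← key F (fun L h => (hF L h).1) L (hle L hL)]
      exact hcyc L (Or.inl hL))
  set F1 : List X → k := fun L => if P₁ L then F (y :: L) - G0 L else 0 with hF1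
  have hyF : ∀ L, F (y :: L) ≠ 0 → P₁ L := by
    intro L h
    rcases (hF _ h).1 with h | ⟨L', h1, h⟩
    · exact absurd (by simp) (hy0 _ h)
    · cases h1; exact h
  have hF1' : ∀ L, F1 L = F (y :: L) - G0 L := by
    intro L
    by_cases hp : P₁ L
    · simp [hF1, hp]
    · have h1 : F (y :: L) = 0 := by by_contra h; exact hp (hyF L h)
      have h2 : G0 L = 0 := by by_contra h; exact hp (hle L (hG0 L h).1)
      simp [hF1, hp, h1, h2]
  have hG0'' : ∀ L, P₁ L → ldel G0 L = F0 L := by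
    intro L hL
    by_cases hp : P₀ L
    · exact hG0' L hp
    · have : F0 L = 0 := by simp [hF0, hp]
      rw [this]
      apply ldel_eq_zero
      intro L' hs _
      by_contra h
      exact hp (hup L L' hs (hG0 L' h).1 hL)
  obtain ⟨H, hH, hH'⟩ := h₁ (n - 1) F1 (by
      intro L hL
      by_cases hp : P₁ L
      · refine ⟨hp, ?_⟩
        rw [hF1'] at hL
        by_cases h : F (y :: L) = 0
        · rw [h] at hL
          have := (hG0 L (by intro h'; simp [h'] at hL)).2
          omega
        · have := (hF _ h).2
          simp at this; omega
      · simp [hF1, hp] at hL) (by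
      intro L hL
      have h1 := hcyc (y :: L) (Or.inr ⟨L, rfl, hL⟩)
      rw [ldel_cons] at h1
      have : F1 = fun L => F (y :: L) - G0 L := funext hF1'
      rw [this, ldel_sub, hG0'' L hL]
      have h2 : F L = F0 L := by
        by_cases hp : P₀ L
        · simp [hF0, hp]
        · simp only [hF0, hp, if_false]
          by_contra h
          rcases (hF _ h).1 with h | ⟨L', rfl, h⟩
          · exact hp h
          · exact hy _ hL (by simp)
      rw [h2] at h1
      rw [← neg_eq_zero, ← h1]; ring)
  -- assemble
  let G : List X → k := fun L => if P₀ L then G0 L else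
    match L with
    | [] => 0
    | z :: L' => if z = y then - H L' else 0
  have hGP0 : ∀ L, y ∉ L → G L = G0 L := by
    intro L hL
    by_cases hp : P₀ L
    · simp [G, hp]
    · have : G0 L = 0 := by by_contra h; exact hp (hG0 L h).1
      rw [this]
      simp only [G, hp, if_false]
      cases L with
      | nil => rfl
      | cons z L' => simp at hL; simp [Ne.symm hL.1]
  have hGy : ∀ L, G (y :: L) = - H L := by
    intro L
    have : ¬ P₀ (y :: L) := fun h => hy0 _ h (by simp)
    simp [G, this]
  refine ⟨G, ?_, ?_⟩
  · intro L hL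
    by_cases hp : P₀ L
    · simp only [G, hp, if_true] at hL
      exact ⟨Or.inl hp, (hG0 L hL).2⟩
    · cases L with
      | nil => simp [G, hp] at hL
      | cons z L' =>
        by_cases hz : z = y
        · subst hz
          rw [hGy] at hL
          have := hH L' (by simpa using hL)
          refine ⟨Or.inr ⟨L', rfl, this.1⟩, ?_⟩
          simp; omega
        · simp [G, hp, hz] at hL
  · intro L hL
    rcases hL with hL | ⟨L', rfl, hL'⟩
    · have : ldel G L = ldel G0 L := by
        apply ldel_congr
        intro L' hs _
        exact hGP0 L' (fun h => hy0 L hL (hs.subset h))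
      rw [this, hG0' L hL]
      simp [hF0, hL]
    · rw [ldel_cons, hGP0 L' (hy L' hL')]
      have : (fun l' => G (y :: l')) = fun l' => - H l' := funext hGy
      rw [this, ldel_neg, hH' L' hL', hF1']
      ring

/-- cone of a predicate with itself is exact -/
lemma LExact.cone_self {y : X} {P : List X → Prop} (hy : ∀ L, P L → y ∉ L) :
    LExact k (ConeP y P P) := by
  classical
  intro n F hF hcyc
  have hyF : ∀ L, F (y :: L) ≠ 0 → P L := by
    intro L h
    rcases (hF _ h).1 with h | ⟨L', h1, h⟩
    · exact absurd (by simp) (hy _ h)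
    · cases h1; exact h
  refine ⟨fun L => F (y :: L), ?_, ?_⟩
  · intro L hL
    exact ⟨Or.inl (hyF L hL), by simpa using (hF _ hL).2⟩
  · intro L hL
    rcases hL with hL | ⟨L', rfl, hL'⟩
    · have := hcyc (y :: L) (Or.inr ⟨L, rfl, hL⟩)
      rw [ldel_cons, sub_eq_zero] at this
      exact this.symm
    · rw [ldel_cons]
      have : ldel (fun l' => F (y :: y :: l')) L' = 0 := by
        apply ldel_eq_zero
        intro L'' hs _
        by_contra h
        exact hy _ (hyF _ h) (by simp)
      rw [this, sub_zero]

lemma LExact.bad {P Q : List X → Prop} (hP : LExact k P) (hQ : LExact k (fun L => P L ∧ Q L))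
    (hc : LConvex P) (hup : ∀ L L', L'.Sublist L → P L' → P L → Q L' → Q L) :
    LExact k (fun L => P L ∧ ¬ Q L) := by
  classical
  intro n F hF hcyc
  set H : List X → k := fun L => if P L ∧ Q L then ldel F L else 0 with hH
  have hlen : ∀ (K : List X → k) (n : ℕ), (∀ L, K L ≠ 0 → L.length = n) →
      ∀ L, ldel K L ≠ 0 → L.length = n + 1 := by
    intro K n hK L hL
    by_contra hne
    apply hL
    apply ldel_eq_zero
    intro L' hs h
    by_contra h'
    have := hK L' h'
    omega
  have hHF : ∀ L, P L → H L = ldel F L := by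
    intro L hL
    by_cases hq : Q L
    · simp [hH, hL, hq]
    · simp only [hH, hq, and_false, if_false]
      exact (hcyc L ⟨hL, hq⟩).symm
  obtain ⟨g, hg, hg'⟩ := hQ (n + 1) H (by
      intro L hL
      by_cases hp : P L ∧ Q L
      · simp only [hH, hp, and_self, if_true] at hL
        exact ⟨hp, hlen F n (fun L h => (hF L h).2) L hL⟩
      · simp [hH, hp] at hL) (by
      rintro L ⟨hL, hq⟩
      rw [← ldel_ldel F L]
      apply ldel_congr
      intro L' hs _
      by_cases hp : P L'
      · exact hHF L' hp
      · have : H L' = 0 := by simp [hH, hp]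
        rw [this]
        symm
        apply ldel_eq_zero
        intro L'' hs' _
        by_contra h
        exact hp (hc L'' L' L hs' hs (hF _ h).1.1 hL))
  obtain ⟨x, hx, hx'⟩ := hP n (fun L => F L - g L) (by
      intro L hL
      by_cases h : F L = 0
      · have hg0 : g L ≠ 0 := by
          intro h'; simp [h, h'] at hL
        exact ⟨(hg L hg0).1.1, by have := (hg L hg0).2; omega⟩
      · exact ⟨(hF L h).1.1, (hF L h).2⟩) (by
      intro L hL
      rw [ldel_sub]
      by_cases hq : Q L
      · rw [hg' L ⟨hL, hq⟩, hHF L hL, sub_self]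
      · rw [hcyc L ⟨hL, hq⟩, zero_sub, neg_eq_zero]
        apply ldel_eq_zero
        intro L' hs _
        by_contra h
        exact hq (hup L L' hs (hg _ h).1.1 hL (hg _ h).1.2))
  refine ⟨fun L => if Q L then 0 else x L, ?_, ?_⟩
  · intro L hL
    by_cases hq : Q L
    · simp [hq] at hL
    · simp only [hq, if_false] at hL
      exact ⟨⟨(hx L hL).1, hq⟩, (hx L hL).2⟩
  · rintro L ⟨hL, hq⟩
    have : ldel (fun L => if Q L then 0 else x L) L = ldel x L := by
      apply ldel_congr
      intro L' hs _
      by_cases hq' : Q L'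
      · simp only [hq', if_true]
        by_contra h
        exact hq (hup L L' hs (hx L' (Ne.symm h)).1 hL hq')
      · simp [hq']
    rw [this, hx' L hL]
    have : g L = 0 := by by_contra h; exact hq (hg L h).1.2
    simp [this]

/-- glueing along a class map: `cl` to a type with rank -/
lemma LExact.layers {Z : Type*} {P : List X → Prop} (cl : List X → Z) (rk : Z → ℕ)
    (hP : LConvex P)
    (hrk : ∀ L, P L → rk (cl L) ≤ L.length)
    (hmono : ∀ L L', L'.Sublist L → P L' → P L → cl L' = cl L ∨ rk (cl L') < rk (cl L))
    (hex : ∀ z, LExact k (fun L => P L ∧ cl L = z)) : LExact k P := by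
  classical
  intro n
  -- descending induction on lower bound for the rank
  have main : ∀ (s r : ℕ), r + s = n + 1 → ∀ F : List X → k,
      (∀ L, F L ≠ 0 → (P L ∧ L.length = n) ∧ r ≤ rk (cl L)) →
      (∀ L, P L → ldel F L = 0) →
      ∃ H : List X → k, (∀ L, H L ≠ 0 → P L ∧ L.length + 1 = n) ∧ ∀ L, P L → ldel H L = F L := by
    intro s
    induction s with
    | zero =>
      intro r hr F hF _
      refine ⟨fun _ => 0, by simp, ?_⟩
      intro L hL
      rw [ldel_eq_zero _ _ (by simp)]
      by_contra h
      have h1 := hF L (Ne.symm h)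
      have h2 := hrk L h1.1.1
      omega
    | succ s ih =>
      intro r hr F hF hcyc
      have hz : ∀ z, rk z = r → ∃ H : List X → k,
          (∀ L, H L ≠ 0 → (P L ∧ cl L = z) ∧ L.length + 1 = n) ∧
          ∀ L, (P L ∧ cl L = z) → ldel H L = F L := by
        intro z hzr
        obtain ⟨H, h1, h2⟩ := hex z n (fun L => if P L ∧ cl L = z then F L else 0) (by
          intro L hL
          by_cases h : P L ∧ cl L = z
          · simp only [h, and_self, if_true] at hL
            exact ⟨h, (hF L hL).1.2⟩
          · simp [h] at hL) (by
          rintro L ⟨hL, hzL⟩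
          refine Eq.trans ?_ (hcyc L hL)
          apply ldel_congr
          intro L' hs _
          by_cases h : P L' ∧ cl L' = z
          · simp [h]
          · simp only [h, if_false]
            by_contra hne
            have h3 := hF L' (Ne.symm hne)
            rcases hmono L L' hs h3.1.1 hL with h4 | h4
            · exact h ⟨h3.1.1, h4.trans hzL⟩
            · rw [hzL] at h4; omega)
        refine ⟨H, h1, ?_⟩
        intro L hL
        rw [h2 L hL, if_pos hL]
      choose! Hz hHz hHz' using hz
      let G : List X → k := fun L => if rk (cl L) = r then Hz (cl L) L else 0
      have hG : ∀ L, G L ≠ 0 → (P L ∧ rk (cl L) = r) ∧ L.length + 1 = n := by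
        intro L hL
        by_cases h : rk (cl L) = r
        · simp only [G, h, if_true] at hL
          have := hHz _ h L hL
          exact ⟨⟨this.1.1, h⟩, this.2⟩
        · simp [G, h] at hL
      have hGr : ∀ L, P L → rk (cl L) ≤ r → ldel G L = F L := by
        intro L hL hr'
        rcases hr'.eq_or_lt with hr' | hr'
        · rw [← hHz' _ hr' L ⟨hL, rfl⟩]
          apply ldel_congr
          intro L' hs _
          by_cases h : rk (cl L') = r
          · simp only [G, h, if_true]
            by_cases hp : P L'
            · rcases hmono L L' hs hp hL with h4 | h4
              · rw [h4]
              · omega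
            · have h5 : Hz (cl L') L' = 0 := by
                by_contra h'; exact hp (hHz _ h L' h').1.1
              have h6 : Hz (cl L) L' = 0 := by
                by_contra h'; exact hp (hHz _ hr' L' h').1.1
              rw [h5, h6]
          · simp only [G, h, if_false]
            by_contra hne
            have := (hHz _ hr' L' (Ne.symm hne)).1.2
            rw [this] at h; exact h hr'
        · have : F L = 0 := by
            by_contra h; have := (hF L h).2; omega
          rw [this]
          apply ldel_eq_zero
          intro L' hs _
          by_contra h
          have h1 := hG L' h
          rcases hmono L L' hs h1.1.1 hL with h4 | h4
          · rw [h4] at h1; omega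
          · omega
      let F' : List X → k := fun L => if P L then F L - ldel G L else 0
      obtain ⟨H, hH1, hH2⟩ := ih (r + 1) (by omega) F' (by
        intro L hL
        by_cases hp : P L
        · simp only [F', hp, if_true] at hL
          have hrr : r + 1 ≤ rk (cl L) := by
            by_contra hlt
            rw [hGr L hp (by omega), sub_self] at hL
            exact hL rfl
          refine ⟨⟨hp, ?_⟩, hrr⟩
          by_cases h : F L = 0
          · rw [h, zero_sub, neg_ne_zero] at hL
            by_contra hlen
            apply hL
            apply ldel_eq_zero
            intro L' hs h1
            by_contra h2
            have := (hG L' h2).2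
            omega
          · exact (hF L h).1.2
        · simp [F', hp] at hL) (by
        intro L hL
        have : ldel F' L = ldel (fun L => F L - ldel G L) L := by
          apply ldel_congr
          intro L' hs _
          by_cases hp : P L'
          · simp [F', hp]
          · simp only [F', hp, if_false]
            have h1 : F L' = 0 := by by_contra h; exact hp (hF L' h).1.1
            have h2 : ldel G L' = 0 := by
              apply ldel_eq_zero
              intro L'' hs' _
              by_contra h
              exact hp (hP L'' L' L hs' hs (hG L'' h).1.1 hL)
            rw [h1, h2, sub_self]
        rw [this, ldel_sub, hcyc L hL, ldel_ldel, sub_zero])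
      refine ⟨fun L => H L + G L, ?_, ?_⟩
      · intro L hL
        by_cases h : H L = 0
        · have : G L ≠ 0 := by intro h'; simp [h, h'] at hL
          exact ⟨(hG L this).1.1, (hG L this).2⟩
        · exact hH1 L h
      · intro L hL
        rw [ldel_add, hH2 L hL]
        simp [F', hL]
  intro F hF hcyc
  exact main (n + 1) 0 (by omega) F (fun L hL => ⟨hF L hL, Nat.zero_le _⟩) hcyc

end exact

section euler
variable {k : Type*} [Field k] {X : Type*}

lemma ldel_smul (c : k) (f : List X → k) (l : List X) :
    ldel (fun l' => c * f l') l = c * ldel f l := by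
  induction l generalizing f with
  | nil => simp
  | cons t l ih => simp only [ldel_cons, ih]; ring

lemma LExact.euler {P : List X → Prop} (hP : LExact k P) (hc : LConvex P)
    (hfin : {L | P L}.Finite) : ∑ L ∈ hfin.toFinset, (-1 : ℤ) ^ L.length = 0 := by
  classical
  let Pn : ℕ → Type _ := fun n => {L : List X // P L ∧ L.length = n}
  have : ∀ n, Finite (Pn n) := fun n =>
    (hfin.subset (fun L (h : P L ∧ L.length = n) => h.1)).to_subtype
  have : ∀ n, Fintype (Pn n) := fun n => Fintype.ofFinite _
  let ext : ∀ n, (Pn n → k) → List X → k := fun n f L =>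
    if h : P L ∧ L.length = n then f ⟨L, h⟩ else 0
  have ext_supp : ∀ n f L, ext n f L ≠ 0 → P L ∧ L.length = n := by
    intro n f L h
    by_contra h'
    simp [ext, h'] at h
  have ext_apply : ∀ n f (L : Pn n), ext n f L.1 = f L := by
    intro n f L
    simp [ext, L.2]
  have ext_add : ∀ n f g, ext n (f + g) = fun L => ext n f L + ext n g L := by
    intro n f g; funext L
    by_cases h : P L ∧ L.length = n <;> simp [ext, h]
  have ext_smul : ∀ n (c : k) f, ext n (c • f) = fun L => c * ext n f L := by
    intro n c f; funext L
    by_cases h : P L ∧ L.length = n <;> simp [ext, h]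
  let d : ∀ n, (Pn n → k) →ₗ[k] (Pn (n + 1) → k) := fun n =>
    { toFun := fun f L => ldel (ext n f) L.1
      map_add' := by
        intro f g; funext L
        simp only [ext_add, ldel_add, Pi.add_apply]
      map_smul' := by
        intro c f; funext L
        simp only [ext_smul, ldel_smul, Pi.smul_apply, RingHom.id_apply, smul_eq_mul] }
  have hlen : ∀ (K : List X → k) (n : ℕ), (∀ L, K L ≠ 0 → L.length = n) →
      ∀ L, ldel K L ≠ 0 → L.length = n + 1 := by
    intro K n hK L hL
    by_contra hne
    apply hL
    apply ldel_eq_zero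
    intro L' hs h
    by_contra h'
    have := hK L' h'
    omega
  have hdcyc : ∀ n f, d n f = 0 → ∀ L, P L → ldel (ext n f) L = 0 := by
    intro n f hf L hL
    by_contra h
    have hl := hlen _ n (fun L h => (ext_supp n f L h).2) L h
    exact h (congrFun hf ⟨L, hL, hl⟩)
  have hker0 : LinearMap.ker (d 0) = ⊥ := by
    rw [LinearMap.ker_eq_bot']
    intro f hf
    obtain ⟨H, h1, h2⟩ := hP 0 (ext 0 f) (ext_supp 0 f) (hdcyc 0 f hf)
    funext L
    rw [← ext_apply 0 f L, ← h2 L.1 L.2.1]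
    apply ldel_eq_zero
    intro L' _ _
    by_contra h
    have := (h1 L' h).2
    omega
  have hker : ∀ n, LinearMap.ker (d (n + 1)) = LinearMap.range (d n) := by
    intro n
    apply le_antisymm
    · intro f hf
      obtain ⟨H, h1, h2⟩ := hP (n + 1) (ext _ f) (ext_supp _ f) (hdcyc _ f hf)
      refine ⟨fun L => H L.1, ?_⟩
      funext L
      rw [← ext_apply _ f L, ← h2 L.1 L.2.1]
      apply ldel_congr
      intro L' _ _
      by_cases h : P L' ∧ L'.length = n
      · simp [ext, h]
      · simp only [ext, h, dite_false]
        by_contra hne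
        have := h1 L' (Ne.symm hne)
        exact h ⟨this.1, by omega⟩
    · rintro _ ⟨f, rfl⟩
      rw [LinearMap.mem_ker]
      funext L
      show ldel (ext (n + 1) (d n f)) L.1 = 0
      rw [← ldel_ldel (ext n f) L.1]
      apply ldel_congr
      intro L' hs hl
      by_cases h : P L'
      · have : L'.length = n + 1 := by have := L.2.2; omega
        simp [ext, h, this, d]
      · simp only [ext, h, false_and, dite_false]
        symm
        apply ldel_eq_zero
        intro L'' hs' _
        by_contra h3
        exact h (hc L'' L' L.1 hs' hs (ext_supp n f L'' h3).1 L.2.1)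
  let r : ℕ → ℕ := fun n => Module.finrank k (LinearMap.range (d n))
  have c0 : Fintype.card (Pn 0) = r 0 := by
    have := (d 0).finrank_range_add_finrank_ker
    rw [hker0] at this
    simp at this
    exact this.symm
  have cS : ∀ n, Fintype.card (Pn (n + 1)) = r (n + 1) + r n := by
    intro n
    have := (d (n + 1)).finrank_range_add_finrank_ker
    rw [hker] at this
    simp at this
    exact this.symm
  have hsum : ∀ N, ∑ n ∈ Finset.range (N + 1), (-1 : ℤ) ^ n * Fintype.card (Pn n)
      = (-1) ^ N * r N := by
    intro N
    induction N with
    | zero => simp [c0]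
    | succ N ih => rw [Finset.sum_range_succ, ih, cS]; push_cast; ring
  -- bound
  obtain ⟨N, hN⟩ : ∃ N, ∀ L, P L → L.length < N := by
    obtain ⟨N, hN⟩ := (hfin.image List.length).bddAbove
    exact ⟨N + 1, fun L hL => Nat.lt_succ_of_le (hN ⟨L, hL, rfl⟩)⟩
  have hrN : r N = 0 := by
    have hcard : Fintype.card (Pn N) = 0 := by
      rw [Fintype.card_eq_zero_iff]
      exact ⟨fun L => by have := hN L.1 L.2.1; have := L.2.2; omega⟩
    have := (d N).finrank_range_add_finrank_ker
    rw [Module.finrank_fintype_fun_eq_card, hcard] at this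
    show Module.finrank k _ = 0
    omega
  have h1 := hsum N
  rw [hrN] at h1
  simp only [Nat.cast_zero, mul_zero] at h1
  rw [← h1]
  rw [← Finset.sum_fiberwise_of_maps_to (s := hfin.toFinset) (t := Finset.range (N + 1))
    (g := List.length) (by intro L hL; simp at hL; simp; have := hN L hL; omega)]
  apply Finset.sum_congr rfl
  intro n _
  rw [Finset.sum_congr rfl (g := fun _ => (-1 : ℤ) ^ n) (by intro L hL; simp at hL; rw [hL.2])]
  rw [Finset.sum_const, nsmul_eq_mul, mul_comm]
  congr 2
  exact (Fintype.card_of_subtype _ (by intro L; simp)).symm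
end euler

section total
variable {E : Type} {G : Type} [AddCommGroup G]

/-- nonnegative vectors of weight `α` -/
abbrev Lam (wt : (E → ℤ) →+ G) (α : G) : Type := {v : E → ℤ // 0 ≤ v ∧ wt v = α}

variable {wt : (E → ℤ) →+ G} {α : G}

/-- the top of a chain -/
def ltop : List (Lam wt α) → E → ℤ
  | [] => 0
  | t :: _ => t.1

@[simp] lemma ltop_nil : ltop ([] : List (Lam wt α)) = 0 := rfl
@[simp] lemma ltop_cons (t : Lam wt α) (l) : ltop (t :: l) = t.1 := rfl

lemma ltop_nonneg (l : List (Lam wt α)) : 0 ≤ ltop l := by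
  cases l with
  | nil => simp
  | cons t l => exact t.2.1

/-- strictly decreasing lists -/
def lchain (l : List (Lam wt α)) : Prop := l.Pairwise (· > ·)

lemma ltop_mono {l l' : List (Lam wt α)} (h : lchain l) (hs : l'.Sublist l) : ltop l' ≤ ltop l := by
  cases l' with
  | nil => simpa using ltop_nonneg l
  | cons t l' =>
    cases l with
    | nil => simp at hs
    | cons s l =>
      have : t ∈ s :: l := hs.subset (by simp)
      rcases List.mem_cons.1 this with rfl | h'
      · simp
      · have := (List.pairwise_cons.1 h).1 t h'
        exact this.le

variable {Yt : Type} (ε : Yt → E → ℤ)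

/-- the chain part -/
def bpart (L : List (Yt ⊕ Lam wt α)) : List (Lam wt α) := L.filterMap Sum.getRight?
/-- the Koszul part -/
def jpart (L : List (Yt ⊕ Lam wt α)) : List Yt := L.filterMap Sum.getLeft?

/-- the value -/
def lval (L : List (Yt ⊕ Lam wt α)) : E → ℤ := ((jpart L).map ε).sum + ltop (bpart L)

@[simp] lemma bpart_map_append (J : List Yt) (b : List (Lam wt α)) :
    bpart (J.map Sum.inl ++ b.map Sum.inr) = b := by
  unfold bpart
  rw [List.filterMap_append]
  have h1 : List.filterMap Sum.getRight? (J.map (Sum.inl : Yt → Yt ⊕ Lam wt α)) = [] := by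
    induction J <;> simp_all
  have h2 : List.filterMap Sum.getRight? (b.map (Sum.inr : _ → Yt ⊕ Lam wt α)) = b := by
    induction b <;> simp_all
  rw [h1, h2]; rfl

@[simp] lemma jpart_map_append (J : List Yt) (b : List (Lam wt α)) :
    jpart (J.map Sum.inl ++ b.map Sum.inr) = J := by
  unfold jpart
  rw [List.filterMap_append]
  have h1 : List.filterMap Sum.getLeft? (J.map (Sum.inl : Yt → Yt ⊕ Lam wt α)) = J := by
    induction J <;> simp_all
  have h2 : List.filterMap Sum.getLeft? (b.map (Sum.inr : _ → Yt ⊕ Lam wt α)) = [] := by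
    induction b <;> simp_all
  rw [h1, h2]; simp

/-- total complex predicate -/
def TP (Q : List (Lam wt α) → Prop) : List Yt → (E → ℤ) → List (Yt ⊕ Lam wt α) → Prop
  | [], u => fun L => ∃ b, lchain b ∧ Q b ∧ 0 ≤ u + ltop b ∧ L = b.map Sum.inr
  | y :: ys, u => ConeP (Sum.inl y) (TP Q ys u) (TP Q ys (u + ε y))

lemma TP_iff' (Q : List (Lam wt α) → Prop) (ys : List Yt) (u : E → ℤ) (L) :
    TP ε Q ys u L ↔ ∃ (J : List Yt) (b : List (Lam wt α)), L = J.map Sum.inl ++ b.map Sum.inr ∧ J.Sublist ys ∧ lchain b ∧ Q b ∧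
      0 ≤ u + ((J.map ε).sum + ltop b) := by
  induction ys generalizing u L with
  | nil =>
    simp only [TP]
    constructor
    · rintro ⟨b, h1, h2, h3, rfl⟩
      exact ⟨[], b, by simp, by simp, h1, h2, by simpa using h3⟩
    · rintro ⟨J, b, rfl, hJ, h1, h2, h3⟩
      rw [List.sublist_nil] at hJ
      subst hJ
      exact ⟨b, h1, h2, by simpa using h3, by simp⟩
  | cons y ys ih =>
    simp only [TP, ConeP, ih]
    constructor
    · rintro (⟨J, b, rfl, hJ, h1, h2, h3⟩ | ⟨L', rfl, J, b, rfl, hJ, h1, h2, h3⟩)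
      · exact ⟨J, b, rfl, hJ.cons y, h1, h2, h3⟩
      · refine ⟨y :: J, b, by simp, hJ.cons_cons y, h1, h2, ?_⟩
        simp only [List.map_cons, List.sum_cons]
        rw [add_assoc] at h3
        rw [add_assoc (ε y)]
        exact h3
    · rintro ⟨J, b, rfl, hJ, h1, h2, h3⟩
      rcases List.sublist_cons_iff.1 hJ with hJ | ⟨J', rfl, hJ2⟩
      · exact Or.inl ⟨J, b, rfl, hJ, h1, h2, h3⟩
      · refine Or.inr ⟨_, rfl, J', b, rfl, hJ2, h1, h2, ?_⟩
        simp only [List.map_cons, List.sum_cons] at h3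
        rw [add_assoc]
        rw [add_assoc (ε y)] at h3
        exact h3

lemma TP_iff (Q : List (Lam wt α) → Prop) (ys : List Yt) (u : E → ℤ) (L) :
    TP ε Q ys u L ↔ (L = (jpart L).map Sum.inl ++ (bpart L).map Sum.inr) ∧
      (jpart L).Sublist ys ∧ lchain (bpart L) ∧ Q (bpart L) ∧ 0 ≤ u + lval ε L := by
  rw [TP_iff']
  constructor
  · rintro ⟨J, b, rfl, h⟩
    simpa [lval] using h
  · rintro ⟨h0, h⟩
    exact ⟨_, _, h0, h⟩

lemma shape_sublist {L L' : List (Yt ⊕ Lam wt α)} (hs : L'.Sublist L)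
    (h : L = (jpart L).map Sum.inl ++ (bpart L).map Sum.inr) :
    L' = (jpart L').map Sum.inl ++ (bpart L').map Sum.inr := by
  rw [h] at hs
  obtain ⟨l1, l2, rfl, h1, h2⟩ := List.sublist_append_iff.1 hs
  obtain ⟨J, _, rfl⟩ := List.sublist_map_iff.1 h1
  obtain ⟨b, _, rfl⟩ := List.sublist_map_iff.1 h2
  simp

lemma bpart_sublist {L L' : List (Yt ⊕ Lam wt α)} (hs : L'.Sublist L) :
    (bpart L').Sublist (bpart L) := hs.filterMap _
lemma jpart_sublist {L L' : List (Yt ⊕ Lam wt α)} (hs : L'.Sublist L) :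
    (jpart L').Sublist (jpart L) := hs.filterMap _

lemma lval_mono (hε : ∀ y, 0 ≤ ε y) {L L' : List (Yt ⊕ Lam wt α)} (hs : L'.Sublist L)
    (hc : lchain (bpart L)) : lval ε L' ≤ lval ε L := by
  apply add_le_add
  · apply List.Sublist.sum_le_sum ((jpart_sublist hs).map ε)
    intro a ha
    simp only [List.mem_map] at ha
    obtain ⟨y, _, rfl⟩ := ha
    exact hε y
  · exact ltop_mono hc (bpart_sublist hs)

lemma TP_up (hε : ∀ y, 0 ≤ ε y) {Q : List (Lam wt α) → Prop} {ys ys' : List Yt} {u u' : E → ℤ}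
    {Q' : List (Lam wt α) → Prop} {L L' : List (Yt ⊕ Lam wt α)}
    (hs : L'.Sublist L) (h' : TP ε Q' ys' u L') (h : TP ε Q ys u' L) : TP ε Q ys u L := by
  rw [TP_iff] at h h' ⊢
  refine ⟨h.1, h.2.1, h.2.2.1, h.2.2.2.1, ?_⟩
  exact h'.2.2.2.2.trans (add_le_add_right (lval_mono ε hε hs h.2.2.1) u)

lemma TP_mono {Q : List (Lam wt α) → Prop} {ys : List Yt} {u u' : E → ℤ} (huu : u ≤ u')
    {L : List (Yt ⊕ Lam wt α)} (h : TP ε Q ys u L) : TP ε Q ys u' L := by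
  rw [TP_iff] at h ⊢
  exact ⟨h.1, h.2.1, h.2.2.1, h.2.2.2.1, h.2.2.2.2.trans (add_le_add_left huu _)⟩

lemma TP_notMem {Q : List (Lam wt α) → Prop} {ys : List Yt} {u : E → ℤ} {y : Yt} (hy : y ∉ ys)
    (L : List (Yt ⊕ Lam wt α)) (h : TP ε Q ys u L) : Sum.inl y ∉ L := by
  rw [TP_iff'] at h
  obtain ⟨J, b, rfl, hJ, -⟩ := h
  simp only [List.mem_append, List.mem_map, not_or]
  constructor
  · rintro ⟨y', h1, h2⟩
    cases h2
    exact hy (hJ.subset h1)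
  · rintro ⟨y', h1, h2⟩
    cases h2

lemma TP_convex (hε : ∀ y, 0 ≤ ε y) {Q : List (Lam wt α) → Prop}
    (hQ : ∀ b₁ b₂ b₃, b₁.Sublist b₂ → b₂.Sublist b₃ → lchain b₃ → Q b₁ → Q b₃ → Q b₂)
    (ys : List Yt) (u : E → ℤ) :
    LConvex (TP ε Q ys u) := by
  intro L₁ L₂ L₃ h12 h23 h1 h3
  rw [TP_iff] at h1 h3 ⊢
  refine ⟨shape_sublist h23 h3.1, (jpart_sublist h23).trans h3.2.1,
    List.Pairwise.sublist (bpart_sublist h23) h3.2.2.1,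
    hQ _ _ _ (bpart_sublist h12) (bpart_sublist h23) h3.2.2.1 h1.2.2.2.1 h3.2.2.2.1, ?_⟩
  exact h1.2.2.2.2.trans (add_le_add_right (lval_mono ε hε h12
    (List.Pairwise.sublist (bpart_sublist h23) h3.2.2.1)) u)

/-- the basic exactness property -/
def Ex2 (k : Type*) [Field k] (wt : (E → ℤ) →+ G) (α : G) (u : E → ℤ) : Prop :=
  LExact k (fun b : List (Lam wt α) => lchain b ∧ 0 ≤ u + ltop b)

variable {k : Type*} [Field k]

lemma LExact_map_inr {P : List (Lam wt α) → Prop} (h : LExact k P) :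
    LExact k (fun L : List (Yt ⊕ Lam wt α) => ∃ b, P b ∧ L = b.map Sum.inr) := by
  classical
  intro n F hF hcyc
  have hmap : ∀ (K : List (Yt ⊕ Lam wt α) → k) (b : List (Lam wt α)),
      ldel K (b.map Sum.inr) = ldel (fun b' => K (b'.map Sum.inr)) b := by
    intro K b
    induction b generalizing K with
    | nil => simp
    | cons t b ih => simp only [List.map_cons, ldel_cons, ih]
  have hinj : Function.Injective (List.map (Sum.inr : Lam wt α → Yt ⊕ Lam wt α)) :=
    List.map_injective_iff.2 Sum.inr_injective
  obtain ⟨H, h1, h2⟩ := h n (fun b => F (b.map Sum.inr)) (by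
      intro b hb
      obtain ⟨⟨b', hb', he⟩, hl⟩ := hF _ hb
      rw [hinj he]
      refine ⟨hb', ?_⟩
      rw [he] at hl
      simpa using hl) (by
      intro b hb
      rw [← hmap]
      exact hcyc _ ⟨b, hb, rfl⟩)
  refine ⟨fun L => if ∃ b : List (Lam wt α), L = b.map Sum.inr then H (bpart L) else 0, ?_, ?_⟩
  · intro L hL
    by_cases hb : ∃ b : List (Lam wt α), L = b.map Sum.inr
    · obtain ⟨b, rfl⟩ := hb
      have e : bpart (b.map (Sum.inr : _ → Yt ⊕ Lam wt α)) = b := bpart_map_append [] b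
      have : (∃ b' : List (Lam wt α), b.map (Sum.inr : _ → Yt ⊕ Lam wt α) = b'.map Sum.inr) := ⟨b, rfl⟩
      simp only [this, if_true, e] at hL
      have := h1 b hL
      exact ⟨⟨b, this.1, rfl⟩, by simpa using this.2⟩
    · simp [hb] at hL
  · rintro L ⟨b, hb, rfl⟩
    rw [hmap, ← h2 b hb]
    apply ldel_congr
    intro b' _ _
    have : (∃ b'' : List (Lam wt α), b'.map (Sum.inr : _ → Yt ⊕ Lam wt α) = b''.map Sum.inr) :=
      ⟨b', rfl⟩
    rw [if_pos this]
    congr 1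
    exact bpart_map_append [] b'

lemma TP_all_exact (hε : ∀ y, 0 ≤ ε y) (hwt : ∀ y, wt (ε y) = 0)
    (hex : ∀ u, wt u = 0 → Ex2 k wt α u) (ys : List Yt) (hys : ys.Nodup) (u : E → ℤ)
    (hu : wt u = 0) : LExact k (TP ε (fun _ : List (Lam wt α) => True) ys u) := by
  induction ys generalizing u with
  | nil =>
    apply LExact.congr _ (LExact_map_inr (Yt := Yt) (hex u hu))
    intro L
    simp only [TP]
    constructor
    · rintro ⟨b, ⟨h1, h2⟩, h⟩; exact ⟨b, h1, trivial, h2, h⟩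
    · rintro ⟨b, h1, _, h2, h⟩; exact ⟨b, ⟨h1, h2⟩, h⟩
  | cons y ys ih =>
    rw [List.nodup_cons] at hys
    simp only [TP]
    apply LExact.cone (ih hys.2 u hu) (ih hys.2 _ (by rw [map_add, hu, hwt, add_zero]))
    · intro L hL
      exact TP_mono ε (le_add_of_nonneg_right (hε y)) hL
    · exact TP_notMem ε hys.1
    · intro L L' hs h' h
      exact TP_up ε hε hs h' h

lemma TP_single_exact (hε : ∀ y, 0 ≤ ε y) (z : List (Lam wt α)) (y : Yt) (ys : List Yt)
    (hys : ys.Nodup) (hy : y ∈ ys) (u : E → ℤ) (hgood : ∀ e, ε y e ≠ 0 → 0 ≤ (u + ltop z) e) :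
    LExact k (TP ε (fun b : List (Lam wt α) => b = z) ys u) := by
  induction ys generalizing u with
  | nil => simp at hy
  | cons y' ys ih =>
    rw [List.nodup_cons] at hys
    simp only [TP]
    by_cases h : y = y'
    · subst h
      have : TP ε (fun b : List (Lam wt α) => b = z) ys (u + ε y)
          = TP ε (fun b : List (Lam wt α) => b = z) ys u := by
        funext L
        apply propext
        constructor
        · intro h
          rw [TP_iff] at h ⊢
          refine ⟨h.1, h.2.1, h.2.2.1, h.2.2.2.1, ?_⟩
          intro e
          by_cases he : ε y e = 0
          · have := h.2.2.2.2 e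
            simpa [he] using this
          · have h1 := hgood e he
            have h2 : (0 : E → ℤ) ≤ ((jpart L).map ε).sum := by
              apply List.sum_nonneg
              intro a ha
              simp only [List.mem_map] at ha
              obtain ⟨y, _, rfl⟩ := ha
              exact hε y
            have h2 := h2 e
            simp only [lval, h.2.2.2.1, Pi.add_apply, Pi.zero_apply] at h1 h2 ⊢
            linarith
        · exact TP_mono ε (le_add_of_nonneg_right (hε y))
      rw [this]
      exact LExact.cone_self (TP_notMem ε hys.1)
    · have hy' : y ∈ ys := by simpa [h] using hy
      apply LExact.cone (ih hys.2 hy' u hgood) (ih hys.2 hy' _ (by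
        intro e he
        have h1 := hgood e he
        have h2 := hε y' e
        simp only [Pi.add_apply, Pi.zero_apply] at h1 h2 ⊢
        linarith))
      · intro L hL
        exact TP_mono ε (le_add_of_nonneg_right (hε y')) hL
      · exact TP_notMem ε hys.1
      · intro L L' hs hs2 h
        exact TP_up ε hε hs hs2 h

/-- goodness -/
def GoodV (w : E → ℤ) : Prop := ∃ y, ∀ e, ε y e ≠ 0 → 0 ≤ w e

lemma GoodV.mono {w w' : E → ℤ} (h : w ≤ w') (hg : GoodV ε w) : GoodV ε w' := by
  obtain ⟨y, hy⟩ := hg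
  exact ⟨y, fun e he => (hy e he).trans (h e)⟩

lemma TP_good_exact (hε : ∀ y, 0 ≤ ε y) (ys : List Yt)
    (hys : ys.Nodup) (hall : ∀ y, y ∈ ys) (u : E → ℤ) :
    LExact k (TP ε (fun b : List (Lam wt α) => GoodV ε (u + ltop b)) ys u) := by
  apply LExact.layers bpart List.length
  · apply TP_convex ε hε
    intro b₁ b₂ b₃ h12 h23 hc h1 h3
    exact GoodV.mono ε (add_le_add_right (ltop_mono (List.Pairwise.sublist h23 hc) h12) u) h1
  · intro L hL
    exact List.length_filterMap_le _ _
  · intro L L' hs _ _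
    rcases (bpart_sublist hs).length_le.eq_or_lt with h | h
    · exact Or.inl ((bpart_sublist hs).eq_of_length h)
    · exact Or.inr h
  · intro z
    by_cases hz : GoodV ε (u + ltop z)
    · obtain ⟨y, hy⟩ := id hz
      apply LExact.congr _ (TP_single_exact ε hε z y ys hys (hall y) u hy)
      intro L
      rw [TP_iff, TP_iff]
      constructor
      · rintro ⟨h1, h2, h3, h4, h5⟩
        exact ⟨⟨h1, h2, h3, by rw [h4]; exact hz, h5⟩, h4⟩
      · rintro ⟨⟨h1, h2, h3, h4, h5⟩, h6⟩
        exact ⟨h1, h2, h3, h6, h5⟩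
    · intro n F hF hcyc
      have : ∀ L, ¬ (TP ε (fun b : List (Lam wt α) => GoodV ε (u + ltop b)) ys u L ∧ bpart L = z) := by
        rintro L ⟨h1, h2⟩
        rw [TP_iff] at h1
        rw [h2] at h1
        exact hz h1.2.2.2.1
      exact ⟨fun _ => 0, by simp, fun L hL => absurd hL (this L)⟩

lemma TP_bad_exact (hε : ∀ y, 0 ≤ ε y) (hwt : ∀ y, wt (ε y) = 0)
    (hex : ∀ u, wt u = 0 → Ex2 k wt α u) (ys : List Yt)
    (hys : ys.Nodup) (hall : ∀ y, y ∈ ys) (u : E → ℤ) (hu : wt u = 0) :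
    LExact k (TP ε (fun b : List (Lam wt α) => ¬ GoodV ε (u + ltop b)) ys u) := by
  have h1 := TP_all_exact (k := k) ε hε hwt hex ys hys u hu
  have h2 := TP_good_exact (k := k) (wt := wt) (α := α) ε hε ys hys hall u
  refine LExact.congr ?_ (LExact.bad (Q := fun L => GoodV ε (u + ltop (bpart L))) h1
    (LExact.congr ?_ h2) ?_ ?_)
  · intro L
    rw [TP_iff, TP_iff]; tauto
  · intro L
    rw [TP_iff, TP_iff]; tauto
  · exact TP_convex ε hε (by simp) ys u
  · intro L L' hs _ h hg
    rw [TP_iff] at h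
    exact GoodV.mono ε (add_le_add_right (ltop_mono h.2.2.1 (bpart_sublist hs)) u) hg

open Classical in
/-- Koszul alternating count -/
noncomputable def kap : List Yt → (E → ℤ) → ℤ
  | [], w => if 0 ≤ w then 1 else 0
  | y :: ys, w => kap ys w - kap ys (w + ε y)

lemma TP_count (Bs : Finset (List (Lam wt α))) (hBs : ∀ b ∈ Bs, lchain b) (ys : List Yt)
    (hys : ys.Nodup) (u : E → ℤ) :
    ∃ S : Finset (List (Yt ⊕ Lam wt α)), (∀ L, L ∈ S ↔ TP ε (fun b => b ∈ Bs) ys u L) ∧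
      ∑ L ∈ S, (-1 : ℤ) ^ L.length = ∑ b ∈ Bs, (-1) ^ b.length * kap ε ys (u + ltop b) := by
  classical
  induction ys generalizing u with
  | nil =>
    have hinj : Function.Injective (List.map (Sum.inr : Lam wt α → Yt ⊕ Lam wt α)) :=
      List.map_injective_iff.2 Sum.inr_injective
    refine ⟨(Bs.filter (fun b => 0 ≤ u + ltop b)).image (List.map Sum.inr), ?_, ?_⟩
    · intro L
      simp only [TP, Finset.mem_image, Finset.mem_filter]
      constructor
      · rintro ⟨b, ⟨h1, h2⟩, rfl⟩; exact ⟨b, hBs b h1, h1, h2, rfl⟩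
      · rintro ⟨b, _, h1, h2, rfl⟩; exact ⟨b, ⟨h1, h2⟩, rfl⟩
    · rw [Finset.sum_image (fun a _ b _ h => hinj h)]
      simp only [List.length_map, kap, mul_ite, mul_one, mul_zero]
      rw [Finset.sum_filter]
  | cons y ys ih =>
    rw [List.nodup_cons] at hys
    obtain ⟨S0, h0, s0⟩ := ih hys.2 u
    obtain ⟨S1, h1, s1⟩ := ih hys.2 (u + ε y)
    refine ⟨S0 ∪ S1.image (List.cons (Sum.inl y)), ?_, ?_⟩
    · intro L
      simp only [TP, ConeP, Finset.mem_union, Finset.mem_image, h0, h1]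
      constructor
      · rintro (h | ⟨L', h, rfl⟩)
        · exact Or.inl h
        · exact Or.inr ⟨L', rfl, h⟩
      · rintro (h | ⟨L', rfl, h⟩)
        · exact Or.inl h
        · exact Or.inr ⟨L', h, rfl⟩
    · rw [Finset.sum_union, s0, Finset.sum_image (fun a _ b _ h => (List.cons_injective h))]
      · have : ∑ L ∈ S1, (-1 : ℤ) ^ (Sum.inl y :: L).length = - ∑ L ∈ S1, (-1 : ℤ) ^ L.length := by
          rw [← Finset.sum_neg_distrib]
          apply Finset.sum_congr rfl
          intro L _
          rw [List.length_cons, pow_succ]; ring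
        rw [this, s1, ← sub_eq_add_neg, ← Finset.sum_sub_distrib]
        apply Finset.sum_congr rfl
        intro b _
        simp only [kap]
        rw [show u + ε y + ltop b = u + ltop b + ε y by abel]
        ring
      · rw [Finset.disjoint_left]
        intro L hL hL'
        simp only [Finset.mem_image] at hL'
        obtain ⟨L', _, rfl⟩ := hL'
        exact TP_notMem ε hys.1 _ ((h0 _).1 hL) (by simp)

theorem koszul_identity (hε : ∀ y, 0 ≤ ε y) (hwt : ∀ y, wt (ε y) = 0)
    (hex : ∀ u, wt u = 0 → Ex2 k wt α u) (ys : List Yt)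
    (hys : ys.Nodup) (hall : ∀ y, y ∈ ys) (u : E → ℤ) (hu : wt u = 0)
    (Bs : Finset (List (Lam wt α)))
    (hBs : ∀ b, b ∈ Bs ↔ lchain b ∧ ¬ GoodV ε (u + ltop b)) :
    ∑ b ∈ Bs, (-1) ^ b.length * kap ε ys (u + ltop b) = 0 := by
  classical
  obtain ⟨S, hS, hsum⟩ := TP_count ε Bs (fun b hb => ((hBs b).1 hb).1) ys hys u
  rw [← hsum]
  have hS' : ∀ L, L ∈ S ↔ TP ε (fun b : List (Lam wt α) => ¬ GoodV ε (u + ltop b)) ys u L := by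
    intro L
    rw [hS, TP_iff, TP_iff, hBs]
    tauto
  have hfin : {L | TP ε (fun b : List (Lam wt α) => ¬ GoodV ε (u + ltop b)) ys u L}.Finite := by
    apply S.finite_toSet.subset
    intro L hL
    exact (hS' L).2 hL
  have := (TP_bad_exact (k := k) ε hε hwt hex ys hys hall u hu).euler (TP_convex ε hε (by
    intro b₁ b₂ b₃ h12 h23 hc h1 h3 h
    exact h3 (GoodV.mono ε (add_le_add_right (ltop_mono hc h23) u) h)) ys u) hfin
  rw [← this]
  apply Finset.sum_congr _ (fun _ _ => rfl)
  ext L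
  simp [hS']

lemma kap_good (ys : List Yt) (y : Yt) (hy : y ∈ ys) (hε : ∀ y, 0 ≤ ε y) (w : E → ℤ)
    (hg : ∀ e, ε y e ≠ 0 → 0 ≤ w e) : kap ε ys w = 0 := by
  induction ys generalizing w with
  | nil => simp at hy
  | cons y' ys ih =>
    by_cases h : y = y'
    · subst h
      simp only [kap]
      rw [sub_eq_zero]
      clear ih hy
      have hmono : ∀ (ys : List Yt) (w : E → ℤ), (∀ e, ε y e ≠ 0 → 0 ≤ w e) →
          kap ε ys w = kap ε ys (w + ε y) := by
        intro ys
        induction ys with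
        | nil =>
          intro w hg
          simp only [kap]
          congr 1
          apply propext
          constructor
          · intro h; exact h.trans (le_add_of_nonneg_right (hε y))
          · intro h e
            by_cases he : ε y e = 0
            · have := h e; simpa [he] using this
            · exact hg e he
        | cons y' ys ih =>
          intro w hg
          simp only [kap]
          rw [ih w hg, ih (w + ε y') (by
            intro e he
            have h1 := hg e he
            have h2 := hε y' e
            simp only [Pi.add_apply, Pi.zero_apply] at h1 h2 ⊢
            linarith), add_right_comm]
      exact hmono ys w hg
    · have hy' : y ∈ ys := by simpa [h] using hy
      simp only [kap]
      rw [ih hy' w hg, ih hy' (w + ε y') (by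
            intro e he
            have h1 := hg e he
            have h2 := hε y' e
            simp only [Pi.add_apply, Pi.zero_apply] at h1 h2 ⊢
            linarith), sub_zero]

end total

section fin
variable {E : Type} [Fintype E] {G : Type} [AddCommGroup G] {wt : (E → ℤ) →+ G} {α : G}
variable {Yt : Type} [Fintype Yt] (ε : Yt → E → ℤ)

lemma bad_finite (hε : ∀ y, 0 ≤ ε y)
    (H1 : ∀ m : E → ℤ, 0 ≤ m → wt m = 0 → m ≠ 0 → ∃ y, ε y ≤ m) (β : G) (w0 : E → ℤ) :
    {w | wt w = β ∧ w0 ≤ w ∧ ¬ GoodV ε w}.Finite := by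
  classical
  by_contra hinf
  have hinf : {w | wt w = β ∧ w0 ≤ w ∧ ¬ GoodV ε w}.Infinite := hinf
  have := hinf.to_subtype
  let f := Infinite.natEmbedding {w | wt w = β ∧ w0 ≤ w ∧ ¬ GoodV ε w}
  obtain ⟨g, hg⟩ := WellQuasiOrdered.exists_monotone_subseq (r := (· ≤ · : (E → ℕ) → (E → ℕ) → Prop))
    wellQuasiOrdered_le (fun n e => ((f n).1 e - w0 e).toNat)
  have hmono : ∀ m n, m ≤ n → (f (g m)).1 ≤ (f (g n)).1 := by
    intro m n hmn e
    have h1 := hg m n hmn e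
    have h2 : w0 e ≤ (f (g m)).1 e := (f (g m)).2.2.1 e
    have h3 : w0 e ≤ (f (g n)).1 e := (f (g n)).2.2.1 e
    have h1 : ((f (g m)).1 e - w0 e).toNat ≤ ((f (g n)).1 e - w0 e).toNat := h1
    show (f (g m)).1 e ≤ (f (g n)).1 e
    omega
  have hy : ∀ n, ∃ y, ε y ≤ (f (g (n+1))).1 - (f (g n)).1 := by
    intro n
    apply H1
    · exact sub_nonneg.2 (hmono _ _ (Nat.le_succ n))
    · rw [map_sub, (f (g (n+1))).2.1, (f (g n)).2.1, sub_self]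
    · rw [sub_ne_zero]
      intro h
      have := f.injective (Subtype.ext h)
      have := g.injective this
      omega
  choose y hy using hy
  obtain ⟨y0, hy0⟩ := Finite.exists_infinite_fiber y
  have hy0 : (y ⁻¹' {y0}).Infinite := Set.infinite_coe_iff.1 hy0
  let t : ℕ := ∑ e, (f (g 0)).1 e |>.natAbs
  obtain ⟨T, hT, hTc⟩ := hy0.exists_subset_card_eq (∑ e, ((f (g 0)).1 e).natAbs)
  let N := T.sup id + 1
  apply (f (g N)).2.2.2
  refine ⟨y0, fun e he => ?_⟩
  have h1 : (f (g N)).1 e - (f (g 0)).1 e = ∑ n ∈ Finset.range N, ((f (g (n+1))).1 e - (f (g n)).1 e) := by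
    rw [Finset.sum_range_sub (fun n => (f (g n)).1 e)]
  have h2 : ∑ n ∈ Finset.range N, ε (y n) e ≤ ∑ n ∈ Finset.range N, ((f (g (n+1))).1 e - (f (g n)).1 e) :=
    Finset.sum_le_sum fun n _ => hy n e
  have h3 : ∑ n ∈ T, ε (y n) e ≤ ∑ n ∈ Finset.range N, ε (y n) e := by
    apply Finset.sum_le_sum_of_subset_of_nonneg
    · intro n hn
      rw [Finset.mem_range]
      have := Finset.le_sup (f := id) hn
      simp only [id] at this
      omega
    · intro n _ _
      exact hε _ e
  have h4 : (T.card : ℤ) ≤ ∑ n ∈ T, ε (y n) e := by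
    rw [Finset.card_eq_sum_ones]
    push_cast
    apply Finset.sum_le_sum
    intro n hn
    have : y n = y0 := hT hn
    rw [this]
    have := hε y0 e
    simp only [Pi.zero_apply] at this
    omega
  have h5 : ((f (g 0)).1 e).natAbs ≤ T.card := by
    rw [hTc]
    exact Finset.single_le_sum (f := fun e => ((f (g 0)).1 e).natAbs) (fun _ _ => Nat.zero_le _) (Finset.mem_univ e)
  omega

omit [Fintype E] in
lemma lists_finite (F : Set (Lam wt α)) (hF : F.Finite) :
    {b : List (Lam wt α) | lchain b ∧ ∀ t ∈ b, t ∈ F}.Finite := by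
  classical
  have : Finite F := hF
  have h := (List.finite_length_le F (Nat.card F)).image (List.map Subtype.val)
  apply h.subset
  rintro b ⟨hb, hbF⟩
  refine ⟨b.attach.map (fun x => ⟨x.1, hbF x.1 x.2⟩), ?_, ?_⟩
  · simp only [Set.mem_setOf_eq, List.length_map, List.length_attach]
    have hnd : b.Nodup := hb.imp (fun h => ne_of_gt h)
    have h1 : (b.toFinset : Set (Lam wt α)).ncard ≤ F.ncard := by
      apply Set.ncard_le_ncard _ hF
      intro t ht
      exact hbF t (by simpa using ht)
    rw [Set.ncard_coe_finset, List.toFinset_card_of_nodup hnd] at h1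
    exact h1
  · rw [List.map_map]
    exact List.attach_map_subtype_val b

lemma lt_finite (a : Lam wt α) : {t : Lam wt α | t ≤ a}.Finite := by
  classical
  apply Set.Finite.of_finite_image (f := Subtype.val) _ Subtype.val_injective.injOn
  apply (Set.finite_Icc (0 : E → ℤ) a.1).subset
  rintro _ ⟨t, ht, rfl⟩
  exact ⟨t.2.1, ht⟩

lemma chains_finite (a : Lam wt α) :
    {b : List (Lam wt α) | lchain b ∧ ∃ l, b = a :: l}.Finite := by
  apply (lists_finite _ (lt_finite a)).subset
  rintro b ⟨hb, l, rfl⟩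
  refine ⟨hb, fun t ht => ?_⟩
  rcases List.mem_cons.1 ht with rfl | ht
  · exact le_refl t
  · exact ((List.pairwise_cons.1 hb).1 t ht).le

/-- chains with top `a` -/
noncomputable def chainsTop (a : Lam wt α) : Finset (List (Lam wt α)) := (chains_finite a).toFinset

lemma mem_chainsTop {a : Lam wt α} {b} : b ∈ chainsTop a ↔ lchain b ∧ ∃ l, b = a :: l := by
  simp [chainsTop]

/-- reduced chain characteristic -/
noncomputable def pch (a : Lam wt α) : ℤ := - ∑ b ∈ chainsTop a, (-1 : ℤ) ^ b.length

lemma chainsTop_disj (S : Set (Lam wt α)) : S.PairwiseDisjoint chainsTop := by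
  classical
  intro a _ a' _ haa
  rw [Function.onFun, Finset.disjoint_left]
  intro b hb hb'
  rw [mem_chainsTop] at hb hb'
  obtain ⟨_, l, rfl⟩ := hb
  obtain ⟨_, l', h⟩ := hb'
  exact haa (List.cons.inj h).1

lemma pch_rec (a : Lam wt α) (S : Finset (Lam wt α)) (hS : ∀ t, t ∈ S ↔ t ≤ a) :
    ∑ t ∈ S, pch t = 1 := by
  classical
  have haS : a ∈ S := (hS a).2 le_rfl
  rw [← Finset.add_sum_erase _ _ haS]
  have h1 : chainsTop a = (({[]} : Finset (List (Lam wt α))) ∪ (S.erase a).biUnion chainsTop).map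
      ⟨List.cons a, List.cons_injective⟩ := by
    ext b
    simp only [Finset.mem_map, Finset.mem_union, Finset.mem_singleton, Finset.mem_biUnion,
      Finset.mem_erase, mem_chainsTop, Function.Embedding.coeFn_mk]
    constructor
    · rintro ⟨hb, l, rfl⟩
      refine ⟨l, ?_, rfl⟩
      cases l with
      | nil => simp
      | cons t l =>
        right
        have h := (List.pairwise_cons.1 hb).1 t (by simp)
        exact ⟨t, ⟨h.ne, (hS t).2 h.le⟩, (List.pairwise_cons.1 hb).2, l, rfl⟩
    · rintro ⟨l, rfl | ⟨t, ⟨hta, htS⟩, hl, l, rfl⟩, rfl⟩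
      · exact ⟨by simp [lchain], [], rfl⟩
      · refine ⟨?_, _, rfl⟩
        have hlt : t < a := lt_of_le_of_ne ((hS t).1 htS) hta
        refine List.pairwise_cons.2 ⟨?_, hl⟩
        intro s hs
        rcases List.mem_cons.1 hs with rfl | hs
        · exact hlt
        · exact lt_trans ((List.pairwise_cons.1 hl).1 s hs) hlt
  have h2 : pch a = 1 - ∑ t ∈ S.erase a, pch t := by
    unfold pch
    rw [h1, Finset.sum_map, Finset.sum_union, Finset.sum_biUnion (chainsTop_disj _)]
    · simp [pow_succ]
      ring
    · rw [Finset.disjoint_left]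
      intro b hb hb'
      simp only [Finset.mem_singleton, Finset.mem_biUnion, mem_chainsTop] at hb hb'
      subst hb
      obtain ⟨_, _, _, _, h⟩ := hb'
      cases h
  rw [h2]; ring

open Classical in
/-- `pch` extended by zero -/
noncomputable def pfun (wt : (E → ℤ) →+ G) (α : G) (a : E → ℤ) : ℤ :=
  if h : 0 ≤ a ∧ wt a = α then pch (⟨a, h⟩ : Lam wt α) else 0

lemma pfun_support {a : E → ℤ} (h : pfun wt α a ≠ 0) : 0 ≤ a ∧ wt a = α := by
  unfold pfun at h
  by_contra h'
  rw [dif_neg h'] at h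
  exact h rfl

open Classical in
lemma pfun_sum (v : E → ℤ) (hv : wt v = α) (T : Finset (E → ℤ))
    (hT : ∀ a, 0 ≤ a → wt a = α → (a ∈ T ↔ a ≤ v)) :
    ∑ a ∈ T, pfun wt α a = if 0 ≤ v then 1 else 0 := by
  split_ifs with h0
  · have hfin := lt_finite (⟨v, h0, hv⟩ : Lam wt α)
    rw [← pch_rec (⟨v, h0, hv⟩ : Lam wt α) hfin.toFinset (by simp)]
    symm
    refine Finset.sum_of_injOn Subtype.val Subtype.val_injective.injOn ?_ ?_ ?_
    · intro t ht
      have : t ≤ (⟨v, h0, hv⟩ : Lam wt α) := by simpa using ht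
      exact (hT t.1 t.2.1 t.2.2).2 this
    · intro a haT ha
      by_contra hne
      have h := pfun_support hne
      apply ha
      exact ⟨⟨a, h⟩, by simpa using show (⟨a, h⟩ : Lam wt α) ≤ ⟨v, h0, hv⟩ from (hT a h.1 h.2).1 haT, rfl⟩
    · intro t _
      simp [pfun, t.2]
  · apply Finset.sum_eq_zero
    intro a ha
    by_contra hne
    have h := pfun_support hne
    exact h0 (h.1.trans ((hT a h.1 h.2).1 ha))

/-- the Koszul function -/
noncomputable def kk (w : E → ℤ) : ℤ := kap ε (Finset.univ.toList) w

omit [Fintype E] in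
lemma kk_bad (hε : ∀ y, 0 ≤ ε y) {w : E → ℤ} (h : kk ε w ≠ 0) : ¬ GoodV ε w := by
  rintro ⟨y, hy⟩
  exact h (kap_good ε _ y (by simp) hε w hy)

omit [Fintype E] [Fintype Yt] in
lemma kap_lower (ys : List Yt) (hε : ∀ y, 0 ≤ ε y) {w : E → ℤ} (h : kap ε ys w ≠ 0) :
    0 ≤ w + (ys.map ε).sum := by
  induction ys generalizing w with
  | nil =>
    simp only [kap] at h
    simp only [List.map_nil, List.sum_nil, add_zero]
    by_contra h'
    rw [if_neg h'] at h
    exact h rfl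
  | cons y ys ih =>
    simp only [kap] at h
    simp only [List.map_cons, List.sum_cons]
    by_cases h1 : kap ε ys w = 0
    · have : kap ε ys (w + ε y) ≠ 0 := by
        intro h2; rw [h1, h2] at h; simp at h
      have := ih this
      rwa [add_assoc] at this
    · refine (ih h1).trans ?_
      have := hε y
      intro e
      have := this e
      simp only [Pi.add_apply, Pi.zero_apply] at this ⊢
      linarith

lemma kk_finite (hε : ∀ y, 0 ≤ ε y)
    (H1 : ∀ m : E → ℤ, 0 ≤ m → wt m = 0 → m ≠ 0 → ∃ y, ε y ≤ m) (β : G) :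
    {w | wt w = β ∧ kk ε w ≠ 0}.Finite := by
  apply (bad_finite ε hε H1 β (-(Finset.univ.toList.map ε).sum)).subset
  rintro w ⟨h1, h2⟩
  refine ⟨h1, ?_, kk_bad ε hε h2⟩
  have := kap_lower ε _ hε h2
  rwa [neg_le_iff_add_nonneg]

/-- identity (2) -/
theorem koszul_pfun {k : Type*} [Field k] (hε : ∀ y, 0 ≤ ε y) (hwt : ∀ y, wt (ε y) = 0)
    (H1 : ∀ m : E → ℤ, 0 ≤ m → wt m = 0 → m ≠ 0 → ∃ y, ε y ≤ m)
    (hex : ∀ u, wt u = 0 → Ex2 k wt α u) (u : E → ℤ) (hu : wt u = 0)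
    (T : Finset (E → ℤ)) (hT : ∀ a, 0 ≤ a → wt a = α → kk ε (u + a) ≠ 0 → a ∈ T) :
    ∑ a ∈ T, pfun wt α a * kk ε (u + a) = kk ε u := by
  classical
  have hFfin : {t : Lam wt α | ¬ GoodV ε (u + t.1)}.Finite := by
    apply Set.Finite.of_finite_image (f := fun t => u + t.1)
    · apply (bad_finite ε hε H1 α u).subset
      rintro _ ⟨t, ht, rfl⟩
      refine ⟨?_, ?_, ht⟩
      · simp [hu, t.2.2]
      · exact le_add_of_nonneg_right t.2.1
    · intro a _ b _ h
      exact Subtype.ext (by simpa using h)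
  have hBfin : {b : List (Lam wt α) | lchain b ∧ ¬ GoodV ε (u + ltop b)}.Finite := by
    apply (lists_finite _ hFfin).subset
    rintro b ⟨hb, hg⟩
    refine ⟨hb, fun t ht => ?_⟩
    intro h
    apply hg
    refine GoodV.mono ε ?_ h
    have := ltop_mono hb (List.singleton_sublist.2 ht)
    exact add_le_add_right this u
  have hid := koszul_identity (k := k) ε hε hwt hex Finset.univ.toList (Finset.nodup_toList _) (by simp)
    u hu hBfin.toFinset (by simp)
  have hsplit : hBfin.toFinset = (if GoodV ε u then (∅ : Finset (List (Lam wt α))) else {[]}) ∪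
      hFfin.toFinset.biUnion chainsTop := by
    ext b
    simp only [Set.Finite.mem_toFinset, Set.mem_setOf_eq, Finset.mem_union, Finset.mem_biUnion,
      mem_chainsTop]
    constructor
    · rintro ⟨hb, hg⟩
      cases b with
      | nil => left; rw [if_neg (by simpa using hg)]; simp
      | cons t l => exact Or.inr ⟨t, by simpa using hg, hb, l, rfl⟩
    · rintro (h | ⟨t, ht, hb, l, rfl⟩)
      · split_ifs at h with h'
        · simp at h
        · simp only [Finset.mem_singleton] at h
          subst h
          exact ⟨by simp [lchain], by simpa using h'⟩
      · exact ⟨hb, by simpa using ht⟩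
  rw [hsplit, Finset.sum_union, Finset.sum_biUnion (chainsTop_disj _)] at hid
  · have e1 : ∑ b ∈ (if GoodV ε u then (∅ : Finset (List (Lam wt α))) else {[]}),
        (-1 : ℤ) ^ b.length * kap ε Finset.univ.toList (u + ltop b) = kk ε u := by
      split_ifs with h
      · by_contra hne
        exact kk_bad ε hε (by simpa using Ne.symm hne) h
      · simp [kk]
    have e2 : ∑ t ∈ hFfin.toFinset, ∑ b ∈ chainsTop t,
        (-1 : ℤ) ^ b.length * kap ε Finset.univ.toList (u + ltop b) =
        - ∑ a ∈ T, pfun wt α a * kk ε (u + a) := by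
      have : ∀ t ∈ hFfin.toFinset, ∑ b ∈ chainsTop t,
        (-1 : ℤ) ^ b.length * kap ε Finset.univ.toList (u + ltop b) = - (pch t * kk ε (u + t.1)) := by
        intro t _
        unfold pch
        rw [neg_mul, neg_neg, Finset.sum_mul]
        apply Finset.sum_congr rfl
        intro b hb
        rw [mem_chainsTop] at hb
        obtain ⟨_, l, rfl⟩ := hb
        rfl
      rw [Finset.sum_congr rfl this, Finset.sum_neg_distrib]
      congr 1
      rw [← Finset.sum_filter_of_ne (s := hFfin.toFinset) (p := fun t => kk ε (u + t.1) ≠ 0)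
        (fun t _ h h' => h (by rw [h', mul_zero]))]
      refine Finset.sum_of_injOn Subtype.val Subtype.val_injective.injOn ?_ ?_ ?_
      · intro t ht
        have : kk ε (u + t.1) ≠ 0 := by
          have h := Finset.mem_coe.1 ht
          exact (Finset.mem_filter.1 h).2
        exact hT t.1 t.2.1 t.2.2 this
      · intro a haT ha
        by_contra hne
        have h := pfun_support (left_ne_zero_of_mul hne)
        apply ha
        refine ⟨⟨a, h⟩, ?_, rfl⟩
        rw [Finset.mem_coe, Finset.mem_filter]
        exact ⟨by simpa using kk_bad ε hε (right_ne_zero_of_mul hne), right_ne_zero_of_mul hne⟩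
      · intro t _
        simp [pfun, t.2]
    rw [e1, e2] at hid
    linarith
  · rw [Finset.disjoint_left]
    intro b hb hb'
    simp only [Finset.mem_biUnion, mem_chainsTop] at hb'
    obtain ⟨t, _, _, l, rfl⟩ := hb'
    split_ifs at hb with h <;> simp at hb
end fin

section partE
variable {E : Type} [Fintype E] {G : Type} [AddCommGroup G] {wt : (E → ℤ) →+ G} {α : G}
variable {Yt : Type} [Fintype Yt] (ε : Yt → E → ℤ)

lemma kk_neg_of_alpha (hε : ∀ y, 0 ≤ ε y)
    (H1 : ∀ m : E → ℤ, 0 ≤ m → wt m = 0 → m ≠ 0 → ∃ y, ε y ≤ m)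
    (hD : ∀ u : E → ℤ, wt u = 0 → (∃ e, 0 ≤ u e) → kk ε u = 0)
    (h2 : ∀ (u : E → ℤ), wt u = 0 → ∀ (T : Finset (E → ℤ)),
      (∀ a, 0 ≤ a → wt a = α → kk ε (u + a) ≠ 0 → a ∈ T) →
      ∑ a ∈ T, pfun wt α a * kk ε (u + a) = kk ε u)
    (hz : ∀ e, ∃ f : E → ℤ, 0 ≤ f ∧ wt f = α ∧ f e = 0)
    (w : E → ℤ) (hw : wt w = α) (e : E) (he : 0 ≤ w e) : kk ε w = 0 := by
  classical
  by_contra hne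
  set S := (kk_finite ε hε H1 α).toFinset with hS
  have hmemS : ∀ x, x ∈ S ↔ wt x = α ∧ kk ε x ≠ 0 := by intro x; simp [hS]
  obtain ⟨w1, hw1, hmax1⟩ := S.exists_max_image (fun w => w e) ⟨w, (hmemS w).2 ⟨hw, hne⟩⟩
  set M := w1 e with hM
  have hM0 : 0 ≤ M := he.trans (hmax1 w ((hmemS w).2 ⟨hw, hne⟩))
  obtain ⟨w2, hw2, hmax2⟩ := (S.filter (fun w => w e = M)).exists_max_image (fun w => ∑ e, w e)
    ⟨w1, by simp [hw1, hM]⟩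
  set B := S.filter (fun w => w e = M ∧ ∑ e, w e = ∑ e, w2 e) with hB
  -- A
  have hAex : ∃ d : ℕ, ∃ a, pfun wt α a ≠ 0 ∧ a e = 0 ∧ ∑ e, a e = (d : ℤ) := by
    obtain ⟨f, hf0, hfα, hfe⟩ := hz e
    have hs := pfun_sum (wt := wt) f hfα (Finset.Icc 0 f) (by intro a h0 _; simp [h0])
    rw [if_pos hf0] at hs
    obtain ⟨a, ha, hpa⟩ := Finset.exists_ne_zero_of_sum_ne_zero (by rw [hs]; exact one_ne_zero)
    have hab := Finset.mem_Icc.1 ha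
    refine ⟨(∑ e, a e).toNat, a, hpa, ?_, ?_⟩
    · have h1 : 0 ≤ a e := hab.1 e
      have h2 : a e ≤ f e := hab.2 e
      rw [hfe] at h2
      omega
    · rw [Int.toNat_of_nonneg]
      exact Finset.sum_nonneg fun i _ => hab.1 i
  set d := Nat.find hAex with hd
  obtain ⟨a1, ha1, ha1e, ha1d⟩ := Nat.find_spec hAex
  have hAmin : ∀ a, pfun wt α a ≠ 0 → a e = 0 → (d : ℤ) ≤ ∑ e, a e := by
    intro a ha hae
    have hnn : 0 ≤ ∑ e, a e := Finset.sum_nonneg fun i _ => (pfun_support ha).1 i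
    have := Nat.find_min' hAex ⟨a, ha, hae, (Int.toNat_of_nonneg hnn).symm⟩
    rw [← hd] at this
    omega
  set A := (Finset.Icc (0 : E → ℤ) (fun _ => (d : ℤ))).filter
    (fun a => pfun wt α a ≠ 0 ∧ a e = 0 ∧ ∑ e, a e = (d : ℤ)) with hA
  have hmemA : ∀ a, a ∈ A ↔ pfun wt α a ≠ 0 ∧ a e = 0 ∧ ∑ e, a e = (d : ℤ) := by
    intro a
    rw [hA, Finset.mem_filter]
    constructor
    · exact fun h => h.2
    · intro h
      refine ⟨?_, h⟩
      have h0 := (pfun_support h.1).1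
      rw [Finset.mem_Icc]
      refine ⟨h0, fun i => ?_⟩
      rw [← h.2.2]
      exact Finset.single_le_sum (f := a) (fun j _ => h0 j) (Finset.mem_univ i)
  obtain ⟨na, hna, ws, hws, huniq⟩ := UniqueSums.uniqueAdd_of_nonempty
    (A := A.image (fun a => -a)) (B := B)
    ⟨-a1, Finset.mem_image_of_mem _ ((hmemA a1).2 ⟨ha1, ha1e, ha1d⟩)⟩
    ⟨w2, by
      rw [hB, Finset.mem_filter]
      have := Finset.mem_filter.1 hw2
      exact ⟨this.1, this.2, rfl⟩⟩
  obtain ⟨as, has, rfl⟩ := Finset.mem_image.1 hna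
  have has' := (hmemA as).1 has
  have hws' := Finset.mem_filter.1 hws
  have hwsS := (hmemS ws).1 hws'.1
  have hasS := pfun_support has'.1
  set u := ws - as with hu
  have hwtu : wt u = 0 := by rw [hu, map_sub, hwsS.1, hasS.2, sub_self]
  have hue : u e = M := by rw [hu, Pi.sub_apply, hws'.2.1, has'.2.1, sub_zero]
  have hku := hD u hwtu ⟨e, by rw [hue]; exact hM0⟩
  have hsum := h2 u hwtu (S.image (fun x => x - u)) (by
    intro a _ haα hka
    rw [Finset.mem_image]
    exact ⟨u + a, (hmemS _).2 ⟨by simp [hwtu, haα], hka⟩, by simp⟩)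
  rw [hku, Finset.sum_eq_single as] at hsum
  · rw [hu, sub_add_cancel] at hsum
    rcases mul_eq_zero.1 hsum with h | h
    · exact has'.1 h
    · exact hwsS.2 h
  · intro a _ hane
    by_contra hnz
    have hpa := left_ne_zero_of_mul hnz
    have hka := right_ne_zero_of_mul hnz
    have haS := pfun_support hpa
    have huaS : u + a ∈ S := (hmemS _).2 ⟨by simp [hwtu, haS.2], hka⟩
    have hae : a e = 0 := by
      have h1 := hmax1 _ huaS
      have h2 := haS.1 e
      simp only [Pi.add_apply, Pi.zero_apply] at h1 h2
      omega
    have huaM : (u + a) e = M := by simp [hae, hue]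
    have t1 := hAmin a hpa hae
    have t2 := hmax2 (u + a) (by simp [huaS, huaM])
    have t3 : ∑ e, (u + a) e = ∑ e, ws e - ∑ e, as e + ∑ e, a e := by
      simp [hu, Finset.sum_add_distrib]
    have haA : a ∈ A := (hmemA a).2 ⟨hpa, hae, by
      have := hws'.2.2; have := has'.2.2
      omega⟩
    have huaB : u + a ∈ B := by
      rw [hB, Finset.mem_filter]
      refine ⟨huaS, huaM, ?_⟩
      have := hws'.2.2; have := has'.2.2; have := ((hmemA a).1 haA).2.2
      omega
    have := huniq (Finset.mem_image_of_mem _ haA) huaB (by rw [hu]; abel)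
    exact hane (neg_injective this.1)
  · intro h
    exfalso
    apply h
    rw [Finset.mem_image]
    exact ⟨ws, hws'.1, by simp [hu]⟩

omit [Fintype E] [Fintype Yt] in
lemma kap_shift (hε : ∀ y, 0 ≤ ε y) (hne : ∀ y, ε y ≠ 0) (hwt : ∀ y, wt (ε y) = 0) (n : ℕ)
    (ys : List Yt) : ∃ S : List (E → ℤ), (∀ v ∈ S, 0 ≤ v ∧ v ≠ 0 ∧ wt v = 0) ∧
      ∀ w, kap (fun y => (n + 1) • ε y) ys w = kap ε ys w + (S.map (fun v => kap ε ys (w + v))).sum := by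
  induction ys with
  | nil => exact ⟨[], by simp, by simp [kap]⟩
  | cons y ys ih =>
    obtain ⟨S, hS, hsum⟩ := ih
    have tel : ∀ (n : ℕ) (w : E → ℤ), kap ε ys w - kap ε ys (w + n • ε y) =
        ((List.range n).map (fun s => kap ε (y :: ys) (w + s • ε y))).sum := by
      intro n w
      induction n with
      | zero => simp
      | succ n ih =>
        rw [List.range_succ, List.map_append, List.sum_append, ← ih]
        simp only [kap, List.map_cons, List.map_nil, List.sum_cons, List.sum_nil, add_zero]
        rw [add_assoc w, ← succ_nsmul]
        ring
    refine ⟨((List.range n).map (fun s => (s + 1) • ε y)) ++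
      S.flatMap (fun v => (List.range (n + 1)).map (fun s => v + s • ε y)), ?_, ?_⟩
    · intro v hv
      rw [List.mem_append] at hv
      rcases hv with hv | hv
      · obtain ⟨s, _, rfl⟩ := List.mem_map.1 hv
        refine ⟨nsmul_nonneg (hε y) _, ?_, by rw [map_nsmul, hwt, smul_zero]⟩
        exact smul_ne_zero (Nat.succ_ne_zero s) (hne y)
      · obtain ⟨v, hvS, hv⟩ := List.mem_flatMap.1 hv
        obtain ⟨s, _, rfl⟩ := List.mem_map.1 hv
        obtain ⟨h0, h1, h2⟩ := hS v hvS
        refine ⟨add_nonneg h0 (nsmul_nonneg (hε y) _), ?_, by rw [map_add, map_nsmul, hwt, h2, smul_zero, add_zero]⟩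
        intro h
        apply h1
        apply le_antisymm _ h0
        rw [← h]
        exact le_add_of_nonneg_right (nsmul_nonneg (hε y) _)
    · intro w
      have e1 : kap (fun y => (n + 1) • ε y) (y :: ys) w =
          kap (fun y => (n + 1) • ε y) ys w - kap (fun y => (n + 1) • ε y) ys (w + (n + 1) • ε y) := rfl
      rw [e1, hsum, hsum, List.map_append, List.sum_append, List.map_map]
      have e2 : kap ε ys w - kap ε ys (w + (n + 1) • ε y) = kap ε (y :: ys) w +
          (List.map ((fun v => kap ε (y :: ys) (w + v)) ∘ fun s => (s + 1) • ε y) (List.range n)).sum := by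
        rw [tel, List.range_succ_eq_map, List.map_cons, List.sum_cons, List.map_map]
        simp [Function.comp_def]
      have e3 : (S.map (fun v => kap ε ys (w + v))).sum -
          (S.map (fun v => kap ε ys (w + (n + 1) • ε y + v))).sum =
          (List.map (fun v => kap ε (y :: ys) (w + v)) (List.flatMap
            (fun v => (List.range (n + 1)).map (fun s => v + s • ε y)) S)).sum := by
        clear hS hsum e2
        induction S with
        | nil => simp
        | cons v S ih =>
          simp only [List.map_cons, List.sum_cons, List.flatMap_cons, List.map_append, List.sum_append]
          rw [← ih, List.map_map]
          have := tel (n + 1) (w + v)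
          rw [add_right_comm w v] at this
          have e4 : (List.map ((fun v => kap ε (y :: ys) (w + v)) ∘ fun s => v + s • ε y)
              (List.range (n + 1))) =
            (List.map (fun s => kap ε (y :: ys) (w + v + s • ε y)) (List.range (n+1))) := by
            apply List.map_congr_left
            intro s _
            simp [add_assoc]
          rw [e4, ← this]
          ring
      rw [← e3]
      linarith [e2]

omit [Fintype E] [Fintype Yt] in
lemma kap_const (hε : ∀ y, 0 ≤ ε y) (hε1 : ∀ y, ε y ≤ 1) (n : ℕ) (ys : List Yt) (w w' : E → ℤ)
    (h : ∀ e, (0 ≤ w e ∧ 0 ≤ w' e) ∨ (-((n : ℤ) + 1) ≤ w e ∧ w e < 0 ∧ w' e = -1)) :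
    kap (fun y => (n + 1) • ε y) ys w = kap ε ys w' := by
  induction ys generalizing w w' with
  | nil =>
    simp only [kap]
    congr 1
    apply propext
    constructor
    · intro h0 e
      have := h0 e
      have := h e
      simp only [Pi.zero_apply] at *
      omega
    · intro h0 e
      have := h0 e
      have := h e
      simp only [Pi.zero_apply] at *
      omega
  | cons y ys ih =>
    simp only [kap]
    rw [ih w w' h, ih (w + (n+1) • ε y) (w' + ε y)]
    intro e
    have h1 := h e
    have h2 := hε y e
    have h3 := hε1 y e
    simp only [Pi.zero_apply, Pi.one_apply] at h2 h3
    rw [Pi.add_apply, Pi.add_apply, Pi.smul_apply, nsmul_eq_mul]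
    push_cast
    have : ε y e = 0 ∨ ε y e = 1 := by omega
    rcases this with h | h
    · rw [h]; simpa using h1
    · rw [h]; simp only [mul_one]; left; omega

omit [Fintype E] [Fintype Yt] in
lemma kap_min (hε : ∀ y, 0 ≤ ε y) (hne : ∀ y, ε y ≠ 0) (ys : List Yt) :
    kap ε ys (-(ys.map ε).sum) ≠ 0 := by
  induction ys with
  | nil => simp [kap]
  | cons y ys ih =>
    simp only [kap, List.map_cons, List.sum_cons]
    have h1 : kap ε ys (-(ε y + (ys.map ε).sum)) = 0 := by
      by_contra h
      have := kap_lower ε ys hε h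
      rw [neg_add, neg_add_cancel_right] at this
      exact hne y (le_antisymm (neg_nonneg.1 this) (hε y))
    rw [h1, zero_sub, neg_add, neg_add_cancel_comm]
    exact neg_ne_zero.2 ih

theorem partE_d (hε : ∀ y, 0 ≤ ε y) (hε1 : ∀ y, ε y ≤ 1) (hne : ∀ y, ε y ≠ 0)
    (hwt : ∀ y, wt (ε y) = 0)
    (H1 : ∀ m : E → ℤ, 0 ≤ m → wt m = 0 → m ≠ 0 → ∃ y, ε y ≤ m)
    (hD : ∀ u : E → ℤ, wt u = 0 → (∃ e, 0 ≤ u e) → kk ε u = 0)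
    (h2 : ∀ (u : E → ℤ), wt u = 0 → ∀ (T : Finset (E → ℤ)),
      (∀ a, 0 ≤ a → wt a = α → kk ε (u + a) ≠ 0 → a ∈ T) →
      ∑ a ∈ T, pfun wt α a * kk ε (u + a) = kk ε u)
    (hz : ∀ e, ∃ f : E → ℤ, 0 ≤ f ∧ wt f = α ∧ f e = 0)
    (v : E → ℤ) (hv : wt v = wt (-1)) (hv0 : 0 ≤ v) (T : Finset (E → ℤ))
    (hT : ∀ a, 0 ≤ a → wt a = α → (a ∈ T ↔ a ≤ v)) :
    ∑ a ∈ T, pfun wt α a = 1 := by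
  classical
  have hA := kk_neg_of_alpha ε hε H1 hD h2 hz
  set c0 := kk ε (-1) with hc0
  -- general consequence
  have hneg : ∀ (n : ℕ) (w : E → ℤ), (∀ e, -((n:ℤ)+1) ≤ w e ∧ w e < 0) →
      kap (fun y => (n + 1) • ε y) Finset.univ.toList w = c0 := by
    intro n w hw
    apply kap_const ε hε hε1
    intro e
    exact Or.inr ⟨(hw e).1, (hw e).2, rfl⟩
  have hc : c0 ≠ 0 := by
    set S0 := (kk_finite ε hε H1 (0 : G)).toFinset with hS0
    have hmem : ∀ x, x ∈ S0 ↔ wt x = 0 ∧ kk ε x ≠ 0 := by intro x; simp [hS0]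
    obtain ⟨us, hus⟩ := S0.exists_maximal ⟨-(Finset.univ.toList.map ε).sum, (hmem _).2 ⟨by
      rw [map_neg, map_list_sum, List.map_map, neg_eq_zero]
      apply List.sum_eq_zero
      intro x hx
      obtain ⟨y, _, rfl⟩ := List.mem_map.1 hx
      exact hwt y, kap_min ε hε hne _⟩⟩
    have husS := (hmem us).1 hus.1
    have husn : ∀ e, us e < 0 := by
      intro e
      by_contra h
      exact husS.2 (hD us husS.1 ⟨e, by omega⟩)
    set n := ∑ e, (us e).natAbs with hn
    obtain ⟨S, hS, hsum⟩ := kap_shift (wt := wt) ε hε hne hwt n Finset.univ.toList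
    have h1 := hsum us
    rw [hneg n us (by
      intro e
      refine ⟨?_, husn e⟩
      have : (us e).natAbs ≤ n := Finset.single_le_sum (f := fun e => (us e).natAbs)
        (fun _ _ => Nat.zero_le _) (Finset.mem_univ e)
      omega)] at h1
    have h2 : (S.map (fun v => kap ε Finset.univ.toList (us + v))).sum = 0 := by
      apply List.sum_eq_zero
      intro x hx
      obtain ⟨v, hv, rfl⟩ := List.mem_map.1 hx
      obtain ⟨hv0, hvne, hvw⟩ := hS v hv
      by_contra hk
      have hmm : us + v ∈ S0 := (hmem _).2 ⟨by simp [husS.1, hvw], hk⟩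
      have := hus.2 hmm (le_add_of_nonneg_right hv0)
      apply hvne
      apply le_antisymm _ hv0
      simpa using this
    rw [h2, add_zero] at h1
    rw [h1]
    exact husS.2
  -- main
  set u : E → ℤ := -1 - v with hu
  have hwu : wt u = 0 := by rw [hu, map_sub, hv, sub_self]
  set n := ∑ e, (u e).natAbs with hn
  have hnu : ∀ e, -((n:ℤ)+1) ≤ u e := by
    intro e
    have : (u e).natAbs ≤ n := Finset.single_le_sum (f := fun e => (u e).natAbs)
        (fun _ _ => Nat.zero_le _) (Finset.mem_univ e)
    omega
  obtain ⟨S, hS, hsum⟩ := kap_shift (wt := wt) ε hε hne hwt n Finset.univ.toList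
  have hfinS := kk_finite ε hε H1 α
  -- big T
  set T' : Finset (E → ℤ) := (hfinS.toFinset.image (fun x => x - u)) ∪
    (S.toFinset.biUnion (fun s => hfinS.toFinset.image (fun x => x - (u + s)))) ∪ T with hT'
  have hT1 : ∀ a, 0 ≤ a → wt a = α → kk ε (u + a) ≠ 0 → a ∈ T' := by
    intro a _ ha hk
    apply Finset.mem_union_left
    apply Finset.mem_union_left
    rw [Finset.mem_image]
    exact ⟨u + a, by simp [hwu, ha, hk], by simp⟩
  have hT2 : ∀ s ∈ S, ∀ a, 0 ≤ a → wt a = α → kk ε (u + s + a) ≠ 0 → a ∈ T' := by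
    intro s hs a _ ha hk
    apply Finset.mem_union_left
    apply Finset.mem_union_right
    rw [Finset.mem_biUnion]
    refine ⟨s, by simpa using hs, ?_⟩
    rw [Finset.mem_image]
    exact ⟨u + s + a, by simp [hwu, ha, hk, (hS s hs).2.2], by simp⟩
  have hsumT : ∑ a ∈ T', pfun wt α a * kap (fun y => (n + 1) • ε y) Finset.univ.toList (u + a) =
      kap (fun y => (n + 1) • ε y) Finset.univ.toList u := by
    rw [hsum u]
    have : ∀ a ∈ T', pfun wt α a * kap (fun y => (n + 1) • ε y) Finset.univ.toList (u + a) =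
        pfun wt α a * kk ε (u + a) + (S.map (fun s => pfun wt α a * kk ε (u + s + a))).sum := by
      intro a _
      rw [hsum, mul_add, List.sum_map_mul_left]
      simp only [kk]
      congr 3
      apply List.map_congr_left
      intro s _
      rw [add_right_comm]
    rw [Finset.sum_congr rfl this, Finset.sum_add_distrib, h2 u hwu T' hT1]
    congr 1
    clear this hsum
    have hgen : ∀ S' : List (E → ℤ), (∀ s ∈ S', s ∈ S) →
        ∑ a ∈ T', (S'.map (fun s => pfun wt α a * kk ε (u + s + a))).sum =
        (S'.map (fun s => kap ε Finset.univ.toList (u + s))).sum := by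
      intro S' hS'
      induction S' with
      | nil => simp
      | cons s S' ih =>
        simp only [List.map_cons, List.sum_cons, Finset.sum_add_distrib]
        rw [ih (fun x hx => hS' x (by simp [hx]))]
        congr 1
        have hs := hS' s (by simp)
        exact h2 (u + s) (by simp [hwu, (hS s hs).2.2]) T' (hT2 s hs)
    exact hgen S (fun _ h => h)
  rw [hneg n u (by
    intro e
    refine ⟨hnu e, ?_⟩
    have := hv0 e
    simp only [hu, Pi.sub_apply, Pi.neg_apply, Pi.one_apply, Pi.zero_apply] at this ⊢
    omega)] at hsumT
  have hterm : ∀ a ∈ T', pfun wt α a * kap (fun y => (n + 1) • ε y) Finset.univ.toList (u + a) =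
      if a ∈ T then pfun wt α a * c0 else 0 := by
    intro a _
    by_cases hp : pfun wt α a = 0
    · simp [hp]
    have hps := pfun_support hp
    simp only [hT a hps.1 hps.2]
    split_ifs with hav
    · rw [hneg]
      intro e
      have h1 := hnu e
      have h2 := hav e
      have h3 := hps.1 e
      simp only [hu, Pi.add_apply, Pi.sub_apply, Pi.neg_apply, Pi.one_apply, Pi.zero_apply] at *
      constructor <;> omega
    · obtain ⟨e, he⟩ : ∃ e, v e < a e := by
        by_contra h
        push Not at h
        exact hav h
      have hue : 0 ≤ (u + a) e := by
        simp only [hu, Pi.add_apply, Pi.sub_apply, Pi.neg_apply, Pi.one_apply]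
        omega
      rw [hsum]
      have z1 : kap ε Finset.univ.toList (u + a) = 0 := hA (u + a) (by simp [hwu, hps.2]) e hue
      rw [z1, zero_add]
      rw [List.sum_eq_zero, mul_zero]
      intro x hx
      obtain ⟨s, hs, rfl⟩ := List.mem_map.1 hx
      apply hA (u + a + s) (by simp [hwu, hps.2, (hS s hs).2.2]) e
      have := (hS s hs).1 e
      simp only [Pi.zero_apply] at this
      rw [Pi.add_apply]
      omega
  rw [Finset.sum_congr rfl hterm, ← Finset.sum_filter] at hsumT
  have hfilt : T'.filter (fun a => a ∈ T) = T := by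
    ext a
    simp only [Finset.mem_filter]
    exact ⟨fun h => h.2, fun h => ⟨Finset.mem_union_right _ h, h⟩⟩
  rw [hfilt, ← Finset.sum_mul] at hsumT
  exact mul_right_cancel₀ hc (by rw [hsumT, one_mul])

open Classical in
theorem star_count (hε : ∀ y, 0 ≤ ε y) (hε1 : ∀ y, ε y ≤ 1) (hne : ∀ y, ε y ≠ 0)
    (hwt : ∀ y, wt (ε y) = 0)
    (H1 : ∀ m : E → ℤ, 0 ≤ m → wt m = 0 → m ≠ 0 → ∃ y, ε y ≤ m)
    (hD : ∀ u : E → ℤ, wt u = 0 → (∃ e, 0 ≤ u e) → kk ε u = 0)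
    (h2 : ∀ (u : E → ℤ), wt u = 0 → ∀ (T : Finset (E → ℤ)),
      (∀ a, 0 ≤ a → wt a = α → kk ε (u + a) ≠ 0 → a ∈ T) →
      ∑ a ∈ T, pfun wt α a * kk ε (u + a) = kk ε u)
    (hz : ∀ e, ∃ f : E → ℤ, 0 ≤ f ∧ wt f = α ∧ f e = 0)
    (w : E → ℤ) (hw : wt w = wt (-1)) :
    ((Finset.Icc 0 w).filter (fun f => wt f = α)).card =
    ((Finset.Icc 0 w).filter (fun f => wt f = 0)).card := by
  have hd := partE_d ε hε hε1 hne hwt H1 hD h2 hz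
  have l : ((((Finset.Icc 0 w).filter (fun f => wt f = α)).card : ℕ) : ℤ) =
      ∑ a ∈ Finset.Icc 0 w, pfun wt α a *
        (((Finset.Icc 0 w).filter (fun f => wt f = α ∧ a ≤ f)).card : ℤ) := by
    have : ∀ f ∈ (Finset.Icc 0 w).filter (fun f => wt f = α),
        (1 : ℤ) = ∑ a ∈ Finset.Icc 0 w, if a ≤ f then pfun wt α a else 0 := by
      intro f hf
      rw [Finset.mem_filter, Finset.mem_Icc] at hf
      rw [← Finset.sum_filter]
      rw [pfun_sum f hf.2, if_pos hf.1.1]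
      intro a ha0 _
      simp only [Finset.mem_filter, Finset.mem_Icc]
      exact ⟨fun h => h.2, fun h => ⟨⟨ha0, h.trans hf.1.2⟩, h⟩⟩
    rw [Finset.card_eq_sum_ones]
    push_cast
    rw [Finset.sum_congr rfl this, Finset.sum_comm]
    apply Finset.sum_congr rfl
    intro a _
    rw [← Finset.sum_filter, Finset.filter_filter, Finset.sum_const, nsmul_eq_mul, mul_comm]
  have r : ((((Finset.Icc 0 w).filter (fun f => wt f = 0)).card : ℕ) : ℤ) =
      ∑ a ∈ Finset.Icc 0 w, pfun wt α a *
        (((Finset.Icc 0 w).filter (fun f => wt f = 0 ∧ a ≤ w - f)).card : ℤ) := by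
    have : ∀ f ∈ (Finset.Icc 0 w).filter (fun f => wt f = 0),
        (1 : ℤ) = ∑ a ∈ Finset.Icc 0 w, if a ≤ w - f then pfun wt α a else 0 := by
      intro f hf
      rw [Finset.mem_filter, Finset.mem_Icc] at hf
      rw [← Finset.sum_filter]
      rw [hd (w - f) (by rw [map_sub, hf.2, sub_zero, hw]) (sub_nonneg.2 hf.1.2)]
      intro a ha0 _
      simp only [Finset.mem_filter, Finset.mem_Icc]
      exact ⟨fun h => h.2, fun h => ⟨⟨ha0, h.trans (sub_le_self w hf.1.1)⟩, h⟩⟩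
    rw [Finset.card_eq_sum_ones]
    push_cast
    rw [Finset.sum_congr rfl this, Finset.sum_comm]
    apply Finset.sum_congr rfl
    intro a _
    rw [← Finset.sum_filter, Finset.filter_filter, Finset.sum_const, nsmul_eq_mul, mul_comm]
  have : ((((Finset.Icc 0 w).filter (fun f => wt f = α)).card : ℕ) : ℤ) =
      ((((Finset.Icc 0 w).filter (fun f => wt f = 0)).card : ℕ) : ℤ) := by
    rw [l, r]
    apply Finset.sum_congr rfl
    intro a _
    by_cases hp : pfun wt α a = 0
    · simp [hp]
    have hps := pfun_support hp
    congr 2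
    apply Finset.card_nbij' (fun f => f - a) (fun c => c + a)
    · intro f hf
      rw [Finset.mem_coe, Finset.mem_filter, Finset.mem_Icc] at hf ⊢
      refine ⟨⟨sub_nonneg.2 hf.2.2, (sub_le_self f hps.1).trans hf.1.2⟩, ?_, ?_⟩
      · rw [map_sub, hf.2.1, hps.2, sub_self]
      · rw [le_sub_iff_add_le, add_sub_cancel]; exact hf.1.2
    · intro f hf
      rw [Finset.mem_coe, Finset.mem_filter, Finset.mem_Icc] at hf ⊢
      have h := hf.2.2
      rw [le_sub_iff_add_le, add_comm] at h
      refine ⟨⟨add_nonneg hf.1.1 hps.1, h⟩, ?_, ?_⟩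
      · rw [map_add, hf.2.1, hps.2, zero_add]
      · exact le_add_of_nonneg_left hf.1.1
    · intro f _; simp
    · intro f _; simp
  exact_mod_cast this

end partE

section extgen
variable {R : Type} [CommRing R]

lemma ext_res {C Z : ModuleCat.{0} R} (P : ProjectiveResolution C) (n : ℕ)
    (h : Subsingleton (((Ext R (ModuleCat.{0} R) (n+1)).obj (Opposite.op C)).obj Z))
    (ψ : P.complex.X (n+1) ⟶ Z) (hψ : P.complex.d (n+2) (n+1) ≫ ψ = 0) :
    ∃ χ : P.complex.X n ⟶ Z, P.complex.d (n+1) n ≫ χ = ψ := by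
  have hz : Limits.IsZero ((P.complex.linearYonedaObj R Z).homology (n+1)) := by
    refine Limits.IsZero.of_iso ?_ (P.isoExt (n+1) Z).symm
    exact ModuleCat.isZero_of_subsingleton _
  rw [← HomologicalComplex.exactAt_iff_isZero_homology,
    HomologicalComplex.exactAt_iff' _ n (n+1) (n+2) (by simp) (by simp),
    ShortComplex.moduleCat_exact_iff] at hz
  obtain ⟨χ, hχ⟩ := hz ψ hψ
  exact ⟨χ, hχ⟩

lemma of_d' (F : ℕ → ModuleCat.{0} R) (d : ∀ n, F (n+1) ⟶ F n)
    (hd : ∀ n, d (n+1) ≫ d n = 0) (n : ℕ) : (ChainComplex.of F d hd).d (n+1) n = d n :=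
  ChainComplex.of_d F d n

noncomputable def mkRes (F : ℕ → ModuleCat.{0} R) [∀ n, Projective (F n)] (d : ∀ n, F (n+1) ⟶ F n)
    (C : ModuleCat.{0} R) (aug : F 0 ⟶ C)
    (hd : ∀ n, d (n+1) ≫ d n = 0) (ha : d 0 ≫ aug = 0)
    (hex : ∀ n (x : F (n+1)), d n x = 0 → ∃ y, d (n+1) y = x)
    (hex0 : ∀ x : F 0, aug x = 0 → ∃ y, d 0 y = x)
    (hsurj : Function.Surjective aug) : ProjectiveResolution C where
  complex := ChainComplex.of F d hd
  projective := fun n => by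
    show Projective (F n)
    infer_instance
  π := (ChainComplex.toSingle₀Equiv _ _).symm ⟨aug, by
    exact (congrArg (· ≫ aug) (of_d' F d hd 0)).trans ha⟩
  quasiIso := ⟨fun n => by
    cases n
    · rw [ChainComplex.quasiIsoAt₀_iff, ShortComplex.quasiIso_iff_of_zeros']
      · have hE : (ShortComplex.mk (d 0) aug ha).Exact := by
          rw [ShortComplex.moduleCat_exact_iff]
          exact hex0
        have : Epi aug := (ModuleCat.epi_iff_surjective _).2 hsurj
        refine (ShortComplex.exact_and_epi_g_iff_of_iso ?_).2 ⟨hE, this⟩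
        exact ShortComplex.isoMk (Iso.refl _) (Iso.refl _) (Iso.refl _)
          (by
            show 𝟙 (F 1) ≫ d 0 = (ChainComplex.of F d hd).d 1 0 ≫ 𝟙 (F 0)
            rw [Category.id_comp]
            exact (of_d' F d hd 0).symm.trans (Category.comp_id _).symm)
          (by
            refine (Category.id_comp aug).trans (Eq.trans ?_ (Category.comp_id _).symm)
            exact (ChainComplex.toSingle₀Equiv_symm_apply_f_zero (C := ChainComplex.of F d hd) aug _).symm)
      all_goals rfl
    · rename_i n
      rw [quasiIsoAt_iff_exactAt']
      · rw [HomologicalComplex.exactAt_iff' _ (n + 1 + 1) (n + 1) n (by simp) (by simp),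
          ShortComplex.moduleCat_exact_iff]
        intro x hx
        simp only [HomologicalComplex.sc', HomologicalComplex.shortComplexFunctor', ChainComplex.of_d] at hx ⊢
        exact hex n x hx
      · apply ChainComplex.exactAt_succ_single_obj⟩

lemma ext_mk (F : ℕ → ModuleCat.{0} R) [∀ n, Projective (F n)] (d : ∀ n, F (n+1) ⟶ F n)
    (C Z : ModuleCat.{0} R) (aug : F 0 ⟶ C)
    (hd : ∀ n, d (n+1) ≫ d n = 0) (ha : d 0 ≫ aug = 0)
    (hex : ∀ n (x : F (n+1)), d n x = 0 → ∃ y, d (n+1) y = x)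
    (hex0 : ∀ x : F 0, aug x = 0 → ∃ y, d 0 y = x)
    (hsurj : Function.Surjective aug) (n : ℕ)
    (h : Subsingleton (((Ext R (ModuleCat.{0} R) (n+1)).obj (Opposite.op C)).obj Z))
    (ψ : F (n+1) ⟶ Z) (hψ : d (n+1) ≫ ψ = 0) :
    ∃ χ : F n ⟶ Z, d n ≫ χ = ψ := by
  obtain ⟨χ, hχ⟩ := ext_res (mkRes F d C aug hd ha hex hex0 hsurj) n h ψ (by
    exact (congrArg (fun t : F (n+2) ⟶ F (n+1) => t ≫ ψ) (of_d' F d hd (n+1))).trans hψ)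
  exact ⟨χ, (congrArg (fun t : F (n+1) ⟶ F n => t ≫ (show F n ⟶ Z from χ))
    (of_d' F d hd n)).symm.trans hχ⟩
end extgen

section toric
variable {k : Type} [Field k] {E : Type} [Fintype E] {G : Type} [AddCommGroup G]

/-- exponents as integer vectors -/
def ofN (d : E →₀ ℕ) : E → ℤ := fun e => (d e : ℤ)
/-- integer vectors as exponents -/
noncomputable def toN (v : E → ℤ) : E →₀ ℕ := Finsupp.equivFunOnFinite.symm (fun e => (v e).toNat)

@[simp] lemma toN_apply (v : E → ℤ) (e : E) : toN v e = (v e).toNat := rfl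
omit [Fintype E] in
@[simp] lemma ofN_apply (d : E →₀ ℕ) (e : E) : ofN d e = (d e : ℤ) := rfl
omit [Fintype E] in
lemma ofN_nonneg (d : E →₀ ℕ) : 0 ≤ ofN d := fun e => by simp
omit [Fintype E] in
lemma ofN_add (d d' : E →₀ ℕ) : ofN (d + d') = ofN d + ofN d' := by ext e; simp
lemma toN_ofN (d : E →₀ ℕ) : toN (ofN d) = d := by ext e; simp
lemma ofN_toN {v : E → ℤ} (hv : 0 ≤ v) : ofN (toN v) = v := by
  ext e; simp [Int.toNat_of_nonneg (hv e)]
omit [Fintype E] in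
lemma ofN_inj {d d' : E →₀ ℕ} (h : ofN d = ofN d') : d = d' := by
  ext e; have := congrFun h e; simpa using this
lemma toN_add {v w : E → ℤ} (hv : 0 ≤ v) (hw : 0 ≤ w) : toN (v + w) = toN v + toN w := by
  apply ofN_inj
  rw [ofN_add, ofN_toN hv, ofN_toN hw, ofN_toN (add_nonneg hv hw)]

open Classical in
/-- monomials -/
noncomputable def zz (k : Type) [Field k] (v : E → ℤ) : MvPolynomial E k :=
  if 0 ≤ v then MvPolynomial.monomial (toN v) 1 else 0

open Classical in
/-- coefficients -/
noncomputable def cf (v : E → ℤ) (p : MvPolynomial E k) : k :=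
  if 0 ≤ v then p.coeff (toN v) else 0

lemma zz_pos {v : E → ℤ} (hv : 0 ≤ v) : zz k v = MvPolynomial.monomial (toN v) 1 := if_pos hv
lemma zz_ofN (d : E →₀ ℕ) : zz k (ofN d) = MvPolynomial.monomial d 1 := by
  rw [zz_pos (ofN_nonneg d), toN_ofN]
lemma cf_pos {v : E → ℤ} (hv : 0 ≤ v) (p : MvPolynomial E k) : cf v p = p.coeff (toN v) := if_pos hv
lemma cf_neg {v : E → ℤ} (hv : ¬ 0 ≤ v) (p : MvPolynomial E k) : cf v p = 0 := if_neg hv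
lemma cf_add (v : E → ℤ) (p q : MvPolynomial E k) : cf v (p + q) = cf v p + cf v q := by
  unfold cf; split_ifs <;> simp
lemma cf_smul (v : E → ℤ) (c : k) (p : MvPolynomial E k) : cf v (c • p) = c * cf v p := by
  unfold cf; split_ifs <;> simp
/-- additive version of `cf` -/
noncomputable def cfHom (v : E → ℤ) : MvPolynomial E k →+ k where
  toFun := cf v
  map_zero' := by unfold cf; split_ifs <;> simp
  map_add' := cf_add v
@[simp] lemma cfHom_apply (v : E → ℤ) (p : MvPolynomial E k) : cfHom v p = cf v p := rfl

lemma zz_add {v w : E → ℤ} (hv : 0 ≤ v) (hw : 0 ≤ w) : zz k (v + w) = zz k v * zz k w := by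
  rw [zz_pos hv, zz_pos hw, zz_pos (add_nonneg hv hw), toN_add hv hw, MvPolynomial.monomial_mul, one_mul]

lemma zz_ne_zero {v : E → ℤ} (hv : 0 ≤ v) : zz k v ≠ 0 := by
  rw [zz_pos hv]; simp

lemma zz_zero : zz k (0 : E → ℤ) = 1 := by
  rw [zz_pos le_rfl]
  have : toN (0 : E → ℤ) = 0 := by ext e; simp
  rw [this]; rfl

lemma cf_mul_zz {v : E → ℤ} (hv : 0 ≤ v) (w : E → ℤ) (hw : 0 ≤ v + w) (p : MvPolynomial E k) :
    cf (v + w) (zz k v * p) = cf w p := by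
  rw [cf_pos hw, zz_pos hv, MvPolynomial.coeff_monomial_mul']
  have key : toN v ≤ toN (v + w) ↔ 0 ≤ w := by
    constructor
    · intro h e
      have h1 := h e
      have h2 := hv e
      have h3 := hw e
      simp only [toN_apply, Pi.add_apply, Pi.zero_apply] at *
      omega
    · intro h
      rw [toN_add hv h]
      exact le_self_add
  split_ifs with h
  · rw [key] at h
    rw [cf_pos h, toN_add hv h, one_mul, add_tsub_cancel_left]
  · rw [key] at h
    rw [cf_neg h]

lemma cf_zz_self {v : E → ℤ} (hv : 0 ≤ v) : cf v (zz k v) = 1 := by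
  classical
  rw [cf_pos hv, zz_pos hv, MvPolynomial.coeff_monomial, if_pos rfl]

variable (wt : (E → ℤ) →+ G)

/-- homogeneous polynomials -/
def HomW (β : G) (p : MvPolynomial E k) : Prop := ∀ d ∈ p.support, wt (ofN d) = β

variable {wt}
omit [Fintype E] in
lemma HomW.add {β : G} {p q : MvPolynomial E k} (hp : HomW wt β p) (hq : HomW wt β q) :
    HomW wt β (p + q) := by
  classical
  intro d hd
  rcases Finset.mem_union.1 (MvPolynomial.support_add hd) with h | h
  · exact hp d h
  · exact hq d h

omit [Fintype E] in
lemma HomW.mul {β γ : G} {p q : MvPolynomial E k} (hp : HomW wt β p) (hq : HomW wt γ q) :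
    HomW wt (β + γ) (p * q) := by
  classical
  intro d hd
  obtain ⟨a, ha, b, hb, rfl⟩ := Finset.mem_add.1 (MvPolynomial.support_mul _ _ hd)
  rw [ofN_add, map_add, hp a ha, hq b hb]

omit [Fintype E] in
lemma HomW.zero {β : G} : HomW wt β (0 : MvPolynomial E k) := by
  intro d hd; simp at hd

omit [Fintype E] in
lemma HomW.smul {β : G} {p : MvPolynomial E k} (c : k) (hp : HomW wt β p) : HomW wt β (c • p) := by
  intro d hd
  exact hp d (MvPolynomial.support_smul hd)

lemma HomW.zz {v : E → ℤ} {β : G} (hv : wt v = β) : HomW wt β (zz k v) := by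
  classical
  unfold LadderDet.zz
  split_ifs with h
  · intro d hd
    have := MvPolynomial.support_monomial_subset hd
    rw [Finset.mem_singleton] at this
    rw [this, ofN_toN h, hv]
  · exact HomW.zero

/-- induction for homogeneous polynomials -/
lemma HomW.induction {β : G} {M : MvPolynomial E k → Prop} (h0 : M 0)
    (hadd : ∀ p q, HomW wt β p → HomW wt β q → M p → M q → M (p + q))
    (hz : ∀ (c : k) (v : E → ℤ), 0 ≤ v → wt v = β → M (c • LadderDet.zz k v)) (p : MvPolynomial E k)
    (hp : HomW wt β p) : M p := by
  classical
  have key : ∀ s : Finset (E →₀ ℕ), s ⊆ p.support →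
      HomW wt β (∑ d ∈ s, MvPolynomial.monomial d (p.coeff d)) ∧
      M (∑ d ∈ s, MvPolynomial.monomial d (p.coeff d)) := by
    intro s
    induction s using Finset.induction_on with
    | empty => intro _; simpa using ⟨HomW.zero, h0⟩
    | insert d s hd ih =>
      intro hs
      rw [Finset.sum_insert hd]
      have hds := hs (Finset.mem_insert_self d s)
      have ih := ih (fun x hx => hs (Finset.mem_insert_of_mem hx))
      have e : MvPolynomial.monomial d (p.coeff d) = (p.coeff d) • LadderDet.zz k (ofN d) := by
        rw [zz_ofN, MvPolynomial.smul_monomial, smul_eq_mul, mul_one]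
      have hh : HomW wt β (MvPolynomial.monomial d (p.coeff d)) := by
        rw [e]; exact (HomW.zz (hp d hds)).smul _
      refine ⟨hh.add ih.1, hadd _ _ hh ih.1 ?_ ih.2⟩
      rw [e]
      exact hz _ _ (ofN_nonneg d) (hp d hds)
  have := (key p.support subset_rfl).2
  rwa [← MvPolynomial.as_sum] at this

variable {R : Type} [CommRing R] [Algebra k R] [Algebra R (MvPolynomial E k)]
  [IsScalarTower k R (MvPolynomial E k)]

variable (k wt R) in
/-- toric presentation: `R` is the degree-zero part of the polynomial ring -/
structure Toric : Prop where
  inj : Function.Injective (algebraMap R (MvPolynomial E k))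
  range : ∀ p : MvPolynomial E k, HomW wt 0 p ↔ ∃ r : R, algebraMap R (MvPolynomial E k) r = p

lemma Toric.hom (hT : Toric k wt R) (r : R) : HomW wt 0 (algebraMap R (MvPolynomial E k) r) :=
  (hT.range _).2 ⟨r, rfl⟩

/-- the weight `α` part -/
def Sa (hT : Toric k wt R) (α : G) : Submodule R (MvPolynomial E k) where
  carrier := {p | HomW wt α p}
  add_mem' := fun h h' => HomW.add h h'
  zero_mem' := HomW.zero
  smul_mem' := by
    intro r p hp
    show HomW wt α (r • p)
    rw [Algebra.smul_def]
    have := (hT.hom r).mul (show HomW wt α p from hp)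
    rwa [zero_add] at this

lemma mem_Sa {hT : Toric k wt R} {α : G} {p : MvPolynomial E k} : p ∈ Sa hT α ↔ HomW wt α p := Iff.rfl

open Classical in
/-- monomials in `R` -/
noncomputable def zr (hT : Toric k wt R) (v : E → ℤ) : R :=
  if h : 0 ≤ v ∧ wt v = 0 then ((hT.range (zz k v)).1 (HomW.zz h.2)).choose else 0

lemma zr_spec (hT : Toric k wt R) {v : E → ℤ} (h0 : 0 ≤ v) (hv : wt v = 0) :
    algebraMap R (MvPolynomial E k) (zr hT v) = zz k v := by
  unfold zr
  rw [dif_pos ⟨h0, hv⟩]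
  exact ((hT.range (zz k v)).1 (HomW.zz hv)).choose_spec

lemma toric_induction (hT : Toric k wt R) {M : R → Prop} (h0 : M 0)
    (hadd : ∀ p q, M p → M q → M (p + q))
    (hz : ∀ (c : k) (v : E → ℤ), 0 ≤ v → wt v = 0 → M (c • zr hT v)) (r : R) : M r := by
  have key := HomW.induction (wt := wt) (β := 0) (k := k)
    (M := fun p => ∀ r : R, algebraMap R (MvPolynomial E k) r = p → M r) ?_ ?_ ?_
    (algebraMap R _ r) (hT.hom r)
  · exact key r rfl
  · intro r hr
    have : r = 0 := hT.inj (by rw [hr, map_zero])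
    rwa [this]
  · intro p q hp hq hMp hMq r hr
    obtain ⟨a, rfl⟩ := (hT.range p).1 hp
    obtain ⟨b, rfl⟩ := (hT.range q).1 hq
    rw [← map_add] at hr
    rw [hT.inj hr]
    exact hadd a b (hMp a rfl) (hMq b rfl)
  · intro c v hv hw r hr
    have : r = c • zr hT v := hT.inj (by
      rw [hr, ← zr_spec hT hv hw, algebraMap_smul_eq hT c])
    rw [this]
    exact hz c v hv hw
where
  algebraMap_smul_eq (hT : Toric k wt R) (c : k) {r : R} :
      c • algebraMap R (MvPolynomial E k) r = algebraMap R (MvPolynomial E k) (c • r) := by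
    rw [Algebra.algebraMap_eq_smul_one, Algebra.algebraMap_eq_smul_one, smul_assoc]

end toric

section chainres
set_option linter.unusedSectionVars false
variable {k : Type} [Field k] {E : Type} [Fintype E] {G : Type} [AddCommGroup G]
variable {wt : (E → ℤ) →+ G}
variable {R : Type} [CommRing R] [Algebra k R] [Algebra R (MvPolynomial E k)]
  [IsScalarTower k R (MvPolynomial E k)]
variable (hT : Toric k wt R) (α : G)

lemma ldel_mem {X A B : Type*} [AddCommGroup A] [Ring B] [Module B A] (M : Submodule B A) (f : List X → A)
    (l : List X) (h : ∀ l', l'.Sublist l → l'.length + 1 = l.length → f l' ∈ M) : ldel f l ∈ M := by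
  rw [← Submodule.Quotient.mk_eq_zero M]
  have := ldel_map (M.mkQ.toAddMonoidHom) f l
  refine Eq.trans this (ldel_eq_zero _ _ fun lq h1 h2 => ?_)
  exact (Submodule.Quotient.mk_eq_zero M).2 (h lq h1 h2)

/-- differential on generators -/
noncomputable def Dgen : List (Lam wt α) → (List (Lam wt α) →₀ R)
  | [] => 0
  | t :: l => Finsupp.single l (zr hT (t.1 - ltop l)) - ldel (fun lq => Finsupp.single (t :: lq) (1:R)) l

/-- differential -/
noncomputable def DD : (List (Lam wt α) →₀ R) →ₗ[R] (List (Lam wt α) →₀ R) :=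
  Finsupp.linearCombination R (Dgen hT α)

variable {α}
/-- chains of given length -/
def chS (wt : (E → ℤ) →+ G) (α : G) (n : ℕ) : Set (List (Lam wt α)) := {l | lchain l ∧ l.length = n + 1}

lemma DD_single (b : List (Lam wt α)) (r : R) : DD hT α (Finsupp.single b r) = r • Dgen hT α b := by
  simp [DD]

lemma Dgen_mem {n : ℕ} {b : List (Lam wt α)} (hb : b ∈ chS wt α (n+1)) :
    Dgen hT α b ∈ Finsupp.supported R R (chS wt α n) := by
  obtain ⟨hc, hl⟩ := hb
  cases b with
  | nil => simp at hl
  | cons t l =>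
    have hc' := (List.pairwise_cons.1 hc)
    simp only [List.length_cons] at hl
    apply Submodule.sub_mem
    · exact Finsupp.single_mem_supported R _ ⟨hc'.2, by omega⟩
    · apply ldel_mem
      intro l' h1 h2
      refine Finsupp.single_mem_supported R _ ⟨?_, by simp; omega⟩
      exact List.Pairwise.sublist (h1.cons_cons t) hc

lemma supported_induction {X : Type} {s : Set X} {M : (X →₀ R) → Prop} (h0 : M 0)
    (hadd : ∀ x y, x ∈ Finsupp.supported R R s → y ∈ Finsupp.supported R R s → M x → M y → M (x + y))
    (hs : ∀ b ∈ s, ∀ r, M (Finsupp.single b r)) (x) (hx : x ∈ Finsupp.supported R R s) : M x := by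
  classical
  have key : ∀ t : Finset X, t ⊆ x.support → (∑ b ∈ t, Finsupp.single b (x b)) ∈ Finsupp.supported R R s ∧
      M (∑ b ∈ t, Finsupp.single b (x b)) := by
    intro t
    induction t using Finset.induction_on with
    | empty => intro _; simpa using h0
    | insert b t hb ih =>
      intro ht
      have ih := ih (fun y hy => ht (Finset.mem_insert_of_mem hy))
      rw [Finset.sum_insert hb]
      have hbs : b ∈ s := (Finsupp.mem_supported R x).1 hx (ht (Finset.mem_insert_self b t))
      have h1 : Finsupp.single b (x b) ∈ Finsupp.supported R R s := Finsupp.single_mem_supported R _ hbs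
      exact ⟨add_mem h1 ih.1, hadd _ _ h1 ih.1 (hs b hbs _) ih.2⟩
  have := (key x.support subset_rfl).2
  have e : (∑ b ∈ x.support, Finsupp.single b (x b)) = x := Finsupp.sum_single x
  rwa [e] at this

lemma DD_mem {n : ℕ} (x : List (Lam wt α) →₀ R) (hx : x ∈ Finsupp.supported R R (chS wt α (n+1))) :
    DD hT α x ∈ Finsupp.supported R R (chS wt α n) := by
  refine supported_induction (M := fun x => DD hT α x ∈ Finsupp.supported R R (chS wt α n))
    (by rw [map_zero]; exact zero_mem _) ?_ ?_ x hx
  · intro x y _ _ h1 h2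
    rw [map_add]; exact add_mem h1 h2
  · intro b hb r
    rw [DD_single]
    exact Submodule.smul_mem _ _ (Dgen_mem hT hb)

/-- terms of the resolution -/
abbrev Fm (R : Type) [CommRing R] (wt : (E → ℤ) →+ G) (α : G) (n : ℕ) : Submodule R (List (Lam wt α) →₀ R) :=
  Finsupp.supported R R (chS wt α n)

/-- differentials of the resolution -/
noncomputable def dm (n : ℕ) : Fm R wt α (n+1) →ₗ[R] Fm R wt α n :=
  (DD hT α).restrict (DD_mem hT)

/-- comparison map -/
noncomputable def Th (k R : Type) [Field k] [CommRing R] [Algebra R (MvPolynomial E k)] (wt : (E → ℤ) →+ G) (α : G) :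
    (List (Lam wt α) →₀ R) →ₗ[R] (List (Lam wt α) →₀ MvPolynomial E k) :=
  Finsupp.linearCombination R (fun b => Finsupp.single b (zz k (ltop b)))

/-- simplicial differential -/
noncomputable def pd (k : Type) [Field k] (wt : (E → ℤ) →+ G) (α : G) :
    (List (Lam wt α) →₀ MvPolynomial E k) →ₗ[MvPolynomial E k] (List (Lam wt α) →₀ MvPolynomial E k) :=
  Finsupp.linearCombination _ (fun b => ldel (fun l => Finsupp.single l 1) b)

lemma Th_single (b : List (Lam wt α)) (r : R) :
    Th k R wt α (Finsupp.single b r) = Finsupp.single b (algebraMap R _ r * zz k (ltop b)) := by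
  simp [Th, Algebra.smul_def]

lemma Th_apply (x : List (Lam wt α) →₀ R) (b) : Th k R wt α x b = algebraMap R _ (x b) * zz k (ltop b) := by
  induction x using Finsupp.induction_linear with
  | zero => simp
  | add x y hx hy => simp [hx, hy, add_mul]
  | single c r =>
    rw [Th_single]
    classical
    rw [Finsupp.single_apply, Finsupp.single_apply]
    split_ifs with h
    · rw [h]
    · simp

lemma Th_inj (hT : Toric k wt R) : Function.Injective (Th k R wt α) := by
  intro x y h
  ext b
  apply hT.inj
  have := DFunLike.congr_fun h b
  rw [Th_apply, Th_apply] at this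
  exact mul_right_cancel₀ (zz_ne_zero (ltop_nonneg b)) this

lemma pd_single (b : List (Lam wt α)) (a) : pd k wt α (Finsupp.single b a) = a • ldel (fun l => Finsupp.single l 1) b := by
  simp [pd]

lemma pd_pd (x) : pd k wt α (pd k wt α x) = 0 := by
  induction x using Finsupp.induction_linear with
  | zero => simp
  | add x y hx hy => simp [hx, hy]
  | single c r =>
    rw [pd_single, map_smul]
    have := ldel_map (pd k wt α).toAddMonoidHom (fun l => Finsupp.single l 1) c
    have e : pd k wt α (ldel (fun l => Finsupp.single l 1) c) = 0 := by
      refine Eq.trans this ?_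
      have h2 : (fun l' => (pd k wt α).toAddMonoidHom (Finsupp.single l' 1)) =
          ldel (fun l => Finsupp.single l (1 : MvPolynomial E k)) := by
        funext l'
        exact (pd_single l' 1).trans (one_smul _ _)
      rw [h2]
      exact ldel_ldel _ c
    rw [e, smul_zero]

lemma wt_sub_top (t : Lam wt α) (l : List (Lam wt α)) (hl : l ≠ []) : wt (t.1 - ltop l) = 0 := by
  cases l with
  | nil => exact absurd rfl hl
  | cons s l => simp [t.2.2, s.2.2]

lemma top_le {t : Lam wt α} {l : List (Lam wt α)} (h : lchain (t :: l)) : 0 ≤ t.1 - ltop l := by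
  have := ltop_mono h (List.sublist_cons_self t l)
  rw [sub_nonneg]; exact this

lemma top_ne {t : Lam wt α} {l : List (Lam wt α)} (h : lchain (t :: l)) (hl : l ≠ []) : t.1 - ltop l ≠ 0 := by
  cases l with
  | nil => exact absurd rfl hl
  | cons s l =>
    intro h0
    have := (List.pairwise_cons.1 h).1 s (by simp)
    have h2 : t = s := Subtype.ext (sub_eq_zero.1 h0)
    rw [h2] at this
    exact lt_irrefl _ this

lemma zr_top (t : Lam wt α) (l : List (Lam wt α)) (h : lchain (t :: l)) (hl : l ≠ []) :
    algebraMap R (MvPolynomial E k) (zr hT (t.1 - ltop l)) = zz k (t.1 - ltop l) :=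
  zr_spec hT (top_le h) (wt_sub_top t l hl)

lemma Th_Dgen {n : ℕ} {b : List (Lam wt α)} (hb : b ∈ chS wt α (n+1)) :
    Th k R wt α (Dgen hT α b) = zz k (ltop b) • ldel (fun l => Finsupp.single l 1) b := by
  obtain ⟨hc, hl⟩ := hb
  cases b with
  | nil => simp at hl
  | cons t l =>
    have hl0 : l ≠ [] := by rintro rfl; simp at hl
    rw [Dgen, ldel_cons, map_sub, Th_single, zr_top hT t l hc hl0, ← zz_add (top_le hc) (ltop_nonneg l),
      sub_add_cancel, smul_sub]
    congr 1
    · simp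
    · refine (ldel_map (Th k R wt α).toAddMonoidHom _ l).trans ?_
      refine Eq.trans ?_ (ldel_map ((LinearMap.lsmul (MvPolynomial E k) (List (Lam wt α) →₀ MvPolynomial E k)
        (zz k (ltop (t::l)))).toAddMonoidHom) _ l).symm
      apply ldel_congr
      intro l' _ _
      refine (Th_single _ _).trans ?_
      simp

lemma Th_DD {n : ℕ} (x : List (Lam wt α) →₀ R) (hx : x ∈ Finsupp.supported R R (chS wt α (n+1))) :
    Th k R wt α (DD hT α x) = pd k wt α (Th k R wt α x) := by
  refine supported_induction (M := fun x => Th k R wt α (DD hT α x) = pd k wt α (Th k R wt α x))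
    (by simp only [map_zero]) ?_ ?_ x hx
  · intro x y _ _ h1 h2
    simp only [map_add, h1, h2]
  · intro b hb r
    rw [DD_single, map_smul, Th_Dgen hT hb, Th_single, pd_single, ← smul_smul, algebraMap_smul]

lemma DD_DD {n : ℕ} (x : List (Lam wt α) →₀ R) (hx : x ∈ Finsupp.supported R R (chS wt α (n+2))) :
    DD hT α (DD hT α x) = 0 := by
  apply Th_inj hT
  rw [Th_DD hT _ (DD_mem hT x hx), Th_DD hT x hx, pd_pd, map_zero]

/-- augmentation -/
noncomputable def augm : Fm R wt α 0 →ₗ[R] Sa hT α :=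
  (Finsupp.linearCombination R (fun b : List (Lam wt α) =>
    match b with
    | [] => (0 : Sa hT α)
    | t :: _ => ⟨zz k t.1, HomW.zz t.2.2⟩)).comp (Finsupp.supported R R (chS wt α 0)).subtype

lemma sum_single_W {B : Type*} [AddCommGroup B] {X : Type} (Φ : (X →₀ R) →+ B) (x : X →₀ R) :
    Φ x = ∑ b ∈ x.support, Φ (Finsupp.single b (x b)) := by
  conv_lhs => rw [← Finsupp.sum_single x]
  rw [Finsupp.sum, map_sum]

lemma Dgen_cf {n : ℕ} {b : List (Lam wt α)} (hb : b ∈ chS wt α (n+1)) (t : Lam wt α) (l : List (Lam wt α))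
    (h : lchain (t :: l)) (hl : l ≠ []) [Decidable (b = t :: l)] :
    cf (t.1 - ltop l) (algebraMap R (MvPolynomial E k) (Dgen hT α b l)) = if b = t :: l then 1 else 0 := by
  classical
  have hconst : ∀ c : k, cf (t.1 - ltop l) (MvPolynomial.C c : MvPolynomial E k) = 0 := by
    intro c
    rw [cf_pos (top_le h), MvPolynomial.coeff_C, if_neg]
    intro h0
    apply top_ne h hl
    rw [← ofN_toN (top_le h), ← h0]
    ext e; simp
  obtain ⟨hc, hbl⟩ := hb
  cases b with
  | nil => simp at hbl
  | cons s b =>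
    have hb0 : b ≠ [] := by rintro rfl; simp at hbl
    have e2 : cf (t.1 - ltop l) (algebraMap R (MvPolynomial E k)
        ((ldel (fun l' => Finsupp.single (s :: l') (1:R)) b) l)) = 0 := by
      refine (ldel_map ((cfHom (t.1 - ltop l)).comp ((algebraMap R (MvPolynomial E k)).toAddMonoidHom.comp
        (Finsupp.applyAddHom l))) _ b).trans ?_
      apply ldel_eq_zero
      intro l' _ _
      show cf (t.1 - ltop l) (algebraMap R (MvPolynomial E k) ((Finsupp.single (s :: l') (1:R)) l)) = 0
      rw [Finsupp.single_apply]
      split_ifs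
      · simpa using hconst 1
      · simpa using hconst 0
    have e1 : cf (t.1 - ltop l) (algebraMap R (MvPolynomial E k)
        ((Finsupp.single b (zr hT (s.1 - ltop b))) l)) = if s :: b = t :: l then 1 else 0 := by
      rw [Finsupp.single_apply]
      by_cases hbl : b = l
      · subst hbl
        rw [if_pos rfl, zr_top hT s b hc hb0]
        by_cases hst : s = t
        · subst hst
          rw [if_pos rfl, cf_zz_self (top_le hc)]
        · rw [if_neg (by simpa using hst), cf_pos (top_le h), zz_pos (top_le hc), MvPolynomial.coeff_monomial,
            if_neg]
          intro h0
          apply hst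
          have := congrArg ofN h0
          rw [ofN_toN (top_le h), ofN_toN (top_le hc)] at this
          exact Subtype.ext (sub_left_injective this)
      · rw [if_neg hbl, if_neg (by simp [hbl])]
        simpa using hconst 0
    have e3 := map_sub ((cfHom (k := k) (t.1 - ltop l)).comp ((algebraMap R (MvPolynomial E k)).toAddMonoidHom.comp
        (Finsupp.applyAddHom l))) (Finsupp.single b (zr hT (s.1 - ltop b))) (ldel (fun l' => Finsupp.single (s :: l') (1:R)) b)
    refine e3.trans ?_
    refine (congrArg₂ (· - ·) e1 e2).trans ?_
    rw [sub_zero]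

lemma cf_alg (v : E → ℤ) (c : k) (r : R) :
    cf v (algebraMap R (MvPolynomial E k) (c • r)) = c * cf v (algebraMap R (MvPolynomial E k) r) := by
  rw [← cf_smul, Algebra.algebraMap_eq_smul_one (A := MvPolynomial E k) (c • r), smul_assoc,
    ← Algebra.algebraMap_eq_smul_one]

lemma W_zero {n : ℕ} (w : List (Lam wt α) →₀ R) (hw : w ∈ Finsupp.supported R R (chS wt α (n+1)))
    (hc : ∀ b, ∃ c : k, w b = algebraMap k R c) (h0 : DD hT α w = 0) : w = 0 := by
  classical
  choose c hc using hc
  ext b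
  by_contra hne
  have hb : b ∈ chS wt α (n+1) := (Finsupp.mem_supported R w).1 hw (Finsupp.mem_support_iff.2 hne)
  obtain ⟨hch, hbl⟩ := id hb
  cases b with
  | nil => simp at hbl
  | cons t l =>
    have hl : l ≠ [] := by rintro rfl; simp at hbl
    have key := sum_single_W ((cfHom (k := k) (t.1 - ltop l)).comp ((algebraMap R (MvPolynomial E k)).toAddMonoidHom.comp
        ((Finsupp.applyAddHom l).comp (DD hT α).toAddMonoidHom))) w
    have e1 : cf (t.1 - ltop l) (algebraMap R (MvPolynomial E k) (DD hT α w l)) = 0 := by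
      rw [h0]; exact (congrArg (cf _) (map_zero _)).trans (map_zero (cfHom _))
    have key2 := e1.symm.trans key
    have e2 : ∀ b ∈ w.support, ((cfHom (k := k) (t.1 - ltop l)).comp ((algebraMap R (MvPolynomial E k)).toAddMonoidHom.comp
        ((Finsupp.applyAddHom l).comp (DD hT α).toAddMonoidHom))) (Finsupp.single b (w b)) = if b = t :: l then c b else 0 := by
      intro b hb'
      have hb2 : b ∈ chS wt α (n+1) := (Finsupp.mem_supported R w).1 hw hb'
      show cf (t.1 - ltop l) (algebraMap R (MvPolynomial E k) (DD hT α (Finsupp.single b (w b)) l)) = _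
      rw [DD_single, hc b, Finsupp.smul_apply, algebraMap_smul, cf_alg, Dgen_cf hT hb2 t l hch hl]
      simp
    rw [Finset.sum_congr rfl e2, Finset.sum_ite_eq' w.support (t::l) c, if_pos (Finsupp.mem_support_iff.2 hne)] at key2
    apply hne
    rw [hc, ← key2]
    simp

lemma split_W {n : ℕ} (x : List (Lam wt α) →₀ R) (hx : x ∈ Finsupp.supported R R (chS wt α n)) :
    ∃ y ∈ Finsupp.supported R R (chS wt α (n+1)), ∃ w ∈ Finsupp.supported R R (chS wt α n),
      (∀ b, ∃ c : k, w b = algebraMap k R c) ∧ x = DD hT α y + w := by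
  classical
  refine supported_induction (M := fun x => ∃ y ∈ Finsupp.supported R R (chS wt α (n+1)),
      ∃ w ∈ Finsupp.supported R R (chS wt α n),
      (∀ b, ∃ c : k, w b = algebraMap k R c) ∧ x = DD hT α y + w) ?_ ?_ ?_ x hx
  · exact ⟨0, zero_mem _, 0, zero_mem _, fun b => ⟨0, by simp⟩, by simp⟩
  · rintro x x' _ _ ⟨y, hy, w, hw, hc, rfl⟩ ⟨y', hy', w', hw', hc', rfl⟩
    refine ⟨y + y', add_mem hy hy', w + w', add_mem hw hw', fun b => ?_, ?_⟩
    · obtain ⟨c, hc⟩ := hc b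
      obtain ⟨c', hc'⟩ := hc' b
      exact ⟨c + c', by simp [hc, hc']⟩
    · rw [map_add]; abel
  · intro b hb r
    refine toric_induction hT (M := fun r => ∃ y ∈ Finsupp.supported R R (chS wt α (n+1)),
      ∃ w ∈ Finsupp.supported R R (chS wt α n),
      (∀ b, ∃ c : k, w b = algebraMap k R c) ∧ Finsupp.single b r = DD hT α y + w) ?_ ?_ ?_ r
    · exact ⟨0, zero_mem _, 0, zero_mem _, fun b => ⟨0, by simp⟩, by simp⟩
    · rintro p q ⟨y, hy, w, hw, hc, e⟩ ⟨y', hy', w', hw', hc', e'⟩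
      refine ⟨y + y', add_mem hy hy', w + w', add_mem hw hw', fun b => ?_, ?_⟩
      · obtain ⟨c, hc⟩ := hc b
        obtain ⟨c', hc'⟩ := hc' b
        exact ⟨c + c', by simp [hc, hc']⟩
      · rw [map_add, Finsupp.single_add, e, e']; abel
    · intro c v hv hwv
      by_cases hv0 : v = 0
      · refine ⟨0, zero_mem _, Finsupp.single b (c • zr hT v), Finsupp.single_mem_supported R _ hb, fun b' => ?_, by simp⟩
        have : zr hT v = 1 := hT.inj (by rw [zr_spec hT hv hwv, hv0, zz_zero, map_one])
        rw [this, Finsupp.single_apply]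
        split_ifs
        · exact ⟨c, by rw [Algebra.algebraMap_eq_smul_one]⟩
        · exact ⟨0, by simp⟩
      · obtain ⟨hch, hbl⟩ := id hb
        cases b with
        | nil => simp at hbl
        | cons s l =>
          set t : Lam wt α := ⟨s.1 + v, add_nonneg s.2.1 hv, by rw [map_add, s.2.2, hwv, add_zero]⟩ with ht
          have hts : s < t := by
            refine lt_of_le_of_ne ?_ ?_
            · show s.1 ≤ s.1 + v
              exact le_add_of_nonneg_right hv
            · intro h
              apply hv0
              have := congrArg Subtype.val h
              simpa [ht] using this
          have hch' : lchain (t :: s :: l) := by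
            refine List.pairwise_cons.2 ⟨?_, hch⟩
            intro a ha
            rcases List.mem_cons.1 ha with rfl | ha
            · exact hts
            · exact lt_trans ((List.pairwise_cons.1 hch).1 a ha) hts
          have hmem : t :: s :: l ∈ chS wt α (n+1) := ⟨hch', by simp at hbl ⊢; omega⟩
          refine ⟨Finsupp.single (t :: s :: l) (algebraMap k R c), Finsupp.single_mem_supported R _ hmem,
            algebraMap k R c • ldel (fun l' => Finsupp.single (t :: l') (1:R)) (s :: l),
            Submodule.smul_mem _ _ ?_, ?_, ?_⟩
          · apply ldel_mem
            intro l' h1 h2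
            refine Finsupp.single_mem_supported R _ ⟨?_, by simp at *; omega⟩
            exact List.Pairwise.sublist (h1.cons_cons t) hch'
          · intro b'
            have : (∃ z : k, (ldel (fun l' => Finsupp.single (t :: l') (1:R)) (s :: l)) b' = algebraMap k R z) := by
              refine ⟨ldel (fun l' => (Finsupp.single (t :: l') (1:k)) b') (s :: l), ?_⟩
              refine (ldel_map (Finsupp.lapply (R := R) (M := R) b').toAddMonoidHom
                (fun l' => Finsupp.single (t :: l') (1:R)) (s :: l)).trans ?_
              refine Eq.trans ?_ (ldel_map (algebraMap k R).toAddMonoidHom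
                (fun l' => (Finsupp.single (t :: l') (1:k)) b') (s :: l)).symm
              apply ldel_congr
              intro l' _ _
              show (Finsupp.single (t :: l') (1:R)) b' = algebraMap k R ((Finsupp.single (t :: l') (1:k)) b')
              rw [Finsupp.single_apply, Finsupp.single_apply]
              split_ifs <;> simp
            obtain ⟨z, hz⟩ := this
            exact ⟨c * z, by rw [Finsupp.smul_apply, hz, map_mul, smul_eq_mul]⟩
          · rw [DD_single, Dgen, smul_sub, sub_add_cancel, Finsupp.smul_single]
            congr 1
            simp [ht, Algebra.smul_def]

lemma augm_single (t : Lam wt α) (ht : Finsupp.single [t] (1:R) ∈ Fm R wt α 0) :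
    (augm hT ⟨Finsupp.single [t] (1:R), ht⟩ : MvPolynomial E k) = zz k t.1 := by
  simp [augm]

end chainres

section chainext
set_option linter.unusedSectionVars false
variable {k : Type} [Field k] {E : Type} [Fintype E] {G : Type} [AddCommGroup G]
variable {wt : (E → ℤ) →+ G}
variable {R : Type} [CommRing R] [Algebra k R] [Algebra R (MvPolynomial E k)]
  [IsScalarTower k R (MvPolynomial E k)]
variable (hT : Toric k wt R) {α : G}

lemma dm_val (n : ℕ) (x : Fm R wt α (n+1)) : (dm hT n x : List (Lam wt α) →₀ R) = DD hT α x := rfl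

lemma dm_dm (n : ℕ) (x : Fm R wt α (n+2)) : dm hT n (dm hT (n+1) x) = 0 := by
  apply Subtype.ext
  exact DD_DD hT x.1 x.2

lemma dm_exact (n : ℕ) (x : Fm R wt α (n+1)) (hx : dm hT n x = 0) : ∃ y, dm hT (n+1) y = x := by
  obtain ⟨y, hy, w, hw, hc, e⟩ := split_W hT x.1 x.2
  have h0 : DD hT α w = 0 := by
    have h1 : DD hT α x.1 = 0 := congrArg Subtype.val hx
    rw [e, map_add, DD_DD hT y hy, zero_add] at h1
    exact h1
  have := W_zero hT w hw hc h0
  refine ⟨⟨y, hy⟩, Subtype.ext ?_⟩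
  rw [e, this, add_zero]
  rfl

/-- the generator of the resolution -/
noncomputable def gen (R : Type) [CommRing R] {n : ℕ} {b : List (Lam wt α)} (hb : b ∈ chS wt α n) : Fm R wt α n :=
  ⟨Finsupp.single b 1, Finsupp.single_mem_supported R _ hb⟩

lemma Fm_induction {n : ℕ} {M : Fm R wt α n → Prop} (h0 : M 0) (hadd : ∀ x y, M x → M y → M (x + y))
    (hs : ∀ b (hb : b ∈ chS wt α n) (r : R), M (r • gen R hb)) (x) : M x := by
  obtain ⟨x, hx⟩ := x
  refine (supported_induction (M := fun x => ∃ hx : x ∈ Finsupp.supported R R (chS wt α n), M ⟨x, hx⟩) ⟨zero_mem _, h0⟩ ?_ ?_ x hx).2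
  · rintro x y hx hy ⟨_, h1⟩ ⟨_, h2⟩
    exact ⟨add_mem hx hy, hadd _ _ h1 h2⟩
  · intro b hb r
    refine ⟨Finsupp.single_mem_supported R _ hb, ?_⟩
    convert hs b hb r using 1
    apply Subtype.ext
    simp [gen]

lemma Fm_hom_ext {n : ℕ} {N : Type*} [AddCommGroup N] [Module R N] {f g : Fm R wt α n →ₗ[R] N}
    (h : ∀ b (hb : b ∈ chS wt α n), f (gen R hb) = g (gen R hb)) : f = g := by
  ext x
  refine Fm_induction (M := fun x => f x = g x) (by simp) ?_ ?_ x
  · intro x y h1 h2; simp [h1, h2]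
  · intro b hb r; simp [h b hb]

lemma augm_gen (t : Lam wt α) (ht : [t] ∈ chS wt α 0) :
    (augm hT (gen R ht) : MvPolynomial E k) = zz k t.1 := augm_single hT t _

lemma mem_ch0 (t : Lam wt α) : [t] ∈ chS wt α 0 := ⟨List.pairwise_singleton _ t, rfl⟩
lemma ch0_eq {b : List (Lam wt α)} (hb : b ∈ chS wt α 0) : ∃ t, b = [t] := by
  obtain ⟨_, h⟩ := hb
  exact List.length_eq_one_iff.1 h

open Classical in
/-- total version of the generators -/
noncomputable def gen' (R : Type) [CommRing R] (wt : (E → ℤ) →+ G) (α : G) (n : ℕ) (b : List (Lam wt α)) : Fm R wt α n :=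
  if hb : b ∈ chS wt α n then gen R hb else 0

lemma gen'_eq {n : ℕ} {b : List (Lam wt α)} (hb : b ∈ chS wt α n) : gen' R wt α n b = gen R hb := dif_pos hb

lemma dm_gen {n : ℕ} (t : Lam wt α) (l : List (Lam wt α)) (hb : t :: l ∈ chS wt α (n+1)) :
    dm hT n (gen R hb) = zr hT (t.1 - ltop l) • gen' R wt α n l - ldel (fun l' => gen' R wt α n (t :: l')) l := by
  obtain ⟨hc, hbl⟩ := id hb
  have hl : l ∈ chS wt α n := ⟨(List.pairwise_cons.1 hc).2, by simpa using hbl⟩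
  apply Subtype.ext
  rw [dm_val]
  show DD hT α (Finsupp.single (t :: l) 1) = _
  rw [DD_single, one_smul, Dgen, gen'_eq hl]
  rw [Submodule.coe_sub]
  congr 1
  · simp [gen]
  · refine Eq.trans ?_ (ldel_map (AddMonoidHom.mk' (fun x : Fm R wt α n => x.1) (fun _ _ => rfl))
      (fun l' => gen' R wt α n (t :: l')) l).symm
    apply ldel_congr
    intro l' h1 h2
    have : t :: l' ∈ chS wt α n := ⟨List.Pairwise.sublist (h1.cons_cons t) hc, by simp at *; omega⟩
    rw [gen'_eq this]
    rfl

lemma hom_dm_gen {n : ℕ} {N : Type*} [AddCommGroup N] [Module R N] (f : Fm R wt α n →ₗ[R] N)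
    (t : Lam wt α) (l : List (Lam wt α)) (hb : t :: l ∈ chS wt α (n+1)) :
    f (dm hT n (gen R hb)) = zr hT (t.1 - ltop l) • f (gen' R wt α n l) - ldel (fun l' => f (gen' R wt α n (t :: l'))) l := by
  rw [dm_gen]
  have hsub : ∀ a b, f (a - b) = f a - f b := fun a b =>
    eq_sub_iff_add_eq.2 ((f.map_add _ _).symm.trans (congrArg f (sub_add_cancel a b)))
  refine (hsub _ _).trans ?_
  rw [map_smul]
  congr 1
  exact ldel_map (AddMonoidHom.mk' (fun x : Fm R wt α n => f x) (fun a b => f.map_add a b)) (fun l' => gen' R wt α n (t :: l')) l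

lemma smul_zz_val (r : R) (p : MvPolynomial E k) : r • p = algebraMap R (MvPolynomial E k) r * p := Algebra.smul_def r p

lemma augm_dm (x : Fm R wt α 1) : augm hT (dm hT 0 x) = 0 := by
  have : (augm hT).comp (dm hT (α := α) 0) = 0 := by
    apply Fm_hom_ext
    intro b hb
    obtain ⟨hc, hbl⟩ := id hb
    match b, hb, hc, hbl with
    | [t, s], hb, hc, _ =>
      show augm hT (dm hT 0 (gen R hb)) = 0
      rw [hom_dm_gen hT, ldel_cons, ldel_nil, sub_zero, gen'_eq (mem_ch0 s), gen'_eq (mem_ch0 t)]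
      apply Subtype.ext
      rw [Submodule.coe_sub, Submodule.coe_smul, augm_gen, augm_gen, smul_zz_val, zr_top hT t [s] hc (by simp),
        ← zz_add (top_le hc) s.2.1]
      simp
  exact LinearMap.congr_fun this x

lemma augm_surj : Function.Surjective (augm hT (α := α)) := by
  intro y
  refine HomW.induction (wt := wt) (β := α) (k := k) (M := fun p => ∀ hp : p ∈ Sa hT α, ∃ x, augm hT x = ⟨p, hp⟩)
    ?_ ?_ ?_ y.1 y.2 y.2
  · intro _; exact ⟨0, by rw [map_zero]; rfl⟩
  · intro p q hp hq h1 h2 _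
    obtain ⟨x, hx⟩ := h1 hp
    obtain ⟨x', hx'⟩ := h2 hq
    exact ⟨x + x', by rw [map_add, hx, hx']; rfl⟩
  · intro c v hv hwv _
    refine ⟨algebraMap k R c • gen R (mem_ch0 ⟨v, hv, hwv⟩), Subtype.ext ?_⟩
    rw [map_smul, Submodule.coe_smul, augm_gen]
    simp

lemma augm_exact (x : Fm R wt α 0) (hx : augm hT x = 0) : ∃ y, dm hT 0 y = x := by
  classical
  obtain ⟨y, hy, w, hw, hc, e⟩ := split_W hT x.1 x.2
  have e' : x = dm hT 0 ⟨y, hy⟩ + ⟨w, hw⟩ := Subtype.ext e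
  have h0 : augm hT ⟨w, hw⟩ = 0 := by
    rw [e', map_add, augm_dm, zero_add] at hx
    exact hx
  refine ⟨⟨y, hy⟩, ?_⟩
  have hw0 : w = 0 := by
    choose c hc using hc
    ext b
    by_contra hne
    have hmem : ∀ b, w b ≠ 0 → b ∈ chS wt α 0 := fun b hb =>
      (Finsupp.mem_supported R w).1 hw (Finsupp.mem_support_iff.2 hb)
    have hb := hmem b hne
    obtain ⟨t, rfl⟩ := ch0_eq hb
    have ew : (⟨w, hw⟩ : Fm R wt α 0) = ∑ b ∈ w.support, w b • gen' R wt α 0 b := by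
      apply Subtype.ext
      rw [AddSubmonoidClass.coe_finsetSum]
      show w = _
      refine (Finsupp.sum_single w).symm.trans ?_
      rw [Finsupp.sum]
      apply Finset.sum_congr rfl
      intro b hb
      rw [gen'_eq (hmem b (Finsupp.mem_support_iff.1 hb))]
      simp [gen]
    rw [ew, map_sum] at h0
    have h1 := congrArg (fun z : Sa hT α => cf t.1 (z : MvPolynomial E k)) h0
    simp only [AddSubmonoidClass.coe_finsetSum] at h1
    have h2 : ∀ b ∈ w.support, cf t.1 ((augm hT (w b • gen' R wt α 0 b) : Sa hT α) : MvPolynomial E k) = if b = [t] then c b else 0 := by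
      intro b hb
      obtain ⟨s, rfl⟩ := ch0_eq (hmem b (Finsupp.mem_support_iff.1 hb))
      rw [gen'_eq (mem_ch0 s), map_smul, Submodule.coe_smul, augm_gen, hc, algebraMap_smul, cf_smul]
      by_cases hst : s = t
      · subst hst; rw [cf_zz_self s.2.1]; simp
      · rw [if_neg (by simpa using hst), cf_pos t.2.1, zz_pos s.2.1, MvPolynomial.coeff_monomial, if_neg, mul_zero]
        intro h0
        apply hst
        have := congrArg ofN h0
        rw [ofN_toN t.2.1, ofN_toN s.2.1] at this
        exact Subtype.ext this
    have h3 : cf t.1 (∑ b ∈ w.support, ((augm hT (w b • gen' R wt α 0 b) : Sa hT α) : MvPolynomial E k)) = c [t] := by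
      have := map_sum (cfHom (k := k) t.1) (fun b => ((augm hT (w b • gen' R wt α 0 b) : Sa hT α) : MvPolynomial E k)) w.support
      refine this.trans ((Finset.sum_congr rfl h2).trans ?_)
      rw [Finset.sum_ite_eq' w.support [t] c, if_pos (Finsupp.mem_support_iff.2 hne)]
    rw [h3] at h1
    have h4 : cf t.1 (((0 : Sa hT α)) : MvPolynomial E k) = 0 := map_zero (cfHom (k := k) t.1)
    apply hne
    rw [hc, h1, h4, map_zero]
    rfl
  rw [e']
  have : (⟨w, hw⟩ : Fm R wt α 0) = 0 := Subtype.ext hw0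
  rw [this, add_zero]

instance (n : ℕ) : Module.Free R (Fm R wt α n) :=
  Module.Free.of_equiv (Finsupp.supportedEquivFinsupp (M := R) (R := R) (chS wt α n)).symm

/-- homs out of the terms -/
noncomputable def Fm_lift {N : Type} [AddCommGroup N] [Module R N] (n : ℕ) (φ : List (Lam wt α) → N) : Fm R wt α n →ₗ[R] N :=
  (Finsupp.linearCombination R φ).comp (Fm R wt α n).subtype

lemma Fm_lift_gen {N : Type} [AddCommGroup N] [Module R N] {n : ℕ} (φ : List (Lam wt α) → N) {b} (hb : b ∈ chS wt α n) :
    Fm_lift (R := R) n φ (gen R hb) = φ b := by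
  simp [Fm_lift, gen]

open Classical in
/-- element of `Sa` from a polynomial -/
noncomputable def toSa (α : G) (p : MvPolynomial E k) : Sa hT α :=
  if h : HomW wt α p then ⟨p, h⟩ else 0

lemma toSa_val {p : MvPolynomial E k} (h : HomW wt α p) : (toSa hT α p : MvPolynomial E k) = p := by
  unfold toSa; rw [dif_pos h]

lemma psi_dm (u : E → ℤ) (hu : wt u = 0) (n : ℕ) (F : List (Lam wt α) → k)
    (hF : ∀ L, F L ≠ 0 → (lchain L ∧ 0 ≤ u + ltop L) ∧ L.length = n + 1)
    (hF0 : ∀ L, (lchain L ∧ 0 ≤ u + ltop L) → ldel F L = 0) (x : Fm R wt α (n+1)) :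
    Fm_lift (R := R) n (fun b => toSa hT α (F b • zz k (u + ltop b))) (dm hT n x) = 0 := by
  have : (Fm_lift (R := R) n (fun b => toSa hT α (F b • zz k (u + ltop b)))).comp (dm hT n) = 0 := by
    apply Fm_hom_ext
    intro b hb
    obtain ⟨hc, hbl⟩ := id hb
    cases b with
    | nil => simp at hbl
    | cons t l =>
      have hl : l ∈ chS wt α n := ⟨(List.pairwise_cons.1 hc).2, by simpa using hbl⟩
      have hl0 : l ≠ [] := by rintro rfl; simp at hbl
      show Fm_lift (R := R) n (fun b => toSa hT α (F b • zz k (u + ltop b))) (dm hT n (gen R hb)) = 0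
      have hh : ∀ b : List (Lam wt α), b ≠ [] → HomW wt α (F b • zz k (u + ltop b)) := by
        intro b hb
        cases b with
        | nil => exact absurd rfl hb
        | cons t l => exact HomW.smul _ (HomW.zz (by rw [ltop_cons, map_add, hu, t.2.2, zero_add]))
      rw [hom_dm_gen hT, gen'_eq hl, Fm_lift_gen]
      apply Subtype.ext
      rw [Submodule.coe_sub, Submodule.coe_smul, toSa_val hT (hh l hl0), smul_zz_val, zr_top hT t l hc hl0]
      have e1 : zz k (t.1 - ltop l) * F l • zz k (u + ltop l) = F l • zz k (u + t.1) := by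
        by_cases hFl : F l = 0
        · rw [hFl, zero_smul, zero_smul, mul_zero]
        · rw [mul_smul_comm, ← zz_add (top_le hc) (hF l hFl).1.2]
          congr 2; abel
      have e2 : ((ldel (fun l' => (Fm_lift (R := R) n fun b => toSa hT α (F b • zz k (u + ltop b))) (gen' R wt α n (t :: l'))) l : Sa hT α) : MvPolynomial E k)
          = (ldel (fun l' => F (t :: l')) l) • zz k (u + t.1) := by
        refine (ldel_map (Sa hT α).subtype.toAddMonoidHom _ l).trans ?_
        refine Eq.trans ?_ (ldel_map ((LinearMap.toSpanSingleton k (MvPolynomial E k) (zz k (u + t.1))).toAddMonoidHom) (fun l' => F (t :: l')) l).symm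
        apply ldel_congr
        intro l' h1 h2
        have : t :: l' ∈ chS wt α n := ⟨List.Pairwise.sublist (h1.cons_cons t) hc, by simp at *; omega⟩
        rw [gen'_eq this, Fm_lift_gen]
        exact toSa_val hT (hh _ (by simp))
      rw [e1, e2, ← sub_smul, ← ldel_cons]
      by_cases h0 : 0 ≤ u + t.1
      · rw [hF0 (t :: l) ⟨hc, h0⟩, zero_smul]; rfl
      · unfold zz; rw [if_neg h0, smul_zero]; rfl
  exact LinearMap.congr_fun this x

theorem Ex2_of_semidualizing [IsDomain R] (C : ModuleCat.{0} R) (e : Sa hT α ≃ₗ[R] C)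
    (hinj : Function.Injective (LinearMap.lsmul R C))
    (hsurj : Function.Surjective (LinearMap.lsmul R C))
    (hext : ∀ i : ℕ, 1 ≤ i → Subsingleton (((Ext R (ModuleCat.{0} R) i).obj (Opposite.op C)).obj C))
    (u : E → ℤ) (hu : wt u = 0) : Ex2 k wt α u := by
  classical
  have hne : Nonempty (Lam wt α) := by
    by_contra hemp
    rw [not_nonempty_iff] at hemp
    have h0 : ∀ x : Sa hT α, x = 0 := by
      intro x
      obtain ⟨y, rfl⟩ := augm_surj hT x
      have : y = 0 := by
        refine Fm_induction (M := fun y => y = 0) rfl (fun x y h h' => by rw [h, h', add_zero]) ?_ y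
        intro b hb r
        obtain ⟨t, _⟩ := ch0_eq hb
        exact (hemp.false t).elim
      rw [this, map_zero]
    have : (1 : R) = 0 := by
      apply hinj
      ext x
      have := h0 (e.symm x)
      have hx : x = 0 := by rw [← e.apply_symm_apply x, this, map_zero]
      rw [hx]; simp
    exact one_ne_zero this
  obtain ⟨t0⟩ := hne
  intro n F hF hF0
  match n with
  | 0 =>
    refine ⟨fun _ => 0, fun L h => absurd rfl h, fun L hL => ?_⟩
    rw [ldel_eq_zero (fun _ => (0:k)) L (fun _ _ _ => rfl)]
    by_contra hne
    obtain ⟨⟨_, h1⟩, h2⟩ := hF L (fun h => hne h.symm)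
    rw [List.length_eq_zero_iff] at h2
    subst h2
    have := hF0 [t0] ⟨List.pairwise_singleton _ t0, add_nonneg (by simpa using h1) t0.2.1⟩
    rw [ldel_cons, ldel_nil, sub_zero] at this
    exact hne this.symm
  | n + 1 =>
    obtain ⟨ψ, hψd, hψg⟩ : ∃ ψ : Fm R wt α n →ₗ[R] Sa hT α, (∀ x, ψ (dm hT n x) = 0) ∧
        ∀ (b) (hb : b ∈ chS wt α n), (ψ (gen R hb) : MvPolynomial E k) = F b • zz k (u + ltop b) := by
      refine ⟨Fm_lift (R := R) n (fun b => toSa hT α (F b • zz k (u + ltop b))), psi_dm hT u hu n F hF hF0, ?_⟩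
      intro b hb
      rw [Fm_lift_gen, toSa_val]
      obtain ⟨hc, hbl⟩ := id hb
      cases b with
      | nil => simp at hbl
      | cons t l => exact HomW.smul _ (HomW.zz (by rw [ltop_cons, map_add, hu, t.2.2, zero_add]))
    cases n with
    | zero =>
      have hker : LinearMap.ker (augm hT (α := α)) ≤ LinearMap.ker ψ := by
        intro x hx
        obtain ⟨y, rfl⟩ := augm_exact hT x hx
        exact hψd y
      have hfac : ∀ x y, augm hT (α := α) x = augm hT y → ψ x = ψ y := by
        intro x y hxy
        have h1 : augm hT (x - y) = 0 := ((augm hT).map_sub x y).trans (by rw [hxy, sub_self])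
        have h2 : ψ (x - y) = 0 := hker h1
        exact sub_eq_zero.1 ((ψ.map_sub x y).symm.trans h2)
      let σ := Function.surjInv (augm_surj hT (α := α))
      have hσ : ∀ y, augm hT (σ y) = y := Function.surjInv_eq (augm_surj hT (α := α))
      let φ : Sa hT α →ₗ[R] Sa hT α :=
        { toFun := fun y => ψ (σ y)
          map_add' := fun y y' => by
            rw [← map_add]; apply hfac; rw [map_add, hσ, hσ, hσ]
          map_smul' := fun r y => by
            rw [RingHom.id_apply, ← map_smul]; apply hfac; rw [map_smul, hσ, hσ] }
      have hφ : ∀ x, φ (augm hT x) = ψ x := by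
        intro x
        exact hfac _ _ (hσ _)
      obtain ⟨r, hr⟩ := hsurj (e.toLinearMap.comp (φ.comp e.symm.toLinearMap))
      have hr' : ∀ x, φ x = r • x := by
        intro x
        have := LinearMap.congr_fun hr (e x)
        simp only [LinearMap.lsmul_apply, LinearMap.comp_apply, LinearEquiv.coe_coe, LinearEquiv.symm_apply_apply] at this
        rw [← map_smul] at this
        exact (e.injective this).symm
      refine ⟨fun L => if L = [] then cf u (algebraMap R _ r) else 0, ?_, ?_⟩
      · intro L hL
        simp only [ne_eq, ite_eq_right_iff, not_forall] at hL
        obtain ⟨rfl, h⟩ := hL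
        refine ⟨⟨List.Pairwise.nil, ?_⟩, rfl⟩
        by_contra hc
        rw [ltop_nil, add_zero] at hc
        exact h (cf_neg hc _)
      · intro L hL
        match L, hL with
        | [], _ =>
          rw [ldel_nil]
          by_contra h
          have := (hF [] (fun h' => h h'.symm)).2
          simp at this
        | [t], hL =>
          rw [ldel_cons, ldel_nil, sub_zero, if_pos rfl]
          have h1 := hψg [t] (mem_ch0 t)
          rw [← hφ, hr', Submodule.coe_smul, augm_gen, smul_zz_val, mul_comm] at h1
          have h2 := cf_mul_zz (k := k) t.2.1 u (by have := hL.2; rwa [ltop_cons, add_comm] at this) (algebraMap R _ r)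
          rw [← h2, h1, ltop_cons, add_comm, cf_smul, cf_zz_self, mul_one]
          have := hL.2; rwa [ltop_cons] at this
        | t :: s :: l, hL =>
          rw [ldel_eq_zero]
          · by_contra h
            have := (hF _ (fun h' => h h'.symm)).2
            simp at this
          · intro l' h1 h2
            rw [if_neg]
            rintro rfl
            simp at h2
    | succ i =>
      obtain ⟨χ, hχ⟩ := ext_mk (fun n => ModuleCat.of R (Fm R wt α n)) (fun n => ModuleCat.ofHom (dm hT n)) C C
        (ModuleCat.ofHom (e.toLinearMap.comp (augm hT)))
        (by intro n; apply ModuleCat.hom_ext; apply LinearMap.ext; intro x; exact dm_dm hT n x)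
        (by
          ext x
          show e (augm hT (dm hT 0 x)) = 0
          rw [augm_dm, map_zero])
        (by intro n x hx; exact dm_exact hT n x hx)
        (by
          intro x hx
          apply augm_exact hT x
          apply e.injective
          rw [map_zero]; exact hx)
        (e.surjective.comp (augm_surj hT)) i (hext (i+1) (by omega))
        (ModuleCat.ofHom (e.toLinearMap.comp ψ))
        (by
          ext x
          show e (ψ (dm hT (i+1) x)) = 0
          rw [hψd, map_zero])
      let X : Fm R wt α i →ₗ[R] Sa hT α := e.symm.toLinearMap.comp χ.hom
      have hX : ∀ x, X (dm hT i x) = ψ x := by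
        intro x
        have := ConcreteCategory.congr_hom hχ x
        show e.symm (χ.hom (dm hT i x)) = ψ x
        rw [LinearEquiv.symm_apply_eq]
        exact this
      refine ⟨fun b => if b.length = i + 1 ∧ lchain b then cf (u + ltop b) (X (gen' R wt α i b) : MvPolynomial E k) else 0, ?_, ?_⟩
      · intro L hL
        simp only [ne_eq, ite_eq_right_iff, not_forall] at hL
        obtain ⟨⟨h1, h2⟩, h3⟩ := hL
        refine ⟨⟨h2, ?_⟩, by omega⟩
        by_contra hc
        exact h3 (cf_neg hc _)
      · intro L hL
        by_cases hlen : L.length = i + 2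
        · have hmem : L ∈ chS wt α (i+1) := ⟨hL.1, by omega⟩
          have h1 := hψg L hmem
          cases L with
          | nil => simp at hlen
          | cons t l =>
            have hc := hL.1
            have hl0 : l ≠ [] := by rintro rfl; simp at hlen
            rw [← hX, hom_dm_gen hT, Submodule.coe_sub, Submodule.coe_smul, smul_zz_val, zr_top hT t l hc hl0] at h1
            have h2 := congrArg (cf (u + t.1)) h1
            rw [cf_smul, ltop_cons, cf_zz_self (show 0 ≤ u + t.1 from hL.2), mul_one] at h2
            rw [← h2]
            have h3 := map_sub (cfHom (k := k) (u + t.1)) (zz k (t.1 - ltop l) * (X (gen' R wt α i l) : MvPolynomial E k))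
              ((ldel (fun l' => X (gen' R wt α i (t :: l'))) l : Sa hT α) : MvPolynomial E k)
            simp only [cfHom_apply] at h3
            rw [h3, ldel_cons]
            congr 1
            · rw [if_pos ⟨by simpa using hlen, (List.pairwise_cons.1 hc).2⟩]
              have h4 := cf_mul_zz (k := k) (top_le hc) (u + ltop l) (by
                have := hL.2; rw [ltop_cons] at this
                have e : t.1 - ltop l + (u + ltop l) = u + t.1 := by abel
                rwa [e]) (X (gen' R wt α i l) : MvPolynomial E k)
              rw [← h4]
              congr 1; abel
            · refine Eq.trans ?_ (ldel_map ((cfHom (k := k) (u + t.1)).comp (Sa hT α).subtype.toAddMonoidHom) _ l).symm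
              apply ldel_congr
              intro l' h1 h2
              have h5 : lchain (t :: l') := List.Pairwise.sublist (h1.cons_cons t) hc
              rw [if_pos ⟨by simp at *; omega, h5⟩]
              rfl
        · have : F L = 0 := by
            by_contra h
            exact hlen (by have := (hF L h).2; omega)
          rw [this]
          apply ldel_eq_zero
          intro l' h1 h2
          rw [if_neg]
          intro h; omega

end chainext

section homfactor
variable {k : Type} [Field k] {E : Type} [Fintype E] {G : Type} [AddCommGroup G]

open Classical in
/-- the grading homomorphism -/
noncomputable def grd (k : Type) [Field k] (wt : (E → ℤ) →+ G) :
    MvPolynomial E k →ₐ[k] AddMonoidAlgebra (MvPolynomial E k) G :=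
  MvPolynomial.aeval (fun e => AddMonoidAlgebra.single (wt (Pi.single e 1)) (MvPolynomial.X e))

variable (wt : (E → ℤ) →+ G)

lemma grd_monomial (d : E →₀ ℕ) (c : k) :
    grd k wt (MvPolynomial.monomial d c) = AddMonoidAlgebra.single (wt (ofN d)) (MvPolynomial.monomial d c) := by
  classical
  induction d using Finsupp.induction generalizing c with
  | zero =>
    have h0 : ofN (0 : E →₀ ℕ) = 0 := by ext; simp
    rw [h0, map_zero]
    have : (MvPolynomial.monomial (0 : E →₀ ℕ) c) = algebraMap k (MvPolynomial E k) c := rfl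
    rw [this, AlgHom.commutes]
    rfl
  | single_add e n d hd hn ih =>
    have h1 : MvPolynomial.monomial (Finsupp.single e n + d) c
        = MvPolynomial.X e ^ n * MvPolynomial.monomial d c := by
      rw [MvPolynomial.X_pow_eq_monomial, MvPolynomial.monomial_mul, one_mul]
    rw [h1, map_mul, map_pow, ih, grd, MvPolynomial.aeval_X, AddMonoidAlgebra.single_pow,
      AddMonoidAlgebra.single_mul_single]
    congr 1
    rw [ofN_add, map_add]
    congr 1
    rw [← map_nsmul]
    congr 1
    ext x
    by_cases h : x = e
    · subst h; simp
    · simp [Pi.single_apply, Finsupp.single_apply, h, Ne.symm h]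

lemma grd_coeff (p : MvPolynomial E k) (β : G) (d : E →₀ ℕ) :
    MvPolynomial.coeff d ((grd k wt p).coeff β) = (open Classical in if wt (ofN d) = β then MvPolynomial.coeff d p else 0) := by
  classical
  induction p using MvPolynomial.induction_on' with
  | monomial a b =>
    rw [grd_monomial, AddMonoidAlgebra.coeff_single_apply]
    by_cases h : a = d
    · subst h
      by_cases h2 : wt (ofN a) = β
      · simp [h2]
      · simp [h2]
    · simp only [MvPolynomial.coeff_monomial, if_neg h]
      split_ifs <;> simp [MvPolynomial.coeff_monomial, h]
  | add p q hp hq =>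
    rw [map_add, AddMonoidAlgebra.coeff_add, Finsupp.add_apply, MvPolynomial.coeff_add, hp, hq, MvPolynomial.coeff_add]
    split_ifs <;> simp

lemma grd_supp_nonempty {p : MvPolynomial E k} (hp : p ≠ 0) : (grd k wt p).coeff.support.Nonempty := by
  obtain ⟨d, hd⟩ := MvPolynomial.ne_zero_iff.1 hp
  refine ⟨wt (ofN d), ?_⟩
  rw [Finsupp.mem_support_iff]
  intro h
  have := grd_coeff wt p (wt (ofN d)) d
  rw [h, if_pos rfl] at this
  simp at this
  exact hd this.symm

lemma grd_homW {p : MvPolynomial E k} {β : G} (h : (grd k wt p).coeff.support ⊆ {β}) : HomW wt β p := by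
  intro d hd
  by_contra hne
  have h1 : (grd k wt p).coeff (wt (ofN d)) = 0 := by
    by_contra h2
    exact hne (Finset.mem_singleton.1 (h (Finsupp.mem_support_iff.2 h2)))
  have := grd_coeff wt p (wt (ofN d)) d
  rw [h1, if_pos rfl] at this
  simp at this
  exact (MvPolynomial.mem_support_iff.1 hd) this.symm

lemma grd_of_homW {p : MvPolynomial E k} {β β' : G} (h : HomW wt β p) (h2 : (grd k wt p).coeff β' ≠ 0) : β' = β := by
  obtain ⟨d, hd⟩ := MvPolynomial.ne_zero_iff.1 h2
  rw [grd_coeff] at hd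
  split_ifs at hd with h3
  · rw [← h3]; exact h d (MvPolynomial.mem_support_iff.2 hd)
  · exact absurd rfl hd

lemma homW_factor [TwoUniqueSums G] {p q : MvPolynomial E k} (hp : p ≠ 0) (hq : q ≠ 0) {γ : G}
    (h : HomW wt γ (p * q)) : ∃ β, HomW wt β p ∧ HomW wt (γ - β) q := by
  classical
  set A := (grd k wt p).coeff.support with hA
  set B := (grd k wt q).coeff.support with hB
  have hA1 := grd_supp_nonempty wt hp
  have hB1 := grd_supp_nonempty wt hq
  rw [← hA] at hA1
  rw [← hB] at hB1
  have key : ∀ a ∈ A, ∀ b ∈ B, UniqueAdd A B a b → a + b = γ := by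
    intro a ha b hb hu
    apply grd_of_homW wt h
    rw [map_mul, AddMonoidAlgebra.coeff_mul_add_of_uniqueAdd hu]
    exact mul_ne_zero (Finsupp.mem_support_iff.1 ha) (Finsupp.mem_support_iff.1 hb)
  have hc : ¬ 1 < A.card * B.card := by
    intro hc
    obtain ⟨p1, h1, p2, h2, hne, hu1, hu2⟩ := TwoUniqueSums.uniqueAdd_of_one_lt_card hc
    rw [Finset.mem_product] at h1 h2
    have e1 := key _ h1.1 _ h1.2 hu1
    have e2 := key _ h2.1 _ h2.2 hu2
    obtain ⟨x, y⟩ := hu1 h2.1 h2.2 (e2.trans e1.symm)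
    exact hne (Prod.ext x.symm y.symm)
  have hA2 := hA1.card_pos
  have hB2 := hB1.card_pos
  have hA3 : A.card = 1 := by nlinarith
  have hB3 : B.card = 1 := by nlinarith
  obtain ⟨a, hAa⟩ := Finset.card_eq_one.1 hA3
  obtain ⟨b, hBb⟩ := Finset.card_eq_one.1 hB3
  have hpa : HomW wt a p := grd_homW wt (by rw [← hA, hAa])
  have hqb : HomW wt b q := grd_homW wt (by rw [← hB, hBb])
  refine ⟨a, hpa, ?_⟩
  have : a + b = γ := by
    refine key a (by rw [hAa]; simp) b (by rw [hBb]; simp) ?_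
    intro a' b' ha' hb' _
    rw [hAa] at ha'; rw [hBb] at hb'
    simp at ha' hb'
    exact ⟨ha', hb'⟩
  rw [← this, add_sub_cancel_left]
  exact hqb
end homfactor

section idealgen
variable {R : Type} [CommRing R]

lemma sd_hom_zero [IsNoetherianRing R] [Nontrivial R] (C : Type) [AddCommGroup C] [Module R C] [Module.Finite R C]
    (hinj : Function.Injective (LinearMap.lsmul R C)) (N : Type) [AddCommGroup N] [Module R N]
    [Module.Finite R N] (h : Subsingleton (C →ₗ[R] N)) : Subsingleton N := by
  obtain ⟨r, hr, hreg⟩ := IsSMulRegular.subsingleton_linearMap_iff.1 h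
  have : r = 0 := by
    apply hinj
    ext c
    simp [Module.mem_annihilator.1 hr c]
  subst this
  exact IsSMulRegular.zero_iff_subsingleton.1 hreg

lemma sd_torsionfree [IsNoetherianRing R] [IsDomain R] (C : Type) [AddCommGroup C] [Module R C] [Module.Finite R C]
    (hb : Function.Bijective (LinearMap.lsmul R C)) (r : R) (hr : r ≠ 0) (c : C) (hc : r • c = 0) : c = 0 := by
  let K : Submodule R C := LinearMap.ker (LinearMap.lsmul R C r)
  have hK : Subsingleton K := by
    apply sd_hom_zero C hb.1
    constructor
    have key : ∀ f : C →ₗ[R] K, f = 0 := by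
      intro f
      obtain ⟨s, hs⟩ := hb.2 (K.subtype.comp f)
      have h1 : LinearMap.lsmul R C (r * s) = 0 := by
        ext x
        have h2 : s • x = (f x : C) := by
          have := LinearMap.congr_fun hs x
          simpa using this
        have h3 : r • (f x : C) = 0 := (f x).2
        simp [mul_smul, h2, h3]
      have h2 : r * s = 0 := hb.1 (by rw [h1, map_zero])
      have hs0 : s = 0 := (mul_eq_zero.1 h2).resolve_left hr
      ext x
      have := LinearMap.congr_fun hs x
      simp [hs0] at this
      simp [← this]
    intro f g; rw [key f, key g]
  have : (⟨c, hc⟩ : K) = 0 := Subsingleton.elim _ _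
  simpa using congrArg Subtype.val this

lemma sd_exists_inj [IsNoetherianRing R] [IsDomain R] (C : Type) [AddCommGroup C] [Module R C] [Module.Finite R C]
    (hb : Function.Bijective (LinearMap.lsmul R C)) : ∃ f : C →ₗ[R] R, Function.Injective f := by
  have h1 : ¬ Subsingleton (C →ₗ[R] R) := fun h =>
    not_subsingleton R (sd_hom_zero C hb.1 R h)
  rw [not_subsingleton_iff_nontrivial] at h1
  obtain ⟨f, hf⟩ := exists_ne (0 : C →ₗ[R] R)
  refine ⟨f, ?_⟩
  rw [injective_iff_map_eq_zero]
  intro x hx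
  obtain ⟨s, hs⟩ := hb.2 (f.smulRight x)
  have h2 : s • x = 0 := by
    have := LinearMap.congr_fun hs x
    simpa [hx] using this
  by_contra hx0
  have hs0 : s = 0 := by
    by_contra h3
    exact hx0 (sd_torsionfree C hb s h3 x h2)
  apply hf
  ext c
  have := LinearMap.congr_fun hs c
  simp [hs0] at this
  by_contra h4
  exact hx0 (sd_torsionfree C hb _ (by simpa using h4) x this.symm)

lemma sd_sat [IsNoetherianRing R] [Nontrivial R] (C : ModuleCat.{0} R) [Module.Finite R C]
    (hinj : Function.Injective (LinearMap.lsmul R C))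
    (hext : Subsingleton (((Ext R (ModuleCat.{0} R) 1).obj (Opposite.op C)).obj C))
    (J : Type) [AddCommGroup J] [Module R J] [Module.Finite R J] (i : C →ₗ[R] J)
    (hi : Function.Injective i) (hJ : ∀ (g : C →ₗ[R] J) c, g c ∈ LinearMap.range i) :
    Function.Surjective i := by
  have hN : Subsingleton (J ⧸ LinearMap.range i) := by
    apply sd_hom_zero C hinj
    constructor
    suffices key : ∀ g : C →ₗ[R] (J ⧸ LinearMap.range i), g = 0 by
      intro f g; rw [key f, key g]
    intro g
    let P := ProjectiveResolution.of C
    have hsurjπ : Function.Surjective (P.π.f 0) := (ModuleCat.epi_iff_surjective _).1 inferInstance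
    let π0 : P.complex.X 0 →ₗ[R] C := (P.π.f 0).hom
    have : Projective (P.complex.X 0) := P.projective 0
    have hq : Epi (ModuleCat.ofHom (LinearMap.range i).mkQ) :=
      (ModuleCat.epi_iff_surjective _).2 (Submodule.mkQ_surjective _)
    let h : P.complex.X 0 ⟶ ModuleCat.of R J :=
      Projective.factorThru (ModuleCat.ofHom (g.comp π0)) (ModuleCat.ofHom (LinearMap.range i).mkQ)
    have hh : ∀ x, (LinearMap.range i).mkQ (h.hom x) = g (π0 x) := by
      intro x
      have := Projective.factorThru_comp (ModuleCat.ofHom (g.comp π0)) (ModuleCat.ofHom (LinearMap.range i).mkQ)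
      exact LinearMap.congr_fun (congrArg ModuleCat.Hom.hom this) x
    have hdπ : ∀ y : P.complex.X 1, π0 ((P.complex.d 1 0).hom y) = 0 := by
      intro y
      have := P.complex_d_comp_π_f_zero
      exact LinearMap.congr_fun (congrArg ModuleCat.Hom.hom this) y
    have hmem : ∀ y : P.complex.X 1, h.hom ((P.complex.d 1 0).hom y) ∈ LinearMap.range i := by
      intro y
      have := hh ((P.complex.d 1 0).hom y)
      rw [hdπ, map_zero] at this
      simpa using this
    let ι := LinearEquiv.ofInjective i hi
    let ψ : P.complex.X 1 ⟶ C := ModuleCat.ofHom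
      (ι.symm.toLinearMap.comp (LinearMap.codRestrict _ (h.hom.comp (P.complex.d 1 0).hom) hmem))
    have hψ1 : ∀ y, i (ψ.hom y) = h.hom ((P.complex.d 1 0).hom y) := by
      intro y
      have : (ι (ι.symm (LinearMap.codRestrict _ (h.hom.comp (P.complex.d 1 0).hom) hmem y)) : J) =
        h.hom ((P.complex.d 1 0).hom y) := by
        rw [LinearEquiv.apply_symm_apply]; rfl
      exact this
    have hψ : P.complex.d 2 1 ≫ ψ = 0 := by
      ext y
      apply hi
      have h3 : (P.complex.d 1 0).hom ((P.complex.d 2 1).hom y) = 0 :=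
        LinearMap.congr_fun (congrArg ModuleCat.Hom.hom (P.complex.d_comp_d 2 1 0)) y
      have h4 := hψ1 ((P.complex.d 2 1).hom y)
      rw [h3, map_zero] at h4
      refine h4.trans (map_zero i).symm
    obtain ⟨χ, hχ⟩ := ext_res P 0 hext ψ hψ
    let h' : P.complex.X 0 →ₗ[R] J := h.hom - i.comp χ.hom
    have hχ' : ∀ y, χ.hom ((P.complex.d 1 0).hom y) = ψ.hom y := fun y =>
      LinearMap.congr_fun (congrArg ModuleCat.Hom.hom hχ) y
    have hh' : ∀ y, h' ((P.complex.d 1 0).hom y) = 0 := by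
      intro y
      show h.hom _ - i (χ.hom _) = 0
      rw [hχ', hψ1, sub_self]
    have hex : ∀ x, π0 x = 0 → ∃ y, (P.complex.d 1 0).hom y = x := by
      have := P.exact₀
      rw [ShortComplex.moduleCat_exact_iff] at this
      exact this
    have hker : LinearMap.ker π0 ≤ LinearMap.ker h' := by
      intro x hx
      obtain ⟨y, rfl⟩ := hex x hx
      exact hh' y
    let g' : C →ₗ[R] J := ((LinearMap.ker π0).liftQ h' hker).comp
      (LinearMap.quotKerEquivOfSurjective π0 hsurjπ).symm.toLinearMap
    have hg' : ∀ x, g' (π0 x) = h' x := by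
      intro x
      have : (LinearMap.quotKerEquivOfSurjective π0 hsurjπ).symm (π0 x) = (LinearMap.ker π0).mkQ x := by
        rw [LinearEquiv.symm_apply_eq]; rfl
      show (LinearMap.ker π0).liftQ h' hker ((LinearMap.quotKerEquivOfSurjective π0 hsurjπ).symm (π0 x)) = _
      rw [this]; rfl
    ext c
    obtain ⟨x, rfl⟩ := hsurjπ c
    have h5 := hJ g' (π0 x)
    rw [hg'] at h5
    have h6 : h.hom x ∈ LinearMap.range i := by
      have h7 : h.hom x = h' x + i (χ.hom x) := by
        show h.hom x = (h.hom x - i (χ.hom x)) + i (χ.hom x)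
        rw [sub_add_cancel]
      rw [h7]
      exact Submodule.add_mem _ h5 ⟨_, rfl⟩
    have h8 : g (π0 x) = 0 := by
      rw [← hh x]
      simpa using h6
    exact h8
  rw [← LinearMap.range_eq_top]
  exact Submodule.Quotient.subsingleton_iff.1 hN
end idealgen

section existsSa
set_option linter.unusedSectionVars false
variable {k : Type} [Field k] {E : Type} [Fintype E] {G : Type} [AddCommGroup G]
variable {wt : (E → ℤ) →+ G}

lemma ufd_gcd {A ι : Type} [CommRing A] [IsDomain A] [UniqueFactorizationMonoid A] (s : Finset ι) (f : ι → A) :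
    ∃ g : A, (∀ x ∈ s, g ∣ f x) ∧ ∀ a c : A, (∀ x ∈ s, a ∣ c * f x) → a ∣ c * g := by
  classical
  let _ : NormalizedGCDMonoid A := Classical.choice inferInstance
  refine ⟨s.gcd f, fun x hx => Finset.gcd_dvd hx, fun a c h => ?_⟩
  exact (Finset.dvd_gcd h).trans (Finset.gcd_mul_left' _ _ c).dvd

lemma homW_unique {p : MvPolynomial E k} (hp : p ≠ 0) {β β' : G} (h : HomW wt β p) (h' : HomW wt β' p) : β = β' := by
  obtain ⟨d, hd⟩ := MvPolynomial.ne_zero_iff.1 hp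
  rw [← h d (MvPolynomial.mem_support_iff.2 hd), ← h' d (MvPolynomial.mem_support_iff.2 hd)]

lemma X_dvd_zz (e : E) {v : E → ℤ} (hv : 0 ≤ v) (he : 1 ≤ v e) :
    (MvPolynomial.X e : MvPolynomial E k) ∣ zz k v := by
  classical
  refine ⟨MvPolynomial.monomial (toN v - Finsupp.single e 1) 1, ?_⟩
  rw [zz_pos hv, MvPolynomial.X, MvPolynomial.monomial_mul, one_mul]
  suffices h : toN v = Finsupp.single e 1 + (toN v - Finsupp.single e 1) by rw [← h]
  ext x
  have hx : 0 ≤ v x := hv x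
  by_cases h : x = e
  · subst h
    simp; omega
  · simp [Finsupp.single_apply, Ne.symm h]

variable {R : Type} [CommRing R] [Algebra k R] [Algebra R (MvPolynomial E k)]
  [IsScalarTower k R (MvPolynomial E k)]

theorem exists_Sa [TwoUniqueSums G] (hT : Toric k wt R) [IsNoetherianRing R] [IsDomain R]
    (C : ModuleCat.{0} R) (hfin : Module.Finite R C) (hb : Function.Bijective (LinearMap.lsmul R C))
    (hext : ∀ i : ℕ, 1 ≤ i → Subsingleton (((Ext R (ModuleCat.{0} R) i).obj (Opposite.op C)).obj C)) :
    ∃ α, Nonempty (Sa hT α ≃ₗ[R] C) ∧ ∀ e, ∃ f : E → ℤ, 0 ≤ f ∧ wt f = α ∧ f e = 0 := by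
  classical
  set ι := algebraMap R (MvPolynomial E k) with hι
  obtain ⟨f, hf⟩ := sd_exists_inj C hb
  obtain ⟨s, hs⟩ := hfin.fg_top
  obtain ⟨g, hg1, hg2⟩ := ufd_gcd s (fun c => ι (f c))
  have hg : ∀ c, g ∣ ι (f c) := by
    intro c
    have hc : c ∈ Submodule.span R (s : Set C) := by rw [hs]; trivial
    induction hc using Submodule.span_induction with
    | mem x hx => exact hg1 x hx
    | zero => simp
    | add x y _ _ hx hy => rw [map_add, map_add]; exact dvd_add hx hy
    | smul a x _ hx => rw [map_smul, smul_eq_mul, map_mul]; exact hx.mul_left _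
  have hg2' : ∀ a c, (∀ x, a ∣ c * ι (f x)) → a ∣ c * g := fun a c h => hg2 a c (fun x _ => h x)
  obtain ⟨c0, hc0⟩ : ∃ c0 : C, c0 ≠ 0 := by
    by_contra hcon
    push Not at hcon
    apply one_ne_zero (α := R)
    apply hb.1
    ext c
    rw [hcon c]; simp
  have ha0 : f c0 ≠ 0 := fun h => hc0 (hf (by rw [h, map_zero]))
  have hιa0 : ι (f c0) ≠ 0 := fun h => ha0 (hT.inj (by rw [← hι, h, map_zero]))
  obtain ⟨a', ha'⟩ := hg c0
  have hg0 : g ≠ 0 := by rintro rfl; exact hιa0 (by rw [ha', zero_mul])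
  have ha'0 : a' ≠ 0 := by rintro rfl; exact hιa0 (by rw [ha', mul_zero])
  obtain ⟨γ, hγ, -⟩ := homW_factor wt hg0 ha'0 (by rw [← ha']; exact hT.hom (f c0))
  let J : Ideal R :=
    { carrier := {r | g ∣ ι r}
      add_mem' := by intro x y hx hy; show g ∣ ι (x + y); rw [map_add]; exact dvd_add hx hy
      zero_mem' := by show g ∣ ι 0; simp
      smul_mem' := by intro r x hx; show g ∣ ι (r • x); rw [smul_eq_mul, map_mul]; exact hx.mul_left _ }
  let i : C →ₗ[R] J := LinearMap.codRestrict J f hg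
  have hi : Function.Injective i := by
    intro x y hxy
    exact hf (congrArg Subtype.val hxy)
  have hsurj : Function.Surjective i := by
    apply sd_sat C hb.1 (hext 1 le_rfl) J i hi
    intro φ
    have hcomm : ∀ x, f x * (φ c0 : R) = f c0 * (φ x : R) := by
      intro x
      have h1 : f x • c0 = f c0 • x := hf (by rw [map_smul, map_smul, smul_eq_mul, smul_eq_mul, mul_comm])
      have h2 := congrArg (fun z => (φ z : R)) h1
      simpa using h2
    obtain ⟨b', hb'⟩ : g ∣ ι (φ c0 : R) := (φ c0).2
    have hdiv : a' * g ∣ b' * g := by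
      apply hg2'
      intro x
      obtain ⟨y, hy⟩ : g ∣ ι (φ x : R) := (φ x).2
      have h1 := congrArg ι (hcomm x)
      rw [map_mul, map_mul, hb', ha', hy] at h1
      refine ⟨y, ?_⟩
      apply mul_left_cancel₀ hg0
      linear_combination h1
    obtain ⟨q, hq⟩ := hdiv
    have hbq : b' = a' * q := by
      apply mul_right_cancel₀ hg0
      linear_combination hq
    have hιb : ι (φ c0 : R) = ι (f c0) * q := by rw [hb', ha', hbq]; ring
    have hqh : HomW wt 0 q := by
      by_cases hq0 : q = 0
      · rw [hq0]; exact HomW.zero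
      · obtain ⟨β, h1, h2⟩ := homW_factor wt hιa0 hq0 (by rw [← hιb]; exact hT.hom _)
        have := homW_unique hιa0 h1 (hT.hom _)
        rwa [this, sub_zero] at h2
    obtain ⟨t, ht⟩ := (hT.range q).1 hqh
    have hbt : (φ c0 : R) = f c0 * t := by
      apply hT.inj
      rw [map_mul, ht]; exact hιb
    intro x
    refine ⟨t • x, ?_⟩
    apply Subtype.ext
    show f (t • x) = φ x
    apply mul_left_cancel₀ ha0
    rw [← hcomm x, hbt, map_smul, smul_eq_mul]; ring
  have hLex : ∀ p : Sa hT (-γ), ∃ r : R, ι r = g * p := by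
    intro p
    have := hγ.mul (mem_Sa.1 p.2)
    rw [add_neg_cancel] at this
    exact (hT.range _).1 this
  choose L hL using hLex
  let L' : Sa hT (-γ) →ₗ[R] J :=
    { toFun := fun p => ⟨L p, by show g ∣ ι (L p); rw [hL]; exact dvd_mul_right _ _⟩
      map_add' := by
        intro p q
        apply Subtype.ext
        apply hT.inj
        show ι (L (p + q)) = ι (L p + L q)
        rw [map_add, hL, hL, hL]
        show g * ((p : MvPolynomial E k) + q) = _
        ring
      map_smul' := by
        intro r p
        apply Subtype.ext
        apply hT.inj
        show ι (L (r • p)) = ι (r * L p)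
        rw [map_mul, hL, hL]
        show g * (r • (p : MvPolynomial E k)) = _
        rw [Algebra.smul_def]; ring }
  have hL'i : Function.Injective L' := by
    intro p q h
    have h1 : L p = L q := congrArg Subtype.val h
    apply Subtype.ext
    apply mul_left_cancel₀ hg0
    rw [← hL, ← hL, h1]
  have hquot : ∀ (r : R) (p : MvPolynomial E k), ι r = g * p → HomW wt (-γ) p := by
    intro r p hp
    by_cases hp0 : p = 0
    · rw [hp0]; exact HomW.zero
    · obtain ⟨β, h1, h2⟩ := homW_factor wt hg0 hp0 (by rw [← hp]; exact hT.hom _)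
      have := homW_unique hg0 h1 hγ
      rwa [this, zero_sub] at h2
  have hL's : Function.Surjective L' := by
    rintro ⟨r, hr⟩
    obtain ⟨p, hp⟩ : g ∣ ι r := hr
    refine ⟨⟨p, hquot r p hp⟩, ?_⟩
    apply Subtype.ext
    apply hT.inj
    show ι (L _) = ι r
    rw [hL, hp]
  refine ⟨-γ, ⟨(LinearEquiv.ofBijective L' ⟨hL'i, hL's⟩).trans (LinearEquiv.ofBijective i ⟨hi, hsurj⟩).symm⟩, ?_⟩
  intro e
  by_contra hcon
  push Not at hcon
  have hX : ∀ p : MvPolynomial E k, HomW wt (-γ) p → MvPolynomial.X e ∣ p := by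
    intro p hp
    refine HomW.induction (wt := wt) (β := -γ) (M := fun p => MvPolynomial.X e ∣ p) (dvd_zero _) ?_ ?_ p hp
    · intro p q _ _ h1 h2; exact dvd_add h1 h2
    · intro c v hv hw
      have h1 := hcon v hv hw
      have h2 : 0 ≤ v e := hv e
      rw [MvPolynomial.smul_eq_C_mul]
      exact (X_dvd_zz e hv (by omega)).mul_left _
  have : g * MvPolynomial.X e ∣ 1 * g := by
    apply hg2'
    intro x
    obtain ⟨p, hp⟩ := hg x
    rw [one_mul, hp]
    exact mul_dvd_mul_left g (hX p (hquot _ p hp))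
  obtain ⟨q, hq⟩ := this
  have h1 : (1 : MvPolynomial E k) = MvPolynomial.X e * q := by
    apply mul_left_cancel₀ hg0
    linear_combination hq
  have h2 := congrArg (MvPolynomial.eval (0 : E → k)) h1
  simp at h2
end existsSa

section pnet
variable {E : Type} [Fintype E] [DecidableEq E]

/-- net excess at a node -/
def bd (inc : ℕ → E → ℤ) (v : ℕ) (f : E → ℤ) : ℤ := ∑ e, inc v e * f e

omit [DecidableEq E] in
lemma bd_add (inc : ℕ → E → ℤ) (v : ℕ) (f f' : E → ℤ) : bd inc v (f + f') = bd inc v f + bd inc v f' := by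
  unfold bd
  rw [← Finset.sum_add_distrib]
  exact Finset.sum_congr rfl (fun e _ => by simp [mul_add])

lemma bd_single (inc : ℕ → E → ℤ) (v : ℕ) (e : E) (p : ℤ) : bd inc v (Pi.single e p) = inc v e * p := by
  unfold bd
  rw [Finset.sum_eq_single e]
  · simp
  · intro b _ hb; simp [Pi.single_apply, hb]
  · simp

open Classical in
/-- box points with prescribed excess -/
noncomputable def FB (inc : ℕ → E → ℤ) (U : Finset ℕ) (w : E → ℤ) (β : ℕ → ℤ) : Finset (E → ℤ) :=
  (Finset.Icc 0 w).filter (fun f => ∀ v ∈ U, bd inc v f = β v)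

lemma mem_FB {inc : ℕ → E → ℤ} {U : Finset ℕ} {w : E → ℤ} {β : ℕ → ℤ} {f : E → ℤ} :
    f ∈ FB inc U w β ↔ (∀ e, 0 ≤ f e) ∧ (∀ e, f e ≤ w e) ∧ ∀ v ∈ U, bd inc v f = β v := by
  unfold FB
  rw [Finset.mem_filter, Finset.mem_Icc, and_assoc]
  rfl

/-- star property for a set of nodes -/
def StarU (inc : ℕ → E → ℤ) (α : ℕ → ℤ) (U : Finset ℕ) : Prop :=
  ∀ w : E → ℤ, (∀ e, 0 ≤ w e) → (∀ e, (∀ v ∈ U, inc v e = 0) → w e = 0) →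
    (∀ v ∈ U, bd inc v w = bd inc v (-1)) →
    (FB inc U w α).card = (FB inc U w 0).card

lemma FB_card (inc : ℕ → E → ℤ) (U : Finset ℕ) (j : ℕ) (hj : j ∉ U) (ep em : E) (hp : inc j ep = 1)
    (hm : inc j em = -1) (hpU : ∀ v ∈ U, inc v ep = 0) (hmU : ∀ v ∈ U, inc v em = 0)
    (w : E → ℤ) (hwp : w ep = 0) (hwm : w em = 0) (A B : ℤ) (hA : 0 ≤ A) (hB : 0 ≤ B) (β : ℕ → ℤ) :
    (FB inc (insert j U) (w + Pi.single ep A + Pi.single em B) β).card =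
      ∑ f ∈ FB inc U w β,
        (Finset.Icc (max 0 (β j - bd inc j f)) (min A (B + (β j - bd inc j f)))).card := by
  have hne : ep ≠ em := by rintro rfl; omega
  have hne' : em ≠ ep := hne.symm
  rw [← Finset.card_sigma]
  symm
  refine Finset.card_nbij' (fun x => x.1 + Pi.single ep x.2 + Pi.single em (x.2 - (β j - bd inc j x.1)))
    (fun f => ⟨Function.update (Function.update f ep 0) em 0, f ep⟩) ?_ ?_ ?_ ?_
  · rintro ⟨f, p⟩ hx
    simp only [Finset.coe_sigma, Set.mem_sigma_iff, Finset.mem_coe] at hx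
    obtain ⟨h1, h2⟩ := hx
    rw [mem_FB] at h1
    rw [Finset.mem_Icc] at h2
    obtain ⟨h3, h4, h5⟩ := h1
    rw [Finset.mem_coe, mem_FB]
    refine ⟨fun e => ?_, fun e => ?_, fun v hv => ?_⟩
    · have := h3 e
      simp only [Pi.add_apply, Pi.single_apply]
      split_ifs <;> omega
    · have := h4 e
      simp only [Pi.add_apply, Pi.single_apply]
      split_ifs <;> omega
    · rw [bd_add, bd_add, bd_single, bd_single]
      rcases Finset.mem_insert.1 hv with rfl | hv
      · rw [hp, hm]; ring
      · rw [hpU v hv, hmU v hv, h5 v hv]; ring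
  · intro f hf
    rw [Finset.mem_coe, mem_FB] at hf
    obtain ⟨h3, h4, h5⟩ := hf
    have hdec : f = Function.update (Function.update f ep 0) em 0 + Pi.single ep (f ep) + Pi.single em (f em) := by
      ext e
      by_cases h1 : e = em
      · subst h1; simp [hne']
      · by_cases h2 : e = ep
        · subst h2; simp [hne]
        · simp [h1, h2]
    set f0 := Function.update (Function.update f ep 0) em 0 with hf0
    have hb : ∀ v, bd inc v f = bd inc v f0 + inc v ep * f ep + inc v em * f em := by
      intro v
      conv_lhs => rw [hdec]
      rw [bd_add, bd_add, bd_single, bd_single]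
    simp only [Finset.coe_sigma, Set.mem_sigma_iff, Finset.mem_coe]
    constructor
    · rw [mem_FB]
      refine ⟨fun e => ?_, fun e => ?_, fun v hv => ?_⟩
      · by_cases h1 : e = em
        · subst h1; simp [hf0]
        · by_cases h2 : e = ep
          · subst h2; simp [hf0, hne]
          · simp [hf0, h1, h2, h3 e]
      · have h4e := h4 e
        by_cases h1 : e = em
        · subst h1; simp [hf0, hwm]
        · by_cases h2 : e = ep
          · subst h2; simp [hf0, hne, hwp]
          · simp [h1, h2] at h4e
            simp [hf0, h1, h2, h4e]
      · have := hb v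
        rw [hpU v hv, hmU v hv, h5 v (Finset.mem_insert_of_mem hv)] at this
        linarith
    · have := hb j
      rw [hp, hm, h5 j (Finset.mem_insert_self j U)] at this
      have e1 := h3 ep
      have e2 := h3 em
      have e3 := h4 ep
      have e4 := h4 em
      simp [hne, hne', hwp, hwm] at e3 e4
      rw [Finset.mem_Icc]
      rw [hf0] at this
      omega
  · rintro ⟨f, p⟩ hx
    simp only [Finset.coe_sigma, Set.mem_sigma_iff, Finset.mem_coe] at hx
    obtain ⟨h1, h2⟩ := hx
    rw [mem_FB] at h1
    obtain ⟨h3, h4, h5⟩ := h1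
    have z1 : f ep = 0 := le_antisymm (hwp ▸ h4 ep) (h3 ep)
    have z2 : f em = 0 := le_antisymm (hwm ▸ h4 em) (h3 em)
    have : Function.update (Function.update (f + Pi.single ep p + Pi.single em (p - (β j - bd inc j f))) ep 0) em 0 = f := by
      ext e
      by_cases h1 : e = em
      · subst h1; simp [z2]
      · by_cases h2 : e = ep
        · subst h2; simp [hne, z1]
        · simp [h1, h2]
    simp only [this, Sigma.mk.injEq, heq_eq_eq, true_and]
    simp [hne, z1]
  · intro f hf
    rw [Finset.mem_coe, mem_FB] at hf
    obtain ⟨h3, h4, h5⟩ := hf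
    have hdec : f = Function.update (Function.update f ep 0) em 0 + Pi.single ep (f ep) + Pi.single em (f em) := by
      ext e
      by_cases h1 : e = em
      · subst h1; simp [hne']
      · by_cases h2 : e = ep
        · subst h2; simp [hne]
        · simp [h1, h2]
    have hb : bd inc j f = bd inc j (Function.update (Function.update f ep 0) em 0) + inc j ep * f ep + inc j em * f em := by
      conv_lhs => rw [hdec]
      rw [bd_add, bd_add, bd_single, bd_single]
    rw [hp, hm, h5 j (Finset.mem_insert_self j U)] at hb
    have : f ep - (β j - bd inc j (Function.update (Function.update f ep 0) em 0)) = f em := by linarith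
    simp only [this]
    exact hdec.symm

lemma star_del (inc : ℕ → E → ℤ) (α : ℕ → ℤ) (U : Finset ℕ) (j : ℕ) (hj : j ∉ U) (ep em : E) (hp : inc j ep = 1)
    (hm : inc j em = -1) (hpU : ∀ v ∈ U, inc v ep = 0) (hmU : ∀ v ∈ U, inc v em = 0)
    (hS : StarU inc α (insert j U)) : StarU inc α U := by
  intro w hw hsupp hbd
  have hne : ep ≠ em := by rintro rfl; omega
  have hwp : w ep = 0 := hsupp ep hpU
  have hwm : w em = 0 := hsupp em hmU
  set D := bd inc j (-1) - bd inc j w with hD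
  let c : (ℕ → ℤ) → (E → ℤ) → ℤ := fun β f => β j - bd inc j f
  let K : (ℕ → ℤ) → ℤ := fun β => ∑ f ∈ FB inc U w β, (min (max D 0) (max (-D) 0 + c β f) - max 0 (c β f) + 1)
  let T : (ℕ → ℤ) → ℤ := fun β => ∑ f ∈ FB inc U w β, |c β f|
  have hT0 : ∀ β, 0 ≤ T β := fun β => Finset.sum_nonneg (fun f _ => abs_nonneg _)
  have main : ∀ β t, T β + |D| ≤ t →
      ((FB inc (insert j U) (w + Pi.single ep (t + max D 0) + Pi.single em (t + max (-D) 0)) β).card : ℤ)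
       = t * (FB inc U w β).card + K β := by
    intro β t ht
    have h0 := hT0 β
    have hD0 := abs_nonneg D
    rw [FB_card inc U j hj ep em hp hm hpU hmU w hwp hwm _ _ (by omega) (by omega) β]
    push_cast
    have : t * ((FB inc U w β).card : ℤ) = ∑ f ∈ FB inc U w β, t := by
      rw [Finset.sum_const, nsmul_eq_mul, mul_comm]
    rw [this, ← Finset.sum_add_distrib]
    refine Finset.sum_congr rfl (fun f hf => ?_)
    have hc : |c β f| ≤ T β := Finset.single_le_sum (f := fun f => |c β f|) (fun f _ => abs_nonneg _) hf
    rw [Int.card_Icc]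
    show ((min (t + max D 0) (t + max (-D) 0 + c β f) + 1 - max 0 (c β f)).toNat : ℤ) = _
    have h1 := abs_le.1 hc
    have h2 := abs_nonneg D
    generalize c β f = x at *
    rw [Int.toNat_of_nonneg (by omega)]
    omega
  have step : ∀ t, T α + T 0 + |D| ≤ t → t * ((FB inc U w α).card : ℤ) + K α = t * (FB inc U w 0).card + K 0 := by
    intro t ht
    have a1 := hT0 α
    have a2 := hT0 0
    have a3 := abs_nonneg D
    rw [← main α t (by omega), ← main 0 t (by omega)]
    have := hS (w + Pi.single ep (t + max D 0) + Pi.single em (t + max (-D) 0)) ?_ ?_ ?_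
    · rw [this]
    · intro e
      have := hw e
      simp only [Pi.add_apply, Pi.single_apply]
      split_ifs <;> omega
    · intro e he
      have h1 : e ≠ ep := by rintro rfl; have := he j (Finset.mem_insert_self _ _); omega
      have h2 : e ≠ em := by rintro rfl; have := he j (Finset.mem_insert_self _ _); omega
      simp [h1, h2]
      exact hsupp e (fun v hv => he v (Finset.mem_insert_of_mem hv))
    · intro v hv
      rw [bd_add, bd_add, bd_single, bd_single]
      rcases Finset.mem_insert.1 hv with rfl | hv
      · rw [hp, hm]; omega
      · rw [hpU v hv, hmU v hv, hbd v hv]; ring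
  have s1 := step _ le_rfl
  have s2 := step (T α + T 0 + |D| + 1) (by omega)
  have : ((FB inc U w α).card : ℤ) = (FB inc U w 0).card := by linarith
  exact_mod_cast this
end pnet

section pnet2
variable {E : Type} [Fintype E] [DecidableEq E]

/-- a path-shaped network with all in- and out-degrees at least two -/
structure PNet (g : ℕ) (inc : ℕ → E → ℤ) (x : ℕ → E) (τ : ℕ → ℤ) : Prop where
  tau : ∀ c, τ c = 1 ∨ τ c = -1
  hx : ∀ c, c + 1 < g → inc c (x c) = τ c ∧ inc (c+1) (x c) = - τ c
  loc : ∀ v u e, v < u → u < g → inc v e ≠ 0 → inc u e ≠ 0 → u = v + 1 ∧ e = x v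
  sgn : ∀ v e, inc v e = 0 ∨ inc v e = 1 ∨ inc v e = -1
  deg : ∀ v, v < g → ∀ η : ℤ, η = 1 ∨ η = -1 → ∃ e₁ e₂, e₁ ≠ e₂ ∧ inc v e₁ = η ∧ inc v e₂ = η

variable {g : ℕ} {inc : ℕ → E → ℤ} {x : ℕ → E} {τ : ℕ → ℤ} {α : ℕ → ℤ}

omit [Fintype E] in
lemma PNet.other (hN : PNet g inc x τ) {v : ℕ} (hv : v < g) (e0 : E) {η : ℤ} (hη : η = 1 ∨ η = -1) :
    ∃ e, e ≠ e0 ∧ inc v e = η := by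
  obtain ⟨e1, e2, hne, h1, h2⟩ := hN.deg v hv η hη
  by_cases h : e1 = e0
  · exact ⟨e2, fun h' => hne (h.trans h'.symm), h2⟩
  · exact ⟨e1, h, h1⟩

lemma PNet.star_right (hN : PNet g inc x τ) {a b : ℕ} (hab : a ≤ b) (hb : b < g)
    (hS : StarU inc α (Finset.Ico a (b+1))) : StarU inc α (Finset.Ico a b) := by
  obtain ⟨ep, hep, hep1⟩ := hN.other hb (x (b-1)) (Or.inl rfl)
  obtain ⟨em, hem, hem1⟩ := hN.other hb (x (b-1)) (Or.inr rfl)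
  have key : ∀ e, e ≠ x (b-1) → inc b e ≠ 0 → ∀ v ∈ Finset.Ico a b, inc v e = 0 := by
    intro e he hbe v hv
    by_contra hne
    rw [Finset.mem_Ico] at hv
    obtain ⟨h1, h2⟩ := hN.loc v b e hv.2 hb hne hbe
    apply he
    rw [h2]; congr 1; omega
  refine star_del inc α _ b (by simp) ep em hep1 hem1 (key ep hep (by omega)) (key em hem (by omega)) ?_
  have : insert b (Finset.Ico a b) = Finset.Ico a (b+1) := by
    ext z; simp; omega
  rwa [this]

lemma PNet.star_left (hN : PNet g inc x τ) {a b : ℕ} (hab : a < b) (hb : b ≤ g)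
    (hS : StarU inc α (Finset.Ico a b)) : StarU inc α (Finset.Ico (a+1) b) := by
  obtain ⟨ep, hep, hep1⟩ := hN.other (hab.trans_le hb) (x a) (Or.inl rfl)
  obtain ⟨em, hem, hem1⟩ := hN.other (hab.trans_le hb) (x a) (Or.inr rfl)
  have key : ∀ e, e ≠ x a → inc a e ≠ 0 → ∀ v ∈ Finset.Ico (a+1) b, inc v e = 0 := by
    intro e he hbe v hv
    by_contra hne
    rw [Finset.mem_Ico] at hv
    obtain ⟨h1, h2⟩ := hN.loc a v e (by omega) (by omega) hbe hne
    exact he h2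
  refine star_del inc α _ a (by simp) ep em hep1 hem1 (key ep hep (by omega)) (key em hem (by omega)) ?_
  have : insert a (Finset.Ico (a+1) b) = Finset.Ico a b := by
    ext z; simp; omega
  rwa [this]

lemma PNet.star_interval (hN : PNet g inc x τ) (hS : StarU inc α (Finset.Ico 0 g)) {a b : ℕ} (hab : a ≤ b) (hb : b ≤ g) :
    StarU inc α (Finset.Ico a b) := by
  have h1 : ∀ t, t ≤ g → StarU inc α (Finset.Ico 0 (g - t)) := by
    intro t
    induction t with
    | zero => intro _; simpa using hS
    | succ t ih =>
      intro ht
      apply hN.star_right (Nat.zero_le _) (by omega)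
      have := ih (by omega)
      rwa [show g - t = g - (t+1) + 1 by omega] at this
  have h2 : StarU inc α (Finset.Ico 0 b) := by
    have := h1 (g - b) (by omega)
    rwa [show g - (g - b) = b by omega] at this
  have h3 : ∀ t, t ≤ b → StarU inc α (Finset.Ico t b) := by
    intro t
    induction t with
    | zero => intro _; exact h2
    | succ t ih => intro ht; exact hN.star_left (by omega) hb (ih (by omega))
  exact h3 a hab

lemma bd_of_supp (v : ℕ) (f : E → ℤ) (s : Finset E) (h : ∀ e, e ∉ s → inc v e = 0 ∨ f e = 0) :
    bd inc v f = ∑ e ∈ s, inc v e * f e := by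
  unfold bd
  symm
  apply Finset.sum_subset (Finset.subset_univ s)
  intro e _ he
  rcases h e he with h | h <;> simp [h]

/-- toggling a pair of parallel arcs -/
def togl (e1 e2 : E) (f : E → ℤ) : E → ℤ :=
  if f e1 = 0 then f + Pi.single e1 1 + Pi.single e2 (-1) else f + Pi.single e1 (-1) + Pi.single e2 1

omit [Fintype E] in
lemma togl_other {e1 e2 e : E} (f : E → ℤ) (h1 : e ≠ e1) (h2 : e ≠ e2) : togl e1 e2 f e = f e := by
  unfold togl; split_ifs <;> simp [h1, h2]

omit [Fintype E] in
lemma togl_fst {e1 e2 : E} (f : E → ℤ) (h : e1 ≠ e2) : togl e1 e2 f e1 = if f e1 = 0 then 1 else f e1 - 1 := by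
  unfold togl; split_ifs with h0 <;> simp [h, h0]; ring

omit [Fintype E] in
lemma togl_snd {e1 e2 : E} (f : E → ℤ) (h : e1 ≠ e2) : togl e1 e2 f e2 = if f e1 = 0 then f e2 - 1 else f e2 + 1 := by
  unfold togl; split_ifs with h0 <;> simp [h.symm]; ring

lemma togl_mem {U : Finset ℕ} {w : E → ℤ} {β : ℕ → ℤ} {e1 e2 : E} (hne : e1 ≠ e2)
    (hinc : ∀ v ∈ U, inc v e1 = inc v e2) (h1 : w e1 = 1) {f : E → ℤ} (hf : f ∈ FB inc U w β)
    (hext : ¬ ((f e1 = 0 ∧ f e2 = 0) ∨ (f e1 = 1 ∧ f e2 = w e2))) :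
    togl e1 e2 f ∈ FB inc U w β ∧ ¬ ((togl e1 e2 f e1 = 0 ∧ togl e1 e2 f e2 = 0) ∨
      (togl e1 e2 f e1 = 1 ∧ togl e1 e2 f e2 = w e2)) ∧ togl e1 e2 (togl e1 e2 f) = f ∧ togl e1 e2 f ≠ f := by
  rw [mem_FB] at hf
  obtain ⟨h3, h4, h5⟩ := hf
  have a1 := h3 e1
  have a2 := h3 e2
  have a3 := h4 e1
  have a4 := h4 e2
  have b1 := togl_fst f hne
  have b2 := togl_snd f hne
  refine ⟨?_, ?_, ?_, ?_⟩
  · rw [mem_FB]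
    have hcase : ∀ e, 0 ≤ togl e1 e2 f e ∧ togl e1 e2 f e ≤ w e := by
      intro e
      by_cases he1 : e = e1
      · subst he1; rw [b1]; split_ifs <;> omega
      · by_cases he2 : e = e2
        · subst he2; rw [b2]; split_ifs <;> omega
        · rw [togl_other f he1 he2]; exact ⟨h3 e, h4 e⟩
    refine ⟨fun e => (hcase e).1, fun e => (hcase e).2, fun v hv => ?_⟩
    unfold togl
    split_ifs <;> rw [bd_add, bd_add, bd_single, bd_single, h5 v hv, hinc v hv] <;> ring
  · rw [b1, b2]; split_ifs <;> omega
  · ext e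
    by_cases he1 : e = e1
    · subst he1
      rw [togl_fst _ hne, b1]
      split_ifs <;> omega
    · by_cases he2 : e = e2
      · subst he2
        rw [togl_snd _ hne, b1, b2]; split_ifs <;> omega
      · rw [togl_other _ he1 he2, togl_other _ he1 he2]
  · intro h
    rw [h] at b1
    split_ifs at b1 <;> omega

open Classical in
lemma parity_ext {U : Finset ℕ} {w : E → ℤ} {β : ℕ → ℤ} (e1 e2 : ℕ → E) (V : Finset ℕ)
    (hne : ∀ v ∈ V, e1 v ≠ e2 v) (hinc : ∀ v ∈ V, ∀ u ∈ U, inc u (e1 v) = inc u (e2 v))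
    (h1 : ∀ v ∈ V, w (e1 v) = 1)
    (hdis : ∀ v ∈ V, ∀ u ∈ V, u ≠ v → e1 u ≠ e1 v ∧ e1 u ≠ e2 v ∧ e2 u ≠ e1 v ∧ e2 u ≠ e2 v) :
    ((FB inc U w β).card : ZMod 2) = (((FB inc U w β).filter (fun f => ∀ v ∈ V,
      (f (e1 v) = 0 ∧ f (e2 v) = 0) ∨ (f (e1 v) = 1 ∧ f (e2 v) = w (e2 v)))).card : ZMod 2) := by
  induction V using Finset.induction_on with
  | empty => simp
  | insert v V hv ih =>
    rw [ih (fun v hv => hne v (Finset.mem_insert_of_mem hv)) (fun v hv => hinc v (Finset.mem_insert_of_mem hv))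
      (fun v hv => h1 v (Finset.mem_insert_of_mem hv))
      (fun v hv u hu => hdis v (Finset.mem_insert_of_mem hv) u (Finset.mem_insert_of_mem hu))]
    set S := (FB inc U w β).filter (fun f => ∀ v ∈ V,
      (f (e1 v) = 0 ∧ f (e2 v) = 0) ∨ (f (e1 v) = 1 ∧ f (e2 v) = w (e2 v))) with hS
    have hsplit : (FB inc U w β).filter (fun f => ∀ u ∈ insert v V,
      (f (e1 u) = 0 ∧ f (e2 u) = 0) ∨ (f (e1 u) = 1 ∧ f (e2 u) = w (e2 u))) =
      S.filter (fun f => (f (e1 v) = 0 ∧ f (e2 v) = 0) ∨ (f (e1 v) = 1 ∧ f (e2 v) = w (e2 v))) := by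
      ext f
      simp only [hS, Finset.mem_filter, Finset.forall_mem_insert]
      tauto
    rw [hsplit, ← Finset.card_filter_add_card_filter_not (s := S)
      (p := fun f => (f (e1 v) = 0 ∧ f (e2 v) = 0) ∨ (f (e1 v) = 1 ∧ f (e2 v) = w (e2 v)))]
    push_cast
    have : (((S.filter (fun f => ¬ ((f (e1 v) = 0 ∧ f (e2 v) = 0) ∨ (f (e1 v) = 1 ∧ f (e2 v) = w (e2 v))))).card : ℕ) : ZMod 2) = 0 := by
      rw [Finset.card_eq_sum_ones]
      push_cast
      have hvm := Finset.mem_insert_self v V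
      have hT : ∀ f ∈ S.filter (fun f => ¬ ((f (e1 v) = 0 ∧ f (e2 v) = 0) ∨ (f (e1 v) = 1 ∧ f (e2 v) = w (e2 v)))),
          f ∈ FB inc U w β ∧ ¬ ((f (e1 v) = 0 ∧ f (e2 v) = 0) ∨ (f (e1 v) = 1 ∧ f (e2 v) = w (e2 v))) := by
        intro f hf
        simp only [hS, Finset.mem_filter] at hf
        exact ⟨hf.1.1, hf.2⟩
      refine Finset.sum_involution (fun f _ => togl (e1 v) (e2 v) f) ?_ ?_ ?_ ?_
      · intro f _; decide
      · intro f hf _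
        exact (togl_mem (hne v hvm) (hinc v hvm) (h1 v hvm) (hT f hf).1 (hT f hf).2).2.2.2
      · intro f hf
        have := togl_mem (hne v hvm) (hinc v hvm) (h1 v hvm) (hT f hf).1 (hT f hf).2
        rw [Finset.mem_filter, hS, Finset.mem_filter]
        refine ⟨⟨this.1, ?_⟩, this.2.1⟩
        intro u hu
        have huv : u ≠ v := by rintro rfl; exact hv hu
        obtain ⟨d1, d2, d3, d4⟩ := hdis v hvm u (Finset.mem_insert_of_mem hu) huv
        rw [togl_other _ d1 d2, togl_other _ d3 d4]
        simp only [hS, Finset.mem_filter] at hf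
        exact hf.1.2 u hu
      · intro f hf
        exact (togl_mem (hne v hvm) (hinc v hvm) (h1 v hvm) (hT f hf).1 (hT f hf).2).2.2.1
    rw [this, add_zero]
end pnet2

section pnet3
variable {E : Type} [Fintype E] [DecidableEq E]
variable {g : ℕ} {inc : ℕ → E → ℤ} {x : ℕ → E} {τ : ℕ → ℤ} {α : ℕ → ℤ}

lemma PNet.single (hN : PNet g inc x τ) {v : ℕ} (hv : v < g) (hS : StarU inc α {v}) :
    α v = 0 ∨ α v = bd inc v (-1) := by
  set κ := bd inc v (-1) with hκ
  have main : ∀ η : ℤ, (η = 1 ∨ η = -1) → 0 < η * κ → α v = 0 ∨ α v = κ := by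
    intro η hη hpos
    obtain ⟨e1, e2, hne, h1, h2⟩ := hN.deg v hv η hη
    have hηη : η * η = 1 := by rcases hη with rfl | rfl <;> norm_num
    set w : E → ℤ := Pi.single e1 1 + Pi.single e2 (η * κ - 1) with hw
    have w1 : w e1 = 1 := by simp [hw, hne]
    have w2 : w e2 = η * κ - 1 := by simp [hw, hne.symm]
    have w3 : ∀ e, e ≠ e1 → e ≠ e2 → w e = 0 := by intro e h3 h4; simp [hw, h3, h4]
    have hw0 : ∀ e, 0 ≤ w e := by
      intro e
      by_cases h3 : e = e1
      · rw [h3, w1]; norm_num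
      · by_cases h4 : e = e2
        · rw [h4, w2]; omega
        · rw [w3 e h3 h4]
    have hbdf : ∀ β f, f ∈ FB inc {v} w β → η * (f e1 + f e2) = β v := by
      intro β f hf
      rw [mem_FB] at hf
      obtain ⟨h3, h4, h5⟩ := hf
      rw [← h5 v (Finset.mem_singleton_self v), bd_of_supp v f {e1, e2}, Finset.sum_pair hne, h1, h2]
      · ring
      · intro e he
        right
        simp only [Finset.mem_insert, Finset.mem_singleton, not_or] at he
        have a1 := h3 e
        have a2 := h4 e
        rw [w3 e he.1 he.2] at a2
        omega
    have hcard := hS w hw0 ?_ ?_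
    · have h0 : FB inc {v} w 0 = {0} := by
        ext f
        rw [Finset.mem_singleton]
        constructor
        · intro hf
          have h3 := hbdf 0 f hf
          rw [mem_FB] at hf
          have a1 := hf.1 e1
          have a2 := hf.1 e2
          have h4 : f e1 + f e2 = 0 := by
            have : η * (η * (f e1 + f e2)) = 0 := by rw [h3]; simp
            rwa [← mul_assoc, hηη, one_mul] at this
          ext e
          by_cases h5 : e = e1
          · rw [h5]; simp; omega
          · by_cases h6 : e = e2
            · rw [h6]; simp; omega
            · have b1 := hf.1 e
              have b2 := hf.2.1 e
              rw [w3 e h5 h6] at b2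
              simp; omega
        · rintro rfl
          rw [mem_FB]
          refine ⟨fun e => le_rfl, fun e => hw0 e, fun u _ => by simp [bd]⟩
      rw [h0, Finset.card_singleton, Finset.card_eq_one] at hcard
      obtain ⟨f, hf⟩ := hcard
      have hfm : f ∈ FB inc {v} w α := by rw [hf]; simp
      by_cases hext : (f e1 = 0 ∧ f e2 = 0) ∨ (f e1 = 1 ∧ f e2 = w e2)
      · have := hbdf α f hfm
        rcases hext with ⟨b1, b2⟩ | ⟨b1, b2⟩
        · left; rw [← this, b1, b2]; simp
        · right; rw [← this, b1, b2, w2]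
          linear_combination κ * hηη
      · have := togl_mem hne (fun u hu => by rw [Finset.mem_singleton.1 hu, h1, h2]) w1 hfm hext
        have h3 := this.1
        rw [hf, Finset.mem_singleton] at h3
        exact absurd h3 this.2.2.2
    · intro e he
      have := he v (Finset.mem_singleton_self v)
      apply w3
      · rintro rfl; rw [h1] at this; rcases hη with rfl | rfl <;> omega
      · rintro rfl; rw [h2] at this; rcases hη with rfl | rfl <;> omega
    · intro u hu
      rw [Finset.mem_singleton.1 hu, hw, bd_add, bd_single, bd_single, h1, h2, ← hκ]
      linear_combination κ * hηη
  rcases lt_trichotomy κ 0 with h | h | h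
  · exact main (-1) (Or.inr rfl) (by omega)
  · have hcard := hS 0 (fun _ => le_rfl) (fun _ _ => rfl) (by
      intro u hu
      rw [Finset.mem_singleton.1 hu, ← hκ, h]; simp [bd])
    have h0 : (0 : E → ℤ) ∈ FB inc {v} 0 0 := by
      rw [mem_FB]
      refine ⟨fun e => le_rfl, fun e => le_rfl, fun u _ => by simp [bd]⟩
    have h1 : 0 < (FB inc {v} 0 α).card := by
      rw [hcard]; exact Finset.card_pos.2 ⟨0, h0⟩
    obtain ⟨f, hf⟩ := Finset.card_pos.1 h1
    rw [mem_FB] at hf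
    have hf0 : f = 0 := by
      ext e; exact le_antisymm (hf.2.1 e) (hf.1 e)
    left
    rw [← hf.2.2 v (Finset.mem_singleton_self v), hf0]; simp [bd]
  · exact main 1 (Or.inl rfl) (by omega)

omit [Fintype E] in
lemma PNet.gadget_end (hN : PNet g inc x τ) {v : ℕ} (hv : v < g) (e0 : E) (σ : ℤ) (hσ : σ = 1 ∨ σ = -1)
    (h0 : inc v e0 = σ) (κ : ℤ) (hκ : κ ≠ 0) :
    ∃ (e1 e2 : E) (c1 c2 : ℤ), e1 ≠ e2 ∧ e1 ≠ e0 ∧ e2 ≠ e0 ∧ inc v e1 ≠ 0 ∧ inc v e2 ≠ 0 ∧ 0 ≤ c1 ∧ 0 ≤ c2 ∧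
      (c1 = 0 ∨ (c1 = 1 ∧ inc v e1 = inc v e2)) ∧ σ + inc v e1 * c1 + inc v e2 * c2 = κ ∧
      ∀ b p q : ℤ, 0 ≤ b → b ≤ 1 → 0 ≤ p → p ≤ c1 → 0 ≤ q → q ≤ c2 →
        (c1 = 1 → (p = 0 ∧ q = 0) ∨ (p = 1 ∧ q = c2)) →
        (σ * b + inc v e1 * p + inc v e2 * q = 0 → b = 0 ∧ p = 0 ∧ q = 0) ∧
        (σ * b + inc v e1 * p + inc v e2 * q = κ → b = 1) := by
  by_cases hs : σ * κ < 0
  · obtain ⟨e1, e2, hne, h1, h2⟩ := hN.deg v hv (-σ) (by omega)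
    refine ⟨e1, e2, 1, |κ|, hne, ?_, ?_, by omega, by omega, by omega, abs_nonneg _, Or.inr ⟨rfl, h1.trans h2.symm⟩, ?_, ?_⟩
    · rintro rfl; omega
    · rintro rfl; omega
    · rw [h1, h2]
      rcases hσ with rfl | rfl
      · rw [abs_of_neg (by omega)]; omega
      · rw [abs_of_pos (by omega)]; omega
    · intro b p q hb hb' hp hp' hq hq' hext
      rw [h1, h2]
      have hext := hext rfl
      rcases hσ with rfl | rfl
      · rw [abs_of_neg (by omega)] at hext; omega
      · rw [abs_of_pos (by omega)] at hext; omega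
  · obtain ⟨e2, hne2, h2⟩ := hN.other hv e0 hσ
    obtain ⟨e1, hne1, h1⟩ := hN.other hv e0 (η := -σ) (by omega)
    refine ⟨e1, e2, 0, |κ| - 1, ?_, hne1, hne2, by omega, by omega, le_rfl, ?_, Or.inl rfl, ?_, ?_⟩
    · rintro rfl; omega
    · have := abs_pos.2 hκ; omega
    · rw [h1, h2]
      rcases hσ with rfl | rfl
      · rw [abs_of_pos (by omega)]; omega
      · rw [abs_of_neg (by omega)]; omega
    · intro b p q hb hb' hp hp' hq hq' hext
      rw [h1, h2]
      rcases hσ with rfl | rfl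
      · rw [abs_of_pos (by omega)] at hq'; omega
      · rw [abs_of_neg (by omega)] at hq'; omega

omit [Fintype E] in
lemma PNet.gadget_mid (hN : PNet g inc x τ) {v : ℕ} (hv : v < g) (e0 e0' : E) (σ σ' : ℤ) (hσ : σ = 1 ∨ σ = -1)
    (hσ' : σ' = 1 ∨ σ' = -1)
    (h0 : inc v e0 = σ) (h0' : inc v e0' = σ') :
    ∃ (e1 e2 : E) (c1 c2 : ℤ), e1 ≠ e2 ∧ e1 ≠ e0 ∧ e2 ≠ e0 ∧ e1 ≠ e0' ∧ e2 ≠ e0' ∧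
      inc v e1 ≠ 0 ∧ inc v e2 ≠ 0 ∧ 0 ≤ c1 ∧ 0 ≤ c2 ∧
      (c1 = 0 ∨ (c1 = 1 ∧ inc v e1 = inc v e2)) ∧ σ + σ' + inc v e1 * c1 + inc v e2 * c2 = 0 ∧
      ∀ a b p q : ℤ, 0 ≤ a → a ≤ 1 → 0 ≤ b → b ≤ 1 → 0 ≤ p → p ≤ c1 → 0 ≤ q → q ≤ c2 →
        (c1 = 1 → (p = 0 ∧ q = 0) ∨ (p = 1 ∧ q = c2)) →
        (σ * a + σ' * b + inc v e1 * p + inc v e2 * q = 0 → a = b ∧ (b = 0 → p = 0 ∧ q = 0)) := by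
  by_cases hs : σ = σ'
  · subst hs
    obtain ⟨e1, e2, hne, h1, h2⟩ := hN.deg v hv (-σ) (by omega)
    refine ⟨e1, e2, 1, 1, hne, ?_, ?_, ?_, ?_, by omega, by omega, by omega, by omega, Or.inr ⟨rfl, h1.trans h2.symm⟩, ?_, ?_⟩
    · rintro rfl; omega
    · rintro rfl; omega
    · rintro rfl; omega
    · rintro rfl; omega
    · rw [h1, h2]; ring
    · intro a b p q ha ha' hb hb' hp hp' hq hq' hext
      rw [h1, h2]
      have hext := hext rfl
      rcases hσ with rfl | rfl <;> omega
  · obtain ⟨e2, hne2, h2⟩ := hN.other hv e0 hσ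
    obtain ⟨e1, hne1, h1⟩ := hN.other hv e0' hσ'
    refine ⟨e1, e2, 0, 0, ?_, ?_, hne2, hne1, ?_, by omega, by omega, le_rfl, le_rfl, Or.inl rfl, ?_, ?_⟩
    · rintro rfl; omega
    · rintro rfl; omega
    · rintro rfl; omega
    · omega
    · intro a b p q ha ha' hb hb' hp hp' hq hq' hext
      rw [h1, h2]
      rcases hσ with rfl | rfl <;> rcases hσ' with rfl | rfl <;> omega

end pnet3

section pnet4
variable {E : Type} [Fintype E] [DecidableEq E]
variable {g : ℕ} {inc : ℕ → E → ℤ} {x : ℕ → E} {τ : ℕ → ℤ} {α : ℕ → ℤ}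

omit [Fintype E] [DecidableEq E] in
lemma PNet.key (hN : PNet g inc x τ) {i j u v : ℕ} (hj : j < g) (hu : i ≤ u) (hu' : u ≤ j)
    (hv : i ≤ v) (hv' : v ≤ j) (e : E) (h1 : i < v → e ≠ x (v-1)) (h2 : v < j → e ≠ x v)
    (h3 : inc u e ≠ 0) (h4 : inc v e ≠ 0) : u = v := by
  rcases lt_trichotomy u v with h | h | h
  · obtain ⟨h5, h6⟩ := hN.loc u v e h (by omega) h3 h4
    exact absurd (by rw [h6, h5]; rfl) (h1 (by omega))
  · exact h
  · obtain ⟨h5, h6⟩ := hN.loc v u e h (by omega) h4 h3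
    exact absurd h6 (h2 (by omega))

omit [Fintype E] in
lemma PNet.gadget (hN : PNet g inc x τ) {i j : ℕ} (hij : i < j) (hj : j < g) (κ : ℕ → ℤ)
    (hκi : κ i ≠ 0) (hκj : κ j ≠ 0) (hmid : ∀ v, i < v → v < j → κ v = 0) (v : ℕ) (hv : i ≤ v) (hv' : v ≤ j) :
    ∃ (e1 e2 : E) (c1 c2 : ℤ), (e1 ≠ e2 ∧ (i < v → e1 ≠ x (v-1)) ∧ (v < j → e1 ≠ x v) ∧
      (i < v → e2 ≠ x (v-1)) ∧ (v < j → e2 ≠ x v) ∧ inc v e1 ≠ 0 ∧ inc v e2 ≠ 0 ∧ 0 ≤ c1 ∧ 0 ≤ c2 ∧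
      (c1 = 0 ∨ (c1 = 1 ∧ inc v e1 = inc v e2))) ∧
      ((if i < v then -τ (v-1) else 0) + (if v < j then τ v else 0) + inc v e1 * c1 + inc v e2 * c2 = κ v) ∧
      ∀ a b p q : ℤ, 0 ≤ a → a ≤ 1 → 0 ≤ b → b ≤ 1 → 0 ≤ p → p ≤ c1 → 0 ≤ q → q ≤ c2 →
        (c1 = 1 → (p = 0 ∧ q = 0) ∨ (p = 1 ∧ q = c2)) →
        (((if i < v then -τ (v-1) * a else 0) + (if v < j then τ v * b else 0) + inc v e1 * p + inc v e2 * q = 0 →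
          (i < v → v < j → a = b) ∧ ((i < v → a = 0) → (v < j → b = 0) → p = 0 ∧ q = 0) ∧
            (v = i → b = 0) ∧ (v = j → a = 0)) ∧
        ((if i < v then -τ (v-1) * a else 0) + (if v < j then τ v * b else 0) + inc v e1 * p + inc v e2 * q = κ v →
          (i < v → v < j → a = b) ∧ (v = i → b = 1) ∧ (v = j → a = 1))) := by
  have htau : ∀ c, -τ c = 1 ∨ -τ c = -1 := by intro c; have := hN.tau c; omega
  rcases Nat.eq_or_lt_of_le hv with h | h
  · subst h
    obtain ⟨e1, e2, c1, c2, k1, k2, k3, k4, k5, k6, k7, k8, k9, k10⟩ :=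
      hN.gadget_end (v := i) (by omega) (x i) (τ i) (hN.tau i) (hN.hx i (by omega)).1 (κ i) hκi
    have e3 : ¬ (i < i) := by omega
    refine ⟨e1, e2, c1, c2, ⟨k1, by omega, fun _ => k2, by omega, fun _ => k3, k4, k5, k6, k7, k8⟩, ?_, ?_⟩
    · simp only [if_neg e3, if_pos hij, zero_add]; exact k9
    · intro a b p q ha ha' hb hb' hp hp' hq hq' hext
      simp only [if_neg e3, if_pos hij, zero_add]
      obtain ⟨h1, h2⟩ := k10 b p q hb hb' hp hp' hq hq' hext
      refine ⟨fun h => ?_, fun h => ?_⟩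
      · have := h1 h; omega
      · have := h2 h; omega
  · have e3 : v - 1 + 1 = v := by omega
    have hxv : inc v (x (v-1)) = -τ (v-1) := by
      have := (hN.hx (v-1) (by omega)).2; rwa [e3] at this
    rcases Nat.eq_or_lt_of_le hv' with h' | h'
    · subst h'
      obtain ⟨e1, e2, c1, c2, k1, k2, k3, k4, k5, k6, k7, k8, k9, k10⟩ :=
        hN.gadget_end hj (x (v-1)) (-τ (v-1)) (htau _) hxv (κ v) hκj
      have e4 : ¬ (v < v) := by omega
      refine ⟨e1, e2, c1, c2, ⟨k1, fun _ => k2, by omega, fun _ => k3, by omega, k4, k5, k6, k7, k8⟩, ?_, ?_⟩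
      · simp only [if_neg e4, if_pos hij, add_zero]; exact k9
      · intro a b p q ha ha' hb hb' hp hp' hq hq' hext
        simp only [if_neg e4, if_pos hij, add_zero]
        obtain ⟨h1, h2⟩ := k10 a p q ha ha' hp hp' hq hq' hext
        refine ⟨fun h => ?_, fun h => ?_⟩
        · have := h1 h; omega
        · have := h2 h; omega
    · obtain ⟨e1, e2, c1, c2, k1, k2, k3, k2', k3', k4, k5, k6, k7, k8, k9, k10⟩ :=
        hN.gadget_mid (v := v) (by omega) (x (v-1)) (x v) (-τ (v-1)) (τ v) (htau _) (hN.tau _) hxv (hN.hx v (by omega)).1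
      refine ⟨e1, e2, c1, c2, ⟨k1, fun _ => k2, fun _ => k2', fun _ => k3, fun _ => k3', k4, k5, k6, k7, k8⟩, ?_, ?_⟩
      · simp only [if_pos h, if_pos h', hmid v h h']; exact k9
      · intro a b p q ha ha' hb hb' hp hp' hq hq' hext
        simp only [if_pos h, if_pos h', hmid v h h']
        have h1 := k10 a b p q ha ha' hb hb' hp hp' hq hq' hext
        refine ⟨fun h => ?_, fun h => ?_⟩
        · have := h1 h; omega
        · have := h1 h; omega

open Classical in
lemma PNet.no_pair (hN : PNet g inc x τ) {i j : ℕ} (hij : i < j) (hj : j < g)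
    (hS : StarU inc α (Finset.Ico i (j+1)))
    (hκi : bd inc i (-1) ≠ 0) (hκj : bd inc j (-1) ≠ 0) (hmid : ∀ v, i < v → v < j → bd inc v (-1) = 0)
    (hamid : ∀ v, i < v → v < j → α v = 0)
    (hα : (α i = 0 ∧ α j = bd inc j (-1)) ∨ (α i = bd inc i (-1) ∧ α j = 0)) : False := by
  have G := hN.gadget hij hj (fun v => bd inc v (-1)) hκi hκj hmid
  have E0 : Inhabited E := ⟨x 0⟩
  have G' : ∀ v, ∃ (e1 e2 : E) (c1 c2 : ℤ), i ≤ v → v ≤ j → _ := fun v => by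
    by_cases h : i ≤ v ∧ v ≤ j
    · obtain ⟨e1, e2, c1, c2, h⟩ := G v h.1 h.2
      exact ⟨e1, e2, c1, c2, fun _ _ => h⟩
    · exact ⟨x 0, x 0, 0, 0, fun h1 h2 => absurd ⟨h1, h2⟩ h⟩
  choose e1 e2 c1 c2 hG using G'
  clear G
  -- distinctness
  have key1 : ∀ u v, i ≤ u → u ≤ j → i ≤ v → v ≤ j → inc u (e1 v) ≠ 0 → u = v := by
    intro u v hu hu' hv hv' h
    obtain ⟨⟨k0, k1, k2, k3, k4, k5, k6, _⟩, _⟩ := hG v hv hv'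
    exact hN.key hj hu hu' hv hv' _ k1 k2 h k5
  have key2 : ∀ u v, i ≤ u → u ≤ j → i ≤ v → v ≤ j → inc u (e2 v) ≠ 0 → u = v := by
    intro u v hu hu' hv hv' h
    obtain ⟨⟨k0, k1, k2, k3, k4, k5, k6, _⟩, _⟩ := hG v hv hv'
    exact hN.key hj hu hu' hv hv' _ k3 k4 h k6
  have n1 : ∀ v, i ≤ v → v ≤ j → inc v (e1 v) ≠ 0 := fun v hv hv' => (hG v hv hv').1.2.2.2.2.2.1
  have n2 : ∀ v, i ≤ v → v ≤ j → inc v (e2 v) ≠ 0 := fun v hv hv' => (hG v hv hv').1.2.2.2.2.2.2.1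
  have hxc : ∀ c, i ≤ c → c < j → inc c (x c) ≠ 0 := fun c hc hc' => by
    have := (hN.hx c (by omega)).1; have := hN.tau c; omega
  have hxc' : ∀ c, i ≤ c → c < j → inc (c+1) (x c) ≠ 0 := fun c hc hc' => by
    have := (hN.hx c (by omega)).2; have := hN.tau c; omega
  have d1 : ∀ v c, i ≤ v → v ≤ j → i ≤ c → c < j → e1 v ≠ x c := by
    intro v c hv hv' hc hc' h
    have h1 := key1 c v hc (by omega) hv hv' (by rw [h]; exact hxc c hc hc')
    subst h1
    exact (hG c hv hv').1.2.2.1 hc' h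
  have d2 : ∀ v c, i ≤ v → v ≤ j → i ≤ c → c < j → e2 v ≠ x c := by
    intro v c hv hv' hc hc' h
    have h1 := key2 c v hc (by omega) hv hv' (by rw [h]; exact hxc c hc hc')
    subst h1
    exact (hG c hv hv').1.2.2.2.2.1 hc' h
  have d12 : ∀ u v, i ≤ u → u ≤ j → i ≤ v → v ≤ j → e1 u ≠ e2 v := by
    intro u v hu hu' hv hv' h
    have h1 := key1 v u hv hv' hu hu' (by rw [h]; exact n2 v hv hv')
    subst h1
    exact (hG v hv hv').1.1 h
  have d11 : ∀ u v, i ≤ u → u ≤ j → i ≤ v → v ≤ j → e1 u = e1 v → u = v := by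
    intro u v hu hu' hv hv' h
    exact (key1 v u hv hv' hu hu' (by rw [h]; exact n1 v hv hv')).symm
  have d22 : ∀ u v, i ≤ u → u ≤ j → i ≤ v → v ≤ j → e2 u = e2 v → u = v := by
    intro u v hu hu' hv hv' h
    exact (key2 v u hv hv' hu hu' (by rw [h]; exact n2 v hv hv')).symm
  -- the bound w
  obtain ⟨w, wx, w1, w2, w0⟩ : ∃ w : E → ℤ, (∀ c, i ≤ c → c < j → w (x c) = 1) ∧
      (∀ v, i ≤ v → v ≤ j → w (e1 v) = c1 v) ∧ (∀ v, i ≤ v → v ≤ j → w (e2 v) = c2 v) ∧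
      (∀ e, (∀ c, i ≤ c → c < j → e ≠ x c) → (∀ v, i ≤ v → v ≤ j → e ≠ e1 v) → (∀ v, i ≤ v → v ≤ j → e ≠ e2 v) → w e = 0) := by
    refine ⟨fun e => if ∃ c, i ≤ c ∧ c < j ∧ e = x c then 1 else
      if h : ∃ v, i ≤ v ∧ v ≤ j ∧ e = e1 v then c1 h.choose else
      if h : ∃ v, i ≤ v ∧ v ≤ j ∧ e = e2 v then c2 h.choose else 0, ?_, ?_, ?_, ?_⟩
    · intro c hc hc'
      exact if_pos ⟨c, hc, hc', rfl⟩
    · intro v hv hv'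
      have h1 : ¬ ∃ c, i ≤ c ∧ c < j ∧ e1 v = x c := by
        rintro ⟨c, hc, hc', h⟩; exact d1 v c hv hv' hc hc' h
      have h2 : ∃ u, i ≤ u ∧ u ≤ j ∧ e1 v = e1 u := ⟨v, hv, hv', rfl⟩
      simp only [if_neg h1, dif_pos h2]
      congr 1
      exact (d11 _ _ hv hv' h2.choose_spec.1 h2.choose_spec.2.1 h2.choose_spec.2.2).symm
    · intro v hv hv'
      have h1 : ¬ ∃ c, i ≤ c ∧ c < j ∧ e2 v = x c := by
        rintro ⟨c, hc, hc', h⟩; exact d2 v c hv hv' hc hc' h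
      have h3 : ¬ ∃ u, i ≤ u ∧ u ≤ j ∧ e2 v = e1 u := by
        rintro ⟨c, hc, hc', h⟩; exact d12 c v hc hc' hv hv' h.symm
      have h2 : ∃ u, i ≤ u ∧ u ≤ j ∧ e2 v = e2 u := ⟨v, hv, hv', rfl⟩
      simp only [if_neg h1, dif_neg h3, dif_pos h2]
      congr 1
      exact (d22 _ _ hv hv' h2.choose_spec.1 h2.choose_spec.2.1 h2.choose_spec.2.2).symm
    · intro e h1 h2 h3
      beta_reduce
      rw [if_neg (by rintro ⟨c, hc, hc', h⟩; exact h1 c hc hc' h),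
        dif_neg (by rintro ⟨c, hc, hc', h⟩; exact h2 c hc hc' h),
        dif_neg (by rintro ⟨c, hc, hc', h⟩; exact h3 c hc hc' h)]
  have hcls : ∀ P : E → Prop, (∀ c, i ≤ c → c < j → P (x c)) → (∀ v, i ≤ v → v ≤ j → P (e1 v)) →
      (∀ v, i ≤ v → v ≤ j → P (e2 v)) → (∀ e, w e = 0 → P e) → ∀ e, P e := by
    intro P h1 h2 h3 h4 e
    by_cases hx : ∃ c, i ≤ c ∧ c < j ∧ e = x c
    · obtain ⟨c, hc, hc', rfl⟩ := hx; exact h1 c hc hc'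
    by_cases hx1 : ∃ c, i ≤ c ∧ c ≤ j ∧ e = e1 c
    · obtain ⟨c, hc, hc', rfl⟩ := hx1; exact h2 c hc hc'
    by_cases hx2 : ∃ c, i ≤ c ∧ c ≤ j ∧ e = e2 c
    · obtain ⟨c, hc, hc', rfl⟩ := hx2; exact h3 c hc hc'
    refine h4 e (w0 e ?_ ?_ ?_)
    · intro c hc hc' h; exact hx ⟨c, hc, hc', h⟩
    · intro c hc hc' h; exact hx1 ⟨c, hc, hc', h⟩
    · intro c hc hc' h; exact hx2 ⟨c, hc, hc', h⟩
  -- bd formula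
  have hbd : ∀ f : E → ℤ, (∀ e, w e = 0 → f e = 0) → ∀ v, i ≤ v → v ≤ j →
      bd inc v f = (if i < v then -τ (v-1) * f (x (v-1)) else 0) + (if v < j then τ v * f (x v) else 0)
        + inc v (e1 v) * f (e1 v) + inc v (e2 v) * f (e2 v) := by
    intro f hf v hv hv'
    have hA : (if i < v then -τ (v-1) * f (x (v-1)) else 0) = ∑ e ∈ (if i < v then {x (v-1)} else ∅ : Finset E), inc v e * f e := by
      split_ifs with h
      · have := (hN.hx (v-1) (by omega)).2
        rw [show v - 1 + 1 = v by omega] at this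
        rw [Finset.sum_singleton, this]
      · simp
    have hB : (if v < j then τ v * f (x v) else 0) = ∑ e ∈ (if v < j then {x v} else ∅ : Finset E), inc v e * f e := by
      split_ifs with h
      · rw [Finset.sum_singleton, (hN.hx v (by omega)).1]
      · simp
    rw [hA, hB, ← Finset.sum_union, add_assoc, ← Finset.sum_pair (f := fun e => inc v e * f e) (d12 v v hv hv' hv hv'), ← Finset.sum_union]
    · apply bd_of_supp
      intro e
      refine hcls (fun e => e ∉ _ → inc v e = 0 ∨ f e = 0) ?_ ?_ ?_ ?_ e
      · intro c hc hc' h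
        left
        by_contra h1
        apply h
        have : c = v ∨ c + 1 = v := by
          by_contra h2
          rcases lt_trichotomy v c with h3 | h3 | h3
          · obtain ⟨h4, _⟩ := hN.loc v (c+1) (x c) (by omega) (by omega) h1 (hxc' c hc hc')
            omega
          · omega
          · obtain ⟨h4, _⟩ := hN.loc c v (x c) h3 (by omega) (hxc c hc hc') h1
            omega
        rcases this with rfl | rfl
        · simp [hc']
        · have : i < c + 1 := by omega
          simp [this]
      · intro u hu hu' h
        left
        by_contra h1
        have := key1 v u hv hv' hu hu' h1
        subst this
        simp at h
      · intro u hu hu' h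
        left
        by_contra h1
        have := key2 v u hv hv' hu hu' h1
        subst this
        simp at h
      · intro e he _
        right; exact hf e he
    · rw [Finset.disjoint_left]
      intro e he he'
      rw [Finset.mem_insert, Finset.mem_singleton] at he'
      rw [Finset.mem_union] at he
      have : ∃ c, i ≤ c ∧ c < j ∧ e = x c := by
        rcases he with he | he
        · split_ifs at he with h
          · exact ⟨v-1, by omega, by omega, by simpa using he⟩
          · simp at he
        · split_ifs at he with h
          · exact ⟨v, by omega, by omega, by simpa using he⟩
          · simp at he
      obtain ⟨c, hc, hc', rfl⟩ := this
      rcases he' with he' | he'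
      · exact d1 _ _ hv hv' hc hc' he'.symm
      · exact d2 _ _ hv hv' hc hc' he'.symm
    · split_ifs with h1 h2
      · rw [Finset.disjoint_singleton]
        intro h
        have h3 := (hN.loc (v-1) (v+1) (x (v-1)) (by omega) (by omega) (hxc (v-1) (by omega) (by omega)) (by rw [h]; exact hxc' v hv h2)).1
        omega
      · simp
      · simp
      · simp
  have hw0 : ∀ e, 0 ≤ w e := by
    apply hcls
    · intro c hc hc'; rw [wx c hc hc']; norm_num
    · intro v hv hv'; rw [w1 v hv hv']; exact (hG v hv hv').1.2.2.2.2.2.2.2.1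
    · intro v hv hv'; rw [w2 v hv hv']; exact (hG v hv hv').1.2.2.2.2.2.2.2.2.1
    · intro e he; rw [he]
  have hstar := hS w hw0 (by
    apply hcls
    · intro c hc hc' h; exact absurd (h c (by simp; omega)) (hxc c hc hc')
    · intro c hc hc' h; exact absurd (h c (by simp; omega)) (n1 c hc hc')
    · intro c hc hc' h; exact absurd (h c (by simp; omega)) (n2 c hc hc')
    · intro e he _; exact he) (by
    intro v hv
    rw [Finset.mem_Ico] at hv
    rw [hbd w (fun _ h => h) v hv.1 (by omega), w1 v hv.1 (by omega), w2 v hv.1 (by omega)]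
    rw [← (hG v hv.1 (by omega)).2.1]
    congr 3
    · split_ifs with h
      · rw [wx (v-1) (by omega) (by omega), mul_one]
      · rfl
    · split_ifs with h
      · rw [wx v (by omega) (by omega), mul_one]
      · rfl)
  set V := (Finset.Icc i j).filter (fun v => c1 v = 1) with hV
  have hVm : ∀ v ∈ V, i ≤ v ∧ v ≤ j ∧ c1 v = 1 := by
    intro v hv; simpa [hV, and_assoc] using hv
  have hpar := fun β => parity_ext (inc := inc) (U := Finset.Ico i (j+1)) (w := w) (β := β) e1 e2 V
    (fun v hv => d12 v v (hVm v hv).1 (hVm v hv).2.1 (hVm v hv).1 (hVm v hv).2.1)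
    (fun v hv u hu => by
      obtain ⟨hv, hv', h⟩ := hVm v hv
      rw [Finset.mem_Ico] at hu
      by_cases huv : u = v
      · subst huv
        have := (hG u hv hv').1.2.2.2.2.2.2.2.2.2
        omega
      · have h1 : inc u (e1 v) = 0 := by
          by_contra h1; exact huv (key1 u v hu.1 (by omega) hv hv' h1)
        have h2 : inc u (e2 v) = 0 := by
          by_contra h1; exact huv (key2 u v hu.1 (by omega) hv hv' h1)
        rw [h1, h2])
    (fun v hv => by rw [w1 v (hVm v hv).1 (hVm v hv).2.1]; exact (hVm v hv).2.2)
    (fun v hv u hu huv => by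
      obtain ⟨hv, hv', h⟩ := hVm v hv
      obtain ⟨hu, hu', h⟩ := hVm u hu
      exact ⟨fun h => huv (d11 u v hu hu' hv hv' h), d12 u v hu hu' hv hv', fun h => d12 v u hv hv' hu hu' h.symm,
        fun h => huv (d22 u v hu hu' hv hv' h)⟩)
  -- analysis of extreme points
  have hloc : ∀ β f, f ∈ (FB inc (Finset.Ico i (j+1)) w β).filter (fun f => ∀ v ∈ V,
      (f (e1 v) = 0 ∧ f (e2 v) = 0) ∨ (f (e1 v) = 1 ∧ f (e2 v) = w (e2 v))) → ∀ v, i ≤ v → v ≤ j →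
      (β v = 0 → (i < v → v < j → f (x (v-1)) = f (x v)) ∧ 
        ((i < v → f (x (v-1)) = 0) → (v < j → f (x v) = 0) → f (e1 v) = 0 ∧ f (e2 v) = 0) ∧
            (v = i → f (x v) = 0) ∧ (v = j → f (x (v-1)) = 0)) ∧
      (β v = bd inc v (-1) → (i < v → v < j → f (x (v-1)) = f (x v)) ∧ (v = i → f (x v) = 1) ∧ (v = j → f (x (v-1)) = 1)) := by
    intro β f hf v hv hv'
    rw [Finset.mem_filter, mem_FB] at hf
    obtain ⟨⟨f0, fw, fb⟩, fe⟩ := hf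
    have fz : ∀ e, w e = 0 → f e = 0 := fun e he => le_antisymm (he ▸ fw e) (f0 e)
    obtain ⟨⟨k0, k1, k2, k3, k4, k5, k6, k7, k8, k9⟩, hbal, hloc⟩ := hG v hv hv'
    have hb := fb v (by rw [Finset.mem_Ico]; omega)
    rw [hbd f fz v hv hv'] at hb
    set a : ℤ := if i < v then f (x (v-1)) else 0 with ha
    set b : ℤ := if v < j then f (x v) else 0 with hb'
    have ra : 0 ≤ a ∧ a ≤ 1 := by
      rw [ha]; split_ifs with h
      · exact ⟨f0 _, (fw _).trans (wx (v-1) (by omega) (by omega)).le⟩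
      · norm_num
    have rb : 0 ≤ b ∧ b ≤ 1 := by
      rw [hb']; split_ifs with h
      · exact ⟨f0 _, (fw _).trans (wx v (by omega) (by omega)).le⟩
      · norm_num
    have h3 := hloc a b (f (e1 v)) (f (e2 v)) ra.1 ra.2 rb.1 rb.2 (f0 _) (w1 v hv hv' ▸ fw _) (f0 _) (w2 v hv hv' ▸ fw _)
      (fun hc => by
        have := fe v (by rw [hV, Finset.mem_filter, Finset.mem_Icc]; exact ⟨⟨hv, hv'⟩, hc⟩)
        rwa [w2 v hv hv'] at this)
    have e5 : (if i < v then -τ (v-1) * a else 0) = (if i < v then -τ (v-1) * f (x (v-1)) else 0) := by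
      split_ifs with h
      · rw [ha, if_pos h]
      · rfl
    have e6 : (if v < j then τ v * b else 0) = (if v < j then τ v * f (x v) else 0) := by
      split_ifs with h
      · rw [hb', if_pos h]
      · rfl
    rw [e5, e6, hb] at h3
    obtain ⟨h4, h5⟩ := h3
    have a1 : i < v → a = f (x (v-1)) := fun h => by rw [ha, if_pos h]
    have b1 : v < j → b = f (x v) := fun h => by rw [hb', if_pos h]
    constructor
    · intro h
      obtain ⟨q1, q2, q3, q4⟩ := h4 h
      refine ⟨fun h h' => by rw [← a1 h, ← b1 h']; exact q1 h h', fun h h' => q2 (fun hh => (a1 hh).trans (h hh)) (fun hh => (b1 hh).trans (h' hh)), 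
        fun h => by rw [← b1 (by omega)]; exact q3 h, fun h => by rw [← a1 (by omega)]; exact q4 h⟩
    · intro h
      obtain ⟨q1, q3, q4⟩ := h5 h
      refine ⟨fun h h' => by rw [← a1 h, ← b1 h']; exact q1 h h', 
        fun h => by rw [← b1 (by omega)]; exact q3 h, fun h => by rw [← a1 (by omega)]; exact q4 h⟩
  have hconst : ∀ β f, (∀ v, i < v → v < j → β v = 0) → f ∈ (FB inc (Finset.Ico i (j+1)) w β).filter (fun f => ∀ v ∈ V,
      (f (e1 v) = 0 ∧ f (e2 v) = 0) ∨ (f (e1 v) = 1 ∧ f (e2 v) = w (e2 v))) → ∀ c, i ≤ c → c < j → f (x c) = f (x i) := by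
    intro β f hβ hf c hc
    induction c, hc using Nat.le_induction with
    | base => intro _; rfl
    | succ c hc ih =>
      intro h
      rw [← ih (by omega)]
      exact (((hloc β f hf (c+1) (by omega) (by omega)).1 (hβ _ (by omega) h)).1 (by omega) h).symm
  have hzero : (FB inc (Finset.Ico i (j+1)) w 0).filter (fun f => ∀ v ∈ V,
      (f (e1 v) = 0 ∧ f (e2 v) = 0) ∨ (f (e1 v) = 1 ∧ f (e2 v) = w (e2 v))) = {0} := by
    ext f
    rw [Finset.mem_singleton]
    constructor
    · intro hf
      have hc := hconst 0 f (fun _ _ _ => rfl) hf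
      have hi := ((hloc 0 f hf i le_rfl hij.le).1 rfl).2.2.1 rfl
      have hx0 : ∀ c, i ≤ c → c < j → f (x c) = 0 := fun c h1 h2 => (hc c h1 h2).trans hi
      have hl := fun v hv hv' => ((hloc 0 f hf v hv hv').1 rfl).2.1 (fun h => hx0 _ (by omega) (by omega)) (fun h => hx0 _ (by omega) (by omega))
      rw [Finset.mem_filter, mem_FB] at hf
      funext e
      refine hcls (fun e => f e = (0 : E → ℤ) e) ?_ ?_ ?_ ?_ e
      · exact hx0
      · exact fun v hv hv' => (hl v hv hv').1
      · exact fun v hv hv' => (hl v hv hv').2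
      · intro e he; exact le_antisymm ((hf.1.2.1 e).trans he.le) (hf.1.1 e)
    · rintro rfl
      rw [Finset.mem_filter, mem_FB]
      refine ⟨⟨fun _ => le_rfl, hw0, fun v _ => by simp [bd]⟩, fun v _ => Or.inl ⟨rfl, rfl⟩⟩
  have hnone : (FB inc (Finset.Ico i (j+1)) w α).filter (fun f => ∀ v ∈ V,
      (f (e1 v) = 0 ∧ f (e2 v) = 0) ∨ (f (e1 v) = 1 ∧ f (e2 v) = w (e2 v))) = ∅ := by
    rw [Finset.eq_empty_iff_forall_notMem]
    intro f hf
    have hc := hconst α f hamid hf (j-1) (by omega) (by omega)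
    rcases hα with ⟨h1, h2⟩ | ⟨h1, h2⟩
    · have q1 := ((hloc α f hf i le_rfl hij.le).1 h1).2.2.1 rfl
      have q2 := ((hloc α f hf j hij.le le_rfl).2 h2).2.2 rfl
      omega
    · have q1 := ((hloc α f hf i le_rfl hij.le).2 h1).2.1 rfl
      have q2 := ((hloc α f hf j hij.le le_rfl).1 h2).2.2.2 rfl
      omega
  have p0 := hpar 0
  have pα := hpar α
  rw [hzero] at p0
  rw [hnone, hstar, p0] at pα
  simp at pα

theorem PNet.main (hN : PNet g inc x τ) (hS : StarU inc α (Finset.Ico 0 g)) :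
    (∀ v, v < g → α v = 0) ∨ (∀ v, v < g → α v = bd inc v (-1)) := by
  have hs : ∀ v, v < g → α v = 0 ∨ α v = bd inc v (-1) := by
    intro v hv
    apply hN.single hv
    have := hN.star_interval hS (a := v) (b := v+1) (by omega) (by omega)
    simpa using this
  by_contra hcon
  push Not at hcon
  obtain ⟨⟨p, hp, hp'⟩, ⟨q, hq, hq'⟩⟩ := hcon
  have main : ∀ d i j, j = i + d → i < j → j < g → bd inc i (-1) ≠ 0 → bd inc j (-1) ≠ 0 →
      ((α i = 0 ∧ α j = bd inc j (-1)) ∨ (α i = bd inc i (-1) ∧ α j = 0)) → False := by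
    intro d
    induction d using Nat.strong_induction_on with
    | _ d ih =>
      intro i j hd hij hj hi0 hj0 hα
      by_cases hmid : ∀ v, i < v → v < j → bd inc v (-1) = 0
      · refine hN.no_pair hij hj (hN.star_interval hS (by omega) (by omega)) hi0 hj0 hmid ?_ hα
        intro v h1 h2
        have h3 := hs v (by omega)
        rw [hmid v h1 h2] at h3
        omega
      · push Not at hmid
        obtain ⟨v, h1, h2, h3⟩ := hmid
        rcases hs v (by omega) with h4 | h4
        · rcases hα with ⟨h5, h6⟩ | ⟨h5, h6⟩
          · exact ih (j - v) (by omega) v j (by omega) h2 hj h3 hj0 (Or.inl ⟨h4, h6⟩)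
          · exact ih (v - i) (by omega) i v (by omega) h1 (by omega) hi0 h3 (Or.inr ⟨h5, h4⟩)
        · rcases hα with ⟨h5, h6⟩ | ⟨h5, h6⟩
          · exact ih (v - i) (by omega) i v (by omega) h1 (by omega) hi0 h3 (Or.inl ⟨h5, h4⟩)
          · exact ih (j - v) (by omega) v j (by omega) h2 hj h3 hj0 (Or.inr ⟨h4, h6⟩)
  have hp2 := (hs p hp).resolve_left hp'
  have hq2 := (hs q hq).resolve_right hq'
  have hp3 : bd inc p (-1) ≠ 0 := by rwa [← hp2]
  have hq3 : bd inc q (-1) ≠ 0 := by intro h; apply hq'; rw [hq2, h]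
  rcases lt_trichotomy p q with h | h | h
  · exact main (q - p) p q (by omega) h hq hp3 hq3 (Or.inr ⟨hp2, hq2⟩)
  · subst h; exact hp' hq2
  · exact main (p - q) q p (by omega) h hp hq3 hp3 (Or.inl ⟨hq2, hp2⟩)

end pnet4

set_option linter.unusedSectionVars false

section kapvanish
variable {E Yt : Type} [Fintype E] [Fintype Yt] [DecidableEq Yt]

omit [Fintype E] [Fintype Yt] in
open Classical in
lemma kap_powerset (ε : Yt → E → ℤ) (ys : List Yt) (hys : ys.Nodup) (w : E → ℤ) :
    kap ε ys w = ∑ J ∈ ys.toFinset.powerset, (-1 : ℤ) ^ J.card * (if 0 ≤ w + ∑ y ∈ J, ε y then 1 else 0) := by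
  induction ys generalizing w with
  | nil => simp [kap]
  | cons y ys ih =>
    rw [List.nodup_cons] at hys
    have hy : y ∉ ys.toFinset := by simpa using hys.1
    rw [List.toFinset_cons, Finset.sum_powerset_insert hy]
    simp only [kap]
    rw [ih hys.2, ih hys.2, sub_eq_add_neg, ← Finset.sum_neg_distrib]
    congr 1
    apply Finset.sum_congr rfl
    intro J hJ
    have hyJ : y ∉ J := fun h => hy (Finset.mem_powerset.1 hJ h)
    rw [Finset.card_insert_of_notMem hyJ, Finset.sum_insert hyJ, pow_succ, add_assoc]
    ring

variable [Lattice Yt] {G : Type} [AddCommGroup G] (wt : (E → ℤ) →+ G) (ε : Yt → E → ℤ)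

/-- multichain representation of a vector -/
def MRep (N : Yt → ℕ) (w : E → ℤ) : Prop :=
  (∀ y z, N y ≠ 0 → N z ≠ 0 → y ≤ z ∨ z ≤ y) ∧ ∑ y, N y • ε y = w

/-- straightening axioms -/
structure Straight : Prop where
  pos : ∀ y, 0 ≤ ε y
  ne : ∀ y, ε y ≠ 0
  wt0 : ∀ y, wt (ε y) = 0
  top : ∀ w, 0 ≤ w → wt w = 0 → w ≠ 0 → ∃ y0, ε y0 ≤ w ∧ ∀ y, ε y ≤ w → y ≤ y0
  up : ∀ (N : Yt → ℕ) y t, (∀ z, N z ≠ 0 → z ≤ t) → ε y ≤ ∑ z, N z • ε z → y ≤ t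

variable {wt ε}

omit [DecidableEq Yt] in
lemma Straight.le_of (h : Straight wt ε) (N : Yt → ℕ) (y : Yt) (hy : N y ≠ 0) : ε y ≤ ∑ z, N z • ε z := by
  refine le_trans ?_ (Finset.single_le_sum (f := fun z => N z • ε z) (fun z _ => nsmul_nonneg (h.pos z) _) (Finset.mem_univ y))
  obtain ⟨t, ht⟩ := Nat.exists_eq_succ_of_ne_zero hy
  simp only [ht, Nat.succ_eq_add_one, succ_nsmul]
  exact le_add_of_nonneg_left (nsmul_nonneg (h.pos y) _)

lemma sum_upd_add (N : Yt → ℕ) (y : Yt) : ∑ z, (N + (Pi.single y 1 : Yt → ℕ)) z • ε z = ∑ z, N z • ε z + ε y := by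
  have : ∀ z, (N + (Pi.single y 1 : Yt → ℕ)) z • ε z = N z • ε z + (if z = y then ε z else 0) := by
    intro z
    by_cases h : z = y
    · subst h; simp [add_mul]
    · simp [h]
  simp only [this, Finset.sum_add_distrib, Finset.sum_ite_eq', Finset.mem_univ, if_true]

lemma upd_sub (N : Yt → ℕ) (y : Yt) (hy : N y ≠ 0) : ∃ N' : Yt → ℕ, N = N' + Pi.single y 1 ∧ ∀ z, N' z ≠ 0 → N z ≠ 0 := by
  refine ⟨N - (Pi.single y 1 : Yt → ℕ), ?_, ?_⟩
  · funext z
    by_cases h : z = y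
    · subst h; simp; omega
    · simp [h]
  · intro z hz
    simp only [Pi.sub_apply] at hz
    omega

lemma Straight.exists_rep (h : Straight wt ε) (d : ℕ) (w : E → ℤ) (hd : (∑ e, w e).toNat = d) (hw : 0 ≤ w) (hw0 : wt w = 0) :
    ∃ N, MRep ε N w := by
  induction d using Nat.strong_induction_on generalizing w with
  | _ d ih =>
    by_cases hne : w = 0
    · exact ⟨0, by simp [MRep, hne]⟩
    · obtain ⟨y0, hy0, htop⟩ := h.top w hw hw0 hne
      have hpos : 0 < ∑ e, ε y0 e := by
        apply Finset.sum_pos'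
        · intro e _; exact h.pos y0 e
        · by_contra hc
          push Not at hc
          apply h.ne y0
          funext e
          exact le_antisymm (hc e (Finset.mem_univ e)) (h.pos y0 e)
      have hle : ∑ e, ε y0 e ≤ ∑ e, w e := Finset.sum_le_sum (fun e _ => hy0 e)
      obtain ⟨N, hN1, hN2⟩ := ih (∑ e, (w - ε y0) e).toNat (by
        simp only [Pi.sub_apply, Finset.sum_sub_distrib]; omega) (w - ε y0) rfl (sub_nonneg.2 hy0) (by rw [map_sub, hw0, h.wt0, sub_zero])
      have hz : ∀ z, N z ≠ 0 → z ≤ y0 := by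
        intro z hz
        apply htop
        have := h.le_of N z hz
        rw [hN2] at this
        exact this.trans (sub_le_self _ (h.pos y0))
      refine ⟨N + (Pi.single y0 1 : Yt → ℕ), ?_, ?_⟩
      · have hs : ∀ z, (N + (Pi.single y0 1 : Yt → ℕ)) z ≠ 0 → N z ≠ 0 ∨ z = y0 := by
          intro z hz
          by_cases hzy : z = y0
          · exact Or.inr hzy
          · left; simpa [hzy] using hz
        intro y z hy hz'
        rcases hs y hy with h1 | h1
        · rcases hs z hz' with h2 | h2
          · exact hN1 y z h1 h2
          · subst h2; exact Or.inl (hz y h1)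
        · subst h1
          rcases hs z hz' with h2 | h2
          · exact Or.inr (hz z h2)
          · subst h2; exact Or.inl le_rfl
      · rw [sum_upd_add, hN2]; simp

lemma Straight.rep_top (h : Straight wt ε) {N : Yt → ℕ} {w : E → ℤ} (hN : MRep ε N w) (hne : w ≠ 0) (y0 : Yt)
    (hy0 : ε y0 ≤ w) (htop : ∀ y, ε y ≤ w → y ≤ y0) : N y0 ≠ 0 := by
  classical
  obtain ⟨hN1, hN2⟩ := hN
  have hS : (Finset.univ.filter (fun y => N y ≠ 0)).Nonempty := by
    by_contra hc
    rw [Finset.not_nonempty_iff_eq_empty, Finset.filter_eq_empty_iff] at hc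
    apply hne
    rw [← hN2]
    apply Finset.sum_eq_zero
    intro y _
    have := hc (Finset.mem_univ y)
    push Not at this
    simp [this]
  obtain ⟨t, ht⟩ := Finset.exists_maximal hS
  have htN : N t ≠ 0 := by simpa using ht.1
  have hmax : ∀ z, N z ≠ 0 → z ≤ t := by
    intro z hz
    rcases hN1 z t hz htN with h1 | h1
    · exact h1
    · exact ht.2 (by simpa using hz) h1
  have h1 : y0 ≤ t := h.up N y0 t hmax (by rw [hN2]; exact hy0)
  have h2 : t ≤ y0 := htop t (by rw [← hN2]; exact h.le_of N t htN)
  rw [le_antisymm h1 h2]; exact htN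

lemma Straight.rep_unique (h : Straight wt ε) (d : ℕ) (w : E → ℤ) (hd : (∑ e, w e).toNat = d) (N N' : Yt → ℕ)
    (hN : MRep ε N w) (hN' : MRep ε N' w) : N = N' := by
  induction d using Nat.strong_induction_on generalizing w N N' with
  | _ d ih =>
    by_cases hne : w = 0
    · have : ∀ N : Yt → ℕ, MRep ε N w → N = 0 := by
        intro N hN
        funext y
        by_contra hy
        have h1 := h.le_of N y hy
        rw [hN.2, hne] at h1
        exact h.ne y (le_antisymm h1 (h.pos y))
      rw [this N hN, this N' hN']
    · have hw : 0 ≤ w := by rw [← hN.2]; exact Finset.sum_nonneg (fun z _ => nsmul_nonneg (h.pos z) _)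
      have hw0 : wt w = 0 := by
        rw [← hN.2, map_sum]
        apply Finset.sum_eq_zero; intro z _; rw [map_nsmul, h.wt0, smul_zero]
      obtain ⟨y0, hy0, htop⟩ := h.top w hw hw0 hne
      have hpos : 0 < ∑ e, ε y0 e := by
        apply Finset.sum_pos'
        · intro e _; exact h.pos y0 e
        · by_contra hc
          push Not at hc
          apply h.ne y0
          funext e
          exact le_antisymm (hc e (Finset.mem_univ e)) (h.pos y0 e)
      have hle : ∑ e, ε y0 e ≤ ∑ e, w e := Finset.sum_le_sum (fun e _ => hy0 e)
      obtain ⟨M, hM, hMs⟩ := upd_sub N y0 (h.rep_top hN hne y0 hy0 htop)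
      obtain ⟨M', hM', hMs'⟩ := upd_sub N' y0 (h.rep_top hN' hne y0 hy0 htop)
      have key : ∀ N M : Yt → ℕ, N = M + Pi.single y0 1 → (∀ z, M z ≠ 0 → N z ≠ 0) → MRep ε N w → MRep ε M (w - ε y0) := by
        intro N M hM hs hN
        refine ⟨fun y z hy hz => hN.1 y z (hs y hy) (hs z hz), ?_⟩
        rw [eq_sub_iff_add_eq, ← sum_upd_add, ← hM]; exact hN.2
      rw [hM, hM', ih (∑ e, (w - ε y0) e).toNat (by
        simp only [Pi.sub_apply, Finset.sum_sub_distrib]; omega) (w - ε y0) rfl M M' (key N M hM hMs hN) (key N' M' hM' hMs' hN')]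

open Classical in
/-- the element to be toggled -/
noncomputable def togEl (b : Yt) (M N : Yt → ℕ) : Yt :=
  if h : ∃ y, 2 ≤ M y then h.choose else
    (insert b (Finset.univ.filter (fun y => N y ≠ 0 ∧ ¬ b ≤ y))).sup' (Finset.insert_nonempty _ _) id

lemma togEl_ge (b : Yt) (M N : Yt → ℕ) (h : ¬ ∃ y, 2 ≤ M y) : b ≤ togEl b M N := by
  classical
  rw [togEl, dif_neg h]
  exact Finset.le_sup' (f := id) (Finset.mem_insert_self b _)

lemma togEl_congr (b : Yt) (M N N' : Yt → ℕ) (h : ∀ y, y ≠ togEl b M N → N y = N' y) : togEl b M N' = togEl b M N := by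
  classical
  by_cases hM : ∃ y, 2 ≤ M y
  · rw [togEl, dif_pos hM, togEl, dif_pos hM]
  · have hb := togEl_ge b M N hM
    have e : (Finset.univ.filter (fun y => N y ≠ 0 ∧ ¬ b ≤ y)) = (Finset.univ.filter (fun y => N' y ≠ 0 ∧ ¬ b ≤ y)) := by
      apply Finset.filter_congr
      intro y _
      by_cases hy : y = togEl b M N
      · have : b ≤ y := by rw [hy]; exact hb
        simp [this]
      · rw [h y hy]
    rw [togEl, dif_neg hM, togEl, dif_neg hM]
    simp only [e]

lemma togEl_le (b T : Yt) (M N : Yt → ℕ) (h : ¬ ∃ y, 2 ≤ M y) (hbT : b ≤ T) (hT : ∀ y, b ≤ y ∨ y ≤ T) :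
    togEl b M N ≤ T := by
  classical
  rw [togEl, dif_neg h]
  apply Finset.sup'_le
  intro y hy
  rw [Finset.mem_insert, Finset.mem_filter] at hy
  rcases hy with rfl | ⟨_, _, hy⟩
  · exact hbT
  · exact (hT y).resolve_left hy

lemma togEl_comp (b : Yt) (M N : Yt → ℕ) (h : ¬ ∃ y, 2 ≤ M y) (hN : ∀ y z, N y ≠ 0 → N z ≠ 0 → y ≤ z ∨ z ≤ y)
    (z : Yt) (hz : N z ≠ 0) : z ≤ togEl b M N ∨ togEl b M N ≤ z := by
  classical
  rw [togEl, dif_neg h]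
  by_cases hb : b ≤ z
  · right
    apply Finset.sup'_le
    intro y hy
    rw [Finset.mem_insert, Finset.mem_filter] at hy
    rcases hy with rfl | ⟨_, hy1, hy⟩
    · exact hb
    · rcases hN y z hy1 hz with h1 | h1
      · exact h1
      · exact absurd (hb.trans h1) hy
  · left
    exact Finset.le_sup' (f := id) (Finset.mem_insert_of_mem (by simp [hz, hb]))

theorem Straight.kk_zero (h : Straight wt ε) (hε1 : ∀ y, ε y ≤ 1) (u : E → ℤ) (hu : wt u = 0) (e : E) (he : 0 ≤ u e)
    (b T : Yt) (hbT : b ≤ T) (hintv : ∀ y, ε y e ≠ 0 ↔ b ≤ y ∧ y ≤ T) (hT : ∀ y, b ≤ y ∨ y ≤ T) : kk ε u = 0 := by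
  classical
  unfold kk
  rw [kap_powerset ε _ (Finset.nodup_toList _)]
  have hwt : ∀ J : Finset Yt, wt (u + ∑ y ∈ J, ε y) = 0 := by
    intro J; rw [map_add, hu, map_sum, Finset.sum_eq_zero (fun y _ => h.wt0 y), add_zero]
  have hex : ∀ J : Finset Yt, ∃ N, 0 ≤ u + ∑ y ∈ J, ε y → MRep ε N (u + ∑ y ∈ J, ε y) := by
    intro J
    by_cases hJ : 0 ≤ u + ∑ y ∈ J, ε y
    · obtain ⟨N, hN⟩ := h.exists_rep _ _ rfl hJ (hwt J)
      exact ⟨N, fun _ => hN⟩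
    · exact ⟨0, fun h => absurd h hJ⟩
  choose N hN using hex
  have huniq : ∀ J N', MRep ε N' (u + ∑ y ∈ J, ε y) → 0 ≤ u + ∑ y ∈ J, ε y ∧ N J = N' := by
    intro J N' hN'
    have h0 : 0 ≤ u + ∑ y ∈ J, ε y := by rw [← hN'.2]; exact Finset.sum_nonneg (fun z _ => nsmul_nonneg (h.pos z) _)
    exact ⟨h0, h.rep_unique _ _ rfl _ _ (hN J h0) hN'⟩
  set M : Finset Yt → Yt → ℕ := fun J y => N J y + if y ∈ J then 0 else 1 with hM
  set t : Finset Yt → Yt := fun J => togEl b (M J) (N J) with ht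
  -- key facts about t
  have key : ∀ J, 0 ≤ u + ∑ y ∈ J, ε y →
      (∀ z, N J z ≠ 0 → z ≤ t J ∨ t J ≤ z) ∧ (t J ∈ J → N J (t J) ≠ 0) := by
    intro J hJ
    obtain ⟨hc, hs⟩ := hN J hJ
    by_cases h2 : ∃ y, 2 ≤ M J y
    · have ht2 : t J = h2.choose := by simp only [ht, togEl, dif_pos h2]
      have h3 := h2.choose_spec
      rw [← ht2] at h3
      have h4 : N J (t J) ≠ 0 := by
        simp only [hM] at h3
        split_ifs at h3 <;> omega
      exact ⟨fun z hz => hc z _ hz h4, fun _ => h4⟩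
    · refine ⟨fun z hz => togEl_comp b _ _ h2 hc z hz, fun htJ => ?_⟩
      intro hN0
      -- count at e
      have hte : ε (t J) e ≠ 0 := (hintv _).2 ⟨togEl_ge b _ _ h2, togEl_le b T _ _ h2 hbT hT⟩
      push Not at h2
      have hs' := congrFun hs e
      simp only [Finset.sum_apply, Pi.add_apply, Pi.smul_apply] at hs'
      have h5 : ∑ y ∈ J, ε y e = ∑ y, (if y ∈ J then 1 else 0) * ε y e := by
        simp [ite_mul, Finset.sum_ite_mem]
      have h6 : ∑ y, ((if y ∈ J then 1 else 0) * ε y e - N J y • ε y e) ≤ 0 := by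
        rw [Finset.sum_sub_distrib, hs', ← h5]; omega
      have h7 : 0 < ∑ y, ((if y ∈ J then 1 else 0) * ε y e - N J y • ε y e) := by
        apply Finset.sum_pos'
        · intro y _
          have hy := h2 y
          simp only [hM] at hy
          have h8 : 0 ≤ ε y e := h.pos y e
          split_ifs at hy ⊢ with hyJ
          · have : N J y = 0 ∨ N J y = 1 := by omega
            rcases this with h9 | h9 <;> simp [h9, h8]
          · have : N J y = 0 := by omega
            simp [this]
        · refine ⟨t J, Finset.mem_univ _, ?_⟩
          rw [if_pos htJ, hN0]
          have h8 : 0 ≤ ε (t J) e := h.pos _ e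
          simp; omega
      omega
  -- effect of toggling
  have hdel : ∀ J, 0 ≤ u + ∑ y ∈ J, ε y → t J ∈ J → 0 ≤ u + ∑ y ∈ J.erase (t J), ε y ∧ t (J.erase (t J)) = t J := by
    intro J hJ htJ
    obtain ⟨k1, k2⟩ := key J hJ
    obtain ⟨N', hN', hs'⟩ := upd_sub (N J) (t J) (k2 htJ)
    obtain ⟨hc, hs⟩ := hN J hJ
    have hrep : MRep ε N' (u + ∑ y ∈ J.erase (t J), ε y) := by
      refine ⟨fun y z hy hz => hc y z (hs' y hy) (hs' z hz), ?_⟩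
      rw [hN', sum_upd_add, ← Finset.sum_erase_add _ _ htJ, ← add_assoc] at hs
      exact add_right_cancel hs
    obtain ⟨h0, hu'⟩ := huniq _ _ hrep
    refine ⟨h0, ?_⟩
    have hMM : M (J.erase (t J)) = M J := by
      funext y
      simp only [hM, hu', hN']
      by_cases hy : y = t J
      · rw [hy]; simp [htJ]
      · simp [hy]
    show togEl b (M (J.erase (t J))) (N (J.erase (t J))) = togEl b (M J) (N J)
    rw [hMM]
    apply togEl_congr
    intro y hy
    have hy : y ≠ t J := hy
    rw [hu', hN']
    simp [hy]
  have hins : ∀ J, 0 ≤ u + ∑ y ∈ J, ε y → t J ∉ J → 0 ≤ u + ∑ y ∈ insert (t J) J, ε y ∧ t (insert (t J) J) = t J := by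
    intro J hJ htJ
    obtain ⟨k1, k2⟩ := key J hJ
    obtain ⟨hc, hs⟩ := hN J hJ
    have hrep : MRep ε (N J + Pi.single (t J) 1) (u + ∑ y ∈ insert (t J) J, ε y) := by
      refine ⟨fun y z hy hz => ?_, ?_⟩
      · by_cases h1 : y = t J
        · by_cases h2 : z = t J
          · rw [h1, h2]; exact Or.inl le_rfl
          · rw [h1]; exact (k1 z (by simpa [h2] using hz)).symm
        · by_cases h2 : z = t J
          · rw [h2]; exact (k1 y (by simpa [h1] using hy))
          · exact hc y z (by simpa [h1] using hy) (by simpa [h2] using hz)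
      · rw [sum_upd_add, Finset.sum_insert htJ, hs, add_assoc, add_comm (ε (t J))]
    obtain ⟨h0, hu'⟩ := huniq _ _ hrep
    refine ⟨h0, ?_⟩
    have hMM : M (insert (t J) J) = M J := by
      funext y
      simp only [hM, hu']
      by_cases hy : y = t J
      · rw [hy]; simp [htJ]
      · simp [hy]
    show togEl b (M (insert (t J) J)) (N (insert (t J) J)) = togEl b (M J) (N J)
    rw [hMM]
    apply togEl_congr
    intro y hy
    have hy : y ≠ t J := hy
    rw [hu']
    simp [hy]
  refine Finset.sum_involution (fun J _ => if 0 ≤ u + ∑ y ∈ J, ε y then (if t J ∈ J then J.erase (t J) else insert (t J) J) else J)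
    ?_ ?_ ?_ ?_
  · intro J _
    by_cases h0 : 0 ≤ u + ∑ y ∈ J, ε y
    · simp only [if_pos h0]
      by_cases h1 : t J ∈ J
      · simp only [if_pos h1, if_pos (hdel J h0 h1).1]
        rw [← Finset.card_erase_add_one h1, pow_succ]; ring
      · simp only [if_neg h1, if_pos (hins J h0 h1).1]
        rw [Finset.card_insert_of_notMem h1, pow_succ]; ring
    · simp only [if_neg h0]; simp
  · intro J _ hne
    have h0 : 0 ≤ u + ∑ y ∈ J, ε y := by
      by_contra h0; simp [h0] at hne
    simp only [if_pos h0]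
    by_cases h1 : t J ∈ J
    · simp only [if_pos h1]
      exact fun h2 => Finset.erase_eq_self.1 h2 h1
    · simp only [if_neg h1]
      exact fun h2 => h1 (Finset.insert_eq_self.1 h2)
  · intro J _
    simp
  · intro J _
    by_cases h0 : 0 ≤ u + ∑ y ∈ J, ε y
    · simp only [if_pos h0]
      by_cases h1 : t J ∈ J
      · obtain ⟨h2, h3⟩ := hdel J h0 h1
        simp only [if_pos h1, if_pos h2, h3]
        simp [Finset.insert_erase h1]
      · obtain ⟨h2, h3⟩ := hins J h0 h1
        simp only [if_neg h1, if_pos h2, h3]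
        simp [Finset.erase_insert h1]
    · simp only [if_neg h0]

end kapvanish

section cuts

/-- description of a thin ladder by cuts -/
structure Cuts (m n g : ℕ) (ρ σ : ℕ → ℕ) (up : ℕ → Bool) (Y : Set (ℕ × ℕ)) : Prop where
  gpos : 0 < g
  mpos : 0 < m
  npos : 0 < n
  r0 : ρ 0 = m
  s0 : σ 0 = 0
  rg : ρ g = 0
  sg : σ g = n
  anti : ∀ v, v < g → ρ (v+1) ≤ ρ v
  mono : ∀ v, v < g → σ v ≤ σ (v+1)
  degr : ∀ v, v < g → 2 + ρ (v+1) ≤ ρ v + (if v + 1 < g ∧ up (v+1) = true then 1 else 0) + (if 0 < v ∧ up v = false then 1 else 0)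
  degc : ∀ v, v < g → 2 + σ v ≤ σ (v+1) + (if v + 1 < g ∧ up (v+1) = false then 1 else 0) + (if 0 < v ∧ up v = true then 1 else 0)
  mem : ∀ i j, (i, j) ∈ Y ↔ (1 ≤ i ∧ i ≤ m ∧ 1 ≤ j ∧ j ≤ n) ∧ ∀ l, 0 < l → l < g →
    (up l = true → ¬ (ρ l < i ∧ σ l < j)) ∧ (up l = false → ¬ (i ≤ ρ l ∧ j ≤ σ l))
  corner : ∀ l, 0 < l → l < g → (up l = true → (ρ l, σ l) ∈ Y) ∧ (up l = false → (ρ l + 1, σ l + 1) ∈ Y)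
  rowne : ∀ i, 1 ≤ i → i ≤ m → ∃ j, (i, j) ∈ Y
  colne : ∀ j, 1 ≤ j → j ≤ n → ∃ i, (i, j) ∈ Y

/-- arcs: rows, columns and corners -/
abbrev EE (m n g : ℕ) : Type := Fin m ⊕ Fin n ⊕ Fin (g - 1)

variable {m n g : ℕ} {ρ σ : ℕ → ℕ} {up : ℕ → Bool} {Y : Set (ℕ × ℕ)}

/-- orientation of a cross arc -/
def ctau (up : ℕ → Bool) (c : ℕ) : ℤ := if up (c+1) = true then 1 else -1

/-- incidence function of the network -/
def cinc (m n g : ℕ) (ρ σ : ℕ → ℕ) (up : ℕ → Bool) (v : ℕ) : EE m n g → ℤ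
  | Sum.inl a => if ρ (v+1) ≤ a.1 ∧ a.1 < ρ v then 1 else 0
  | Sum.inr (Sum.inl b) => if σ v ≤ b.1 ∧ b.1 < σ (v+1) then -1 else 0
  | Sum.inr (Sum.inr c) => if v = c.1 then ctau up c.1 else if v = c.1 + 1 then - ctau up c.1 else 0

/-- cross arcs -/
def cx (m n g : ℕ) (hm : 0 < m) (c : ℕ) : EE m n g :=
  if h : c < g - 1 then Sum.inr (Sum.inr ⟨c, h⟩) else Sum.inl ⟨0, hm⟩

lemma ctau_cases (up : ℕ → Bool) (c : ℕ) : ctau up c = 1 ∨ ctau up c = -1 := by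
  unfold ctau; split_ifs <;> simp

lemma Cuts.anti' (h : Cuts m n g ρ σ up Y) {u v : ℕ} (huv : u ≤ v) (hv : v ≤ g) : ρ v ≤ ρ u := by
  induction v, huv using Nat.le_induction with
  | base => rfl
  | succ v huv ih => exact (h.anti v (by omega)).trans (ih (by omega))

lemma Cuts.mono' (h : Cuts m n g ρ σ up Y) {u v : ℕ} (huv : u ≤ v) (hv : v ≤ g) : σ u ≤ σ v := by
  induction v, huv using Nat.le_induction with
  | base => rfl
  | succ v huv ih => exact (ih (by omega)).trans (h.mono v (by omega))

lemma Cuts.rle (h : Cuts m n g ρ σ up Y) {v : ℕ} (hv : v ≤ g) : ρ v ≤ m := h.r0 ▸ h.anti' (Nat.zero_le v) hv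
lemma Cuts.sle (h : Cuts m n g ρ σ up Y) {v : ℕ} (hv : v ≤ g) : σ v ≤ n := h.sg ▸ h.mono' hv le_rfl

theorem Cuts.pnet (h : Cuts m n g ρ σ up Y) :
    PNet g (cinc m n g ρ σ up) (cx m n g h.mpos) (ctau up) where
  tau := ctau_cases up
  hx := by
    intro c hc
    have h1 : c < g - 1 := by omega
    simp [cx, h1, cinc]
  loc := by
    intro v u e hvu hu hv hu'
    rcases e with a | b | c
    · simp only [cinc] at hv hu'
      have h1 : ρ (v+1) ≤ a.1 ∧ a.1 < ρ v := by by_contra h; simp [h] at hv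
      have h2 : ρ (u+1) ≤ a.1 ∧ a.1 < ρ u := by by_contra h; simp [h] at hu'
      have := h.anti' (u := v+1) (v := u) (by omega) (by omega)
      omega
    · simp only [cinc] at hv hu'
      have h1 : σ v ≤ b.1 ∧ b.1 < σ (v+1) := by by_contra h; simp [h] at hv
      have h2 : σ u ≤ b.1 ∧ b.1 < σ (u+1) := by by_contra h; simp [h] at hu'
      have := h.mono' (u := v+1) (v := u) (by omega) (by omega)
      omega
    · simp only [cinc] at hv hu'
      have h1 : v = c.1 ∨ v = c.1 + 1 := by by_contra h; push Not at h; simp [h] at hv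
      have h2 : u = c.1 ∨ u = c.1 + 1 := by by_contra h; push Not at h; simp [h] at hu'
      have h3 : v = c.1 := by omega
      refine ⟨by omega, ?_⟩
      subst h3
      simp [cx]
  sgn := by
    intro v e
    rcases e with a | b | c
    · simp only [cinc]; split_ifs <;> simp
    · simp only [cinc]; split_ifs <;> simp
    · simp only [cinc]
      have := ctau_cases up c.1
      split_ifs <;> omega
  deg := by
    intro v hv η hη
    have crossL : ∀ hh : v + 1 < g, cinc m n g ρ σ up v (Sum.inr (Sum.inr ⟨v, by omega⟩)) = ctau up v := by
      intro hh; simp [cinc]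
    have crossR : ∀ hh : 0 < v, cinc m n g ρ σ up v (Sum.inr (Sum.inr ⟨v - 1, by omega⟩)) = - ctau up (v-1) := by
      intro hh
      have h1 : v ≠ v - 1 := by omega
      have h2 : v = v - 1 + 1 := by omega
      simp only [cinc]; rw [if_neg h1, if_pos h2]
    have rm := h.rle (v := v) (by omega)
    have sn := h.sle (v := v+1) (by omega)
    rcases hη with rfl | rfl
    · have hd := h.degr v hv
      have row : ∀ a (ha : ρ (v+1) ≤ a) (ha' : a < ρ v), cinc m n g ρ σ up v (Sum.inl ⟨a, by omega⟩) = 1 := by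
        intro a ha ha'; simp only [cinc]; rw [if_pos ⟨ha, ha'⟩]
      have t1 : ∀ hh : v + 1 < g ∧ up (v+1) = true, cinc m n g ρ σ up v (Sum.inr (Sum.inr ⟨v, by omega⟩)) = 1 := by
        intro hh; rw [crossL hh.1, ctau, if_pos hh.2]
      have t2 : ∀ hh : 0 < v ∧ up v = false, cinc m n g ρ σ up v (Sum.inr (Sum.inr ⟨v - 1, by omega⟩)) = 1 := by
        intro hh; rw [crossR hh.1, ctau, show v - 1 + 1 = v by omega]; simp [hh.2]
      by_cases c1 : v + 1 < g ∧ up (v+1) = true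
      · by_cases c2 : 0 < v ∧ up v = false
        · exact ⟨_, _, by simp; omega, t1 c1, t2 c2⟩
        · rw [if_pos c1, if_neg c2] at hd
          exact ⟨_, _, by simp, row (ρ (v+1)) le_rfl (by omega), t1 c1⟩
      · by_cases c2 : 0 < v ∧ up v = false
        · rw [if_neg c1, if_pos c2] at hd
          exact ⟨_, _, by simp, row (ρ (v+1)) le_rfl (by omega), t2 c2⟩
        · rw [if_neg c1, if_neg c2] at hd
          exact ⟨_, _, by simp, row (ρ (v+1)) le_rfl (by omega), row (ρ (v+1) + 1) (by omega) (by omega)⟩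
    · have hd := h.degc v hv
      have row : ∀ a (ha : σ v ≤ a) (ha' : a < σ (v+1)), cinc m n g ρ σ up v (Sum.inr (Sum.inl ⟨a, by omega⟩)) = -1 := by
        intro a ha ha'; simp only [cinc]; rw [if_pos ⟨ha, ha'⟩]
      have t1 : ∀ hh : v + 1 < g ∧ up (v+1) = false, cinc m n g ρ σ up v (Sum.inr (Sum.inr ⟨v, by omega⟩)) = -1 := by
        intro hh; rw [crossL hh.1, ctau]; simp [hh.2]
      have t2 : ∀ hh : 0 < v ∧ up v = true, cinc m n g ρ σ up v (Sum.inr (Sum.inr ⟨v - 1, by omega⟩)) = -1 := by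
        intro hh; rw [crossR hh.1, ctau, show v - 1 + 1 = v by omega]; simp [hh.2]
      by_cases c1 : v + 1 < g ∧ up (v+1) = false
      · by_cases c2 : 0 < v ∧ up v = true
        · exact ⟨_, _, by simp; omega, t1 c1, t2 c2⟩
        · rw [if_pos c1, if_neg c2] at hd
          exact ⟨_, _, by simp, row (σ v) le_rfl (by omega), t1 c1⟩
      · by_cases c2 : 0 < v ∧ up v = true
        · rw [if_neg c1, if_pos c2] at hd
          exact ⟨_, _, by simp, row (σ v) le_rfl (by omega), t2 c2⟩
        · rw [if_neg c1, if_neg c2] at hd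
          exact ⟨_, _, by simp, row (σ v) le_rfl (by omega), row (σ v + 1) (by omega) (by omega)⟩

/-- value on a cross arc -/
def xval (f : EE m n g → ℤ) (l : ℕ) : ℤ :=
  if h : 0 < l ∧ l < g then f (Sum.inr (Sum.inr ⟨l - 1, by omega⟩)) else 0

/-- cut function -/
def cut (ρ σ : ℕ → ℕ) (up : ℕ → Bool) (f : EE m n g → ℤ) (l : ℕ) : ℤ :=
  (∑ a : Fin m, if a.1 < ρ l then f (Sum.inl a) else 0) - (∑ b : Fin n, if σ l ≤ b.1 then f (Sum.inr (Sum.inl b)) else 0)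
    - (if up l = true then 1 else -1) * xval f l

lemma Cuts.bd_cut (h : Cuts m n g ρ σ up Y) (f : EE m n g → ℤ) (v : ℕ) (hv : v < g) :
    bd (cinc m n g ρ σ up) v f = cut ρ σ up f v - cut ρ σ up f (v+1) := by
  unfold bd cut
  rw [Fintype.sum_sum_type, Fintype.sum_sum_type]
  have h1 : ∑ a : Fin m, cinc m n g ρ σ up v (Sum.inl a) * f (Sum.inl a) =
      (∑ a : Fin m, if a.1 < ρ v then f (Sum.inl a) else 0) - (∑ a : Fin m, if a.1 < ρ (v+1) then f (Sum.inl a) else 0) := by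
    rw [← Finset.sum_sub_distrib]
    apply Finset.sum_congr rfl
    intro a _
    have := h.anti v hv
    simp only [cinc]
    split_ifs <;> first | omega | simp
  have h2 : ∑ b : Fin n, cinc m n g ρ σ up v (Sum.inr (Sum.inl b)) * f (Sum.inr (Sum.inl b)) =
      (∑ b : Fin n, if σ (v+1) ≤ b.1 then f (Sum.inr (Sum.inl b)) else 0) - (∑ b : Fin n, if σ v ≤ b.1 then f (Sum.inr (Sum.inl b)) else 0) := by
    rw [← Finset.sum_sub_distrib]
    apply Finset.sum_congr rfl
    intro a _
    have := h.mono v hv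
    simp only [cinc]
    split_ifs <;> first | omega | simp
  have h3 : ∑ c : Fin (g-1), cinc m n g ρ σ up v (Sum.inr (Sum.inr c)) * f (Sum.inr (Sum.inr c)) =
      (if up (v+1) = true then 1 else -1) * xval f (v+1) - (if up v = true then 1 else -1) * xval f v := by
    have h4 : ∀ c : Fin (g-1), cinc m n g ρ σ up v (Sum.inr (Sum.inr c)) * f (Sum.inr (Sum.inr c)) =
      (if v = c.1 then ctau up c.1 * f (Sum.inr (Sum.inr c)) else 0) - (if v = c.1 + 1 then ctau up c.1 * f (Sum.inr (Sum.inr c)) else 0) := by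
      intro c
      simp only [cinc]
      split_ifs <;> first | omega | simp
    simp only [h4, Finset.sum_sub_distrib]
    congr 1
    · by_cases hv1 : v + 1 < g
      · rw [Finset.sum_eq_single (⟨v, by omega⟩ : Fin (g-1))]
        · simp [xval, hv1, ctau]
        · intro b _ hb
          rw [if_neg]
          intro h5; exact hb (Fin.ext h5.symm)
        · simp
      · rw [Finset.sum_eq_zero]
        · simp [xval, hv1]
        · intro c _
          have := c.2
          rw [if_neg (by omega)]
    · by_cases hv1 : 0 < v
      · rw [Finset.sum_eq_single (⟨v-1, by omega⟩ : Fin (g-1))]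
        · have : v = v - 1 + 1 := by omega
          simp only [if_pos this]
          simp [xval, hv1, hv, ctau, ← this]
        · intro b _ hb
          rw [if_neg]
          intro h5; exact hb (Fin.ext (by simp only; omega))
        · simp
      · rw [Finset.sum_eq_zero]
        · simp [xval, hv1]
        · intro c _
          rw [if_neg (by omega)]
  rw [h1, h2, h3]; ring

lemma Cuts.cut_g (h : Cuts m n g ρ σ up Y) (f : EE m n g → ℤ) : cut ρ σ up f g = 0 := by
  unfold cut
  rw [h.rg, h.sg]
  have h1 : ∀ b : Fin n, ¬ n ≤ b.1 := fun b => by have := b.2; omega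
  simp [xval, h1]

lemma Cuts.bd_zero (h : Cuts m n g ρ σ up Y) (f : EE m n g → ℤ) :
    (∀ v, v < g → bd (cinc m n g ρ σ up) v f = 0) ↔ ∀ l, l < g → cut ρ σ up f l = 0 := by
  constructor
  · intro hb
    have : ∀ t, t ≤ g → cut ρ σ up f (g - t) = 0 := by
      intro t
      induction t with
      | zero => intro _; exact h.cut_g f
      | succ t ih =>
        intro ht
        have h1 := h.bd_cut f (g - (t+1)) (by omega)
        rw [show g - (t+1) + 1 = g - t by omega, ih (by omega), hb _ (by omega)] at h1
        omega
    intro l hl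
    have := this (g - l) (by omega)
    rwa [show g - (g - l) = l by omega] at this
  · intro hc v hv
    rw [h.bd_cut f v hv, hc v hv]
    by_cases hv' : v + 1 < g
    · rw [hc _ hv']; rfl
    · rw [show v + 1 = g by omega, h.cut_g]; rfl

/-- exponent vector of a position -/
def ceps (m n g : ℕ) (ρ σ : ℕ → ℕ) (up : ℕ → Bool) (y : ℕ × ℕ) : EE m n g → ℤ
  | Sum.inl a => if a.1 + 1 = y.1 then 1 else 0
  | Sum.inr (Sum.inl b) => if b.1 + 1 = y.2 then 1 else 0
  | Sum.inr (Sum.inr c) => if (up (c.1+1) = true ∧ y.1 ≤ ρ (c.1+1) ∧ y.2 ≤ σ (c.1+1)) ∨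
      (up (c.1+1) = false ∧ ρ (c.1+1) < y.1 ∧ σ (c.1+1) < y.2) then 1 else 0

lemma ceps_nonneg (y : ℕ × ℕ) : 0 ≤ ceps m n g ρ σ up y := by
  intro e
  rcases e with a | b | c <;> simp only [ceps, Pi.zero_apply] <;> split_ifs <;> norm_num

lemma ceps_le_one (y : ℕ × ℕ) : ceps m n g ρ σ up y ≤ 1 := by
  intro e
  rcases e with a | b | c <;> simp only [ceps, Pi.one_apply] <;> split_ifs <;> norm_num

lemma Cuts.ceps_cut (h : Cuts m n g ρ σ up Y) {i j : ℕ} (hy : (i, j) ∈ Y) (l : ℕ) (hl : l < g) :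
    cut ρ σ up (ceps m n g ρ σ up (i, j)) l = 0 := by
  obtain ⟨⟨h1, h2, h3, h4⟩, h5⟩ := (h.mem i j).1 hy
  unfold cut
  have e1 : (∑ a : Fin m, if a.1 < ρ l then ceps m n g ρ σ up (i, j) (Sum.inl a) else 0) = if i ≤ ρ l then 1 else 0 := by
    rw [Finset.sum_eq_single (⟨i - 1, by omega⟩ : Fin m)]
    · simp only [ceps]
      split_ifs <;> first | omega | rfl
    · intro b _ hb
      have : b.1 + 1 ≠ i := fun h => hb (Fin.ext (by simp only; omega))
      simp [ceps, this]
    · simp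
  have e2 : (∑ b : Fin n, if σ l ≤ b.1 then ceps m n g ρ σ up (i, j) (Sum.inr (Sum.inl b)) else 0) = if σ l < j then 1 else 0 := by
    rw [Finset.sum_eq_single (⟨j - 1, by omega⟩ : Fin n)]
    · simp only [ceps]
      split_ifs <;> first | omega | rfl
    · intro b _ hb
      have : b.1 + 1 ≠ j := fun h => hb (Fin.ext (by simp only; omega))
      simp [ceps, this]
    · simp
  rw [e1, e2]
  by_cases hl0 : 0 < l
  · obtain ⟨h6, h7⟩ := h5 l hl0 hl
    simp only [xval, dif_pos (And.intro hl0 hl), ceps, show l - 1 + 1 = l by omega]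
    cases hu : up l
    · have := h7 hu
      simp only [Bool.false_eq_true, false_and, true_and, false_or, if_false]
      split_ifs <;> omega
    · have := h6 hu
      simp only [true_and, reduceCtorEq, false_and, or_false, if_true]
      split_ifs <;> omega
  · have : l = 0 := by omega
    subst this
    simp only [xval, h.r0, h.s0]
    rw [if_pos h2, if_pos (by omega)]
    simp

/-- the weight -/
def cwt (m n g : ℕ) (ρ σ : ℕ → ℕ) (up : ℕ → Bool) : (EE m n g → ℤ) →+ (Fin g → ℤ) where
  toFun f v := bd (cinc m n g ρ σ up) v.1 f
  map_zero' := by funext v; simp [bd]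
  map_add' f f' := by funext v; exact bd_add _ _ _ _

lemma cwt_zero (f : EE m n g → ℤ) : cwt m n g ρ σ up f = 0 ↔ ∀ v, v < g → bd (cinc m n g ρ σ up) v f = 0 := by
  constructor
  · intro h v hv; exact congrFun h ⟨v, hv⟩
  · intro h; funext v; exact h v.1 v.2

lemma Cuts.cwt_zero_iff (h : Cuts m n g ρ σ up Y) (f : EE m n g → ℤ) :
    cwt m n g ρ σ up f = 0 ↔ ∀ l, l < g → cut ρ σ up f l = 0 := by
  rw [cwt_zero, h.bd_zero]

lemma Cuts.cwt_ceps (h : Cuts m n g ρ σ up Y) {y : ℕ × ℕ} (hy : y ∈ Y) :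
    cwt m n g ρ σ up (ceps m n g ρ σ up y) = 0 := by
  rw [h.cwt_zero_iff]; intro l hl; exact h.ceps_cut (i := y.1) (j := y.2) hy l hl

end cuts

lemma interval_of {L : Type} [Lattice L] [Fintype L] (P : L → Prop) (hne : ∃ y, P y)
    (hsup : ∀ y z, P y → P z → P (y ⊔ z)) (hinf : ∀ y z, P y → P z → P (y ⊓ z))
    (hconv : ∀ y b t, P b → P t → b ≤ y → y ≤ t → P y) (hcomp : ∀ y, ∃ z, P z ∧ (z ≤ y ∨ y ≤ z)) :
    ∃ b t, b ≤ t ∧ (∀ y, P y ↔ b ≤ y ∧ y ≤ t) ∧ ∀ y, b ≤ y ∨ y ≤ t := by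
  classical
  set S := Finset.univ.filter P with hS
  have hmem : ∀ y, y ∈ S ↔ P y := by intro y; simp [hS]
  obtain ⟨y0, hy0⟩ := hne
  have hSn : S.Nonempty := ⟨y0, (hmem y0).2 hy0⟩
  have hb : P (S.inf' hSn id) := Finset.inf'_induction hSn id (p := P) (fun a ha b hb => hinf a b ha hb) (fun y hy => (hmem y).1 hy)
  have ht : P (S.sup' hSn id) := Finset.sup'_induction hSn id (p := P) (fun a ha b hb => hsup a b ha hb) (fun y hy => (hmem y).1 hy)
  have h1 : ∀ y, P y → S.inf' hSn id ≤ y := fun y hy => Finset.inf'_le (f := id) ((hmem y).2 hy)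
  have h2 : ∀ y, P y → y ≤ S.sup' hSn id := fun y hy => Finset.le_sup' (f := id) ((hmem y).2 hy)
  refine ⟨_, _, (h1 y0 hy0).trans (h2 y0 hy0), fun y => ⟨fun hy => ⟨h1 y hy, h2 y hy⟩, fun hy => hconv y _ _ hb ht hy.1 hy.2⟩, ?_⟩
  intro y
  obtain ⟨z, hz, h | h⟩ := hcomp y
  · exact Or.inl ((h1 z hz).trans h)
  · exact Or.inr (h.trans (h2 z hz))

section cuts2
variable {m n g : ℕ} {ρ σ : ℕ → ℕ} {up : ℕ → Bool} {Y : Set (ℕ × ℕ)}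

theorem Cuts.peel (h : Cuts m n g ρ σ up Y) (u : EE m n g → ℤ) (hu : 0 ≤ u) (hc : ∀ l, l < g → cut ρ σ up u l = 0)
    (hne : u ≠ 0) : ∃ i j, (i, j) ∈ Y ∧ ceps m n g ρ σ up (i, j) ≤ u ∧
      (∀ a : Fin m, u (Sum.inl a) ≠ 0 → i ≤ a.1 + 1) ∧ (∀ b : Fin n, u (Sum.inr (Sum.inl b)) ≠ 0 → b.1 + 1 ≤ j) := by
  classical
  have hu' : ∀ e, 0 ≤ u e := hu
  have hx : ∀ l, 0 ≤ xval u l := by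
    intro l; unfold xval; split_ifs
    · exact hu' _
    · exact le_rfl
  have hR : ∀ l, (0 : ℤ) ≤ ∑ a : Fin m, if a.1 < ρ l then u (Sum.inl a) else 0 := by
    intro l; apply Finset.sum_nonneg; intro a _; split_ifs
    · exact hu' _
    · exact le_rfl
  have hC : ∀ l, (0 : ℤ) ≤ ∑ b : Fin n, if σ l ≤ b.1 then u (Sum.inr (Sum.inl b)) else 0 := by
    intro l; apply Finset.sum_nonneg; intro a _; split_ifs
    · exact hu' _
    · exact le_rfl
  have hRp : ∀ l (a : Fin m), u (Sum.inl a) ≠ 0 → a.1 < ρ l → (0 : ℤ) < ∑ a : Fin m, if a.1 < ρ l then u (Sum.inl a) else 0 := by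
    intro l a ha hal
    apply Finset.sum_pos'
    · intro a _; split_ifs
      · exact hu' _
      · exact le_rfl
    · exact ⟨a, Finset.mem_univ a, by rw [if_pos hal]; exact lt_of_le_of_ne (hu' _) (Ne.symm ha)⟩
  have hCp : ∀ l (b : Fin n), u (Sum.inr (Sum.inl b)) ≠ 0 → σ l ≤ b.1 → (0 : ℤ) < ∑ b : Fin n, if σ l ≤ b.1 then u (Sum.inr (Sum.inl b)) else 0 := by
    intro l a ha hal
    apply Finset.sum_pos'
    · intro a _; split_ifs
      · exact hu' _
      · exact le_rfl
    · exact ⟨a, Finset.mem_univ a, by rw [if_pos hal]; exact lt_of_le_of_ne (hu' _) (Ne.symm ha)⟩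
  have hc0 := hc 0 h.gpos
  unfold cut at hc hc0
  have x0 : xval u 0 = 0 := by simp [xval]
  rw [x0] at hc0
  have hex : (∃ a : Fin m, u (Sum.inl a) ≠ 0) ∧ (∃ b : Fin n, u (Sum.inr (Sum.inl b)) ≠ 0) := by
    have i1 : (∃ a : Fin m, u (Sum.inl a) ≠ 0) → (∃ b : Fin n, u (Sum.inr (Sum.inl b)) ≠ 0) := by
      rintro ⟨a, ha⟩
      by_contra hcon
      push Not at hcon
      have h1 := hRp 0 a ha (by rw [h.r0]; exact a.2)
      have h2 : (∑ b : Fin n, if σ 0 ≤ b.1 then u (Sum.inr (Sum.inl b)) else 0) = 0 :=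
        Finset.sum_eq_zero (fun b _ => by simp [hcon b])
      omega
    have i2 : (∃ b : Fin n, u (Sum.inr (Sum.inl b)) ≠ 0) → (∃ a : Fin m, u (Sum.inl a) ≠ 0) := by
      rintro ⟨a, ha⟩
      by_contra hcon
      push Not at hcon
      have h1 := hCp 0 a ha (by rw [h.s0]; exact Nat.zero_le _)
      have h2 : (∑ a : Fin m, if a.1 < ρ 0 then u (Sum.inl a) else 0) = 0 :=
        Finset.sum_eq_zero (fun b _ => by simp [hcon b])
      omega
    by_cases hr : ∃ a : Fin m, u (Sum.inl a) ≠ 0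
    · exact ⟨hr, i1 hr⟩
    · exfalso
      have hcc : ¬ ∃ b : Fin n, u (Sum.inr (Sum.inl b)) ≠ 0 := fun hh => hr (i2 hh)
      push Not at hr hcc
      apply hne
      funext e
      rcases e with a | b | c
      · exact hr a
      · exact hcc b
      · have := c.2
        have h1 := hc (c.1 + 1) (by omega)
        rw [Finset.sum_eq_zero (fun b _ => by simp [hr b]), Finset.sum_eq_zero (fun b _ => by simp [hcc b])] at h1
        have h2 : 0 < c.1 + 1 ∧ c.1 + 1 < g := ⟨by omega, by omega⟩
        simp only [xval, dif_pos h2, Nat.add_sub_cancel] at h1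
        show u (Sum.inr (Sum.inr c)) = 0
        split_ifs at h1 <;> simpa using h1
  obtain ⟨a0, ha0, hamin⟩ := Finset.exists_min_image (Finset.univ.filter (fun a : Fin m => u (Sum.inl a) ≠ 0)) (fun a => a.1)
    (by obtain ⟨a, ha⟩ := hex.1; exact ⟨a, by simpa using ha⟩)
  obtain ⟨b0, hb0, hbmax⟩ := Finset.exists_max_image (Finset.univ.filter (fun b : Fin n => u (Sum.inr (Sum.inl b)) ≠ 0)) (fun a => a.1)
    (by obtain ⟨a, ha⟩ := hex.2; exact ⟨a, by simpa using ha⟩)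
  simp only [Finset.mem_filter, Finset.mem_univ, true_and] at ha0 hamin hb0 hbmax
  have hRz : ∀ l, ρ l ≤ a0.1 → (∑ a : Fin m, if a.1 < ρ l then u (Sum.inl a) else 0) = 0 := by
    intro l hl
    apply Finset.sum_eq_zero
    intro a _
    split_ifs with hal
    · by_contra hh
      have := hamin a hh
      omega
    · rfl
  have hCz : ∀ l, b0.1 < σ l → (∑ b : Fin n, if σ l ≤ b.1 then u (Sum.inr (Sum.inl b)) else 0) = 0 := by
    intro l hl
    apply Finset.sum_eq_zero
    intro a _
    split_ifs with hal
    · by_contra hh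
      have := hbmax a hh
      omega
    · rfl
  have ha2 := a0.2
  have hb2 := b0.2
  refine ⟨a0.1 + 1, b0.1 + 1, ?_, ?_, fun a ha => by have := hamin a ha; omega, fun b hb => by have := hbmax b hb; omega⟩
  · rw [h.mem]
    refine ⟨⟨by omega, by omega, by omega, by omega⟩, fun l hl hl' => ⟨?_, ?_⟩⟩
    · rintro hup ⟨h1, h2⟩
      have h3 := hc l hl'
      rw [if_pos hup, hRz l (by omega)] at h3
      have h4 := hCp l b0 hb0 (by omega)
      have := hx l
      omega
    · rintro hup ⟨h1, h2⟩
      have h3 := hc l hl'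
      rw [hCz l (by omega)] at h3
      simp only [hup, Bool.false_eq_true, if_false] at h3
      have h4 := hRp l a0 ha0 (by omega)
      have := hx l
      omega
  · intro e
    rcases e with a | b | c
    · simp only [ceps]
      split_ifs with hh
      · have : a = a0 := Fin.ext (by omega)
        have := hu' (Sum.inl a0)
        subst a; omega
      · exact hu' _
    · simp only [ceps]
      split_ifs with hh
      · have : b = b0 := Fin.ext (by omega)
        have := hu' (Sum.inr (Sum.inl b0))
        subst b; omega
      · exact hu' _
    · simp only [ceps]
      split_ifs with hh
      · have := c.2
        have h1 := hc (c.1 + 1) (by omega)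
        have h2 : 0 < c.1 + 1 ∧ c.1 + 1 < g := ⟨by omega, by omega⟩
        have hval : xval u (c.1+1) = u (Sum.inr (Sum.inr c)) := by simp only [xval, dif_pos h2, Nat.add_sub_cancel]
        rw [hval] at h1
        rcases hh with ⟨hup, h3, h4⟩ | ⟨hup, h3, h4⟩
        · rw [hCz _ (by omega), if_pos hup] at h1
          have h5 := hRp (c.1+1) a0 ha0 (by omega)
          omega
        · rw [hRz _ (by omega)] at h1
          simp only [hup, Bool.false_eq_true, if_false] at h1
          have h5 := hCp (c.1+1) b0 hb0 (by omega)
          omega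
      · exact hu' _

lemma Cuts.join (h : Cuts m n g ρ σ up Y) {y z : ℕ × ℕ} (hy : y ∈ Y) (hz : z ∈ Y) : (min y.1 z.1, max y.2 z.2) ∈ Y := by
  rw [h.mem]
  obtain ⟨⟨h1, h2, h3, h4⟩, h5⟩ := (h.mem y.1 y.2).1 hy
  obtain ⟨⟨k1, k2, k3, k4⟩, k5⟩ := (h.mem z.1 z.2).1 hz
  refine ⟨⟨by omega, by omega, by omega, by omega⟩, fun l hl hl' => ⟨fun hup => ?_, fun hup => ?_⟩⟩
  · have := (h5 l hl hl').1 hup; have := (k5 l hl hl').1 hup; omega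
  · have := (h5 l hl hl').2 hup; have := (k5 l hl hl').2 hup; omega

lemma Cuts.meet (h : Cuts m n g ρ σ up Y) {y z : ℕ × ℕ} (hy : y ∈ Y) (hz : z ∈ Y) : (max y.1 z.1, min y.2 z.2) ∈ Y := by
  rw [h.mem]
  obtain ⟨⟨h1, h2, h3, h4⟩, h5⟩ := (h.mem y.1 y.2).1 hy
  obtain ⟨⟨k1, k2, k3, k4⟩, k5⟩ := (h.mem z.1 z.2).1 hz
  refine ⟨⟨by omega, by omega, by omega, by omega⟩, fun l hl hl' => ⟨fun hup => ?_, fun hup => ?_⟩⟩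
  · have := (h5 l hl hl').1 hup; have := (k5 l hl hl').1 hup; omega
  · have := (h5 l hl hl').2 hup; have := (k5 l hl hl').2 hup; omega

/-- the positions, as a lattice -/
structure LY (_ : Cuts m n g ρ σ up Y) : Type where
  /-- the position -/
  val : ℕ × ℕ
  /-- it is in the ladder -/
  property : val ∈ Y

lemma LY_ext {h : Cuts m n g ρ σ up Y} {y z : LY h} (e : y.1 = z.1) : y = z := by
  cases y; cases z; cases e; rfl

instance (h : Cuts m n g ρ σ up Y) : Lattice (LY h) where
  le y z := z.1.1 ≤ y.1.1 ∧ y.1.2 ≤ z.1.2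
  le_refl y := ⟨le_rfl, le_rfl⟩
  le_trans a b c h1 h2 := ⟨h2.1.trans h1.1, h1.2.trans h2.2⟩
  le_antisymm a b h1 h2 := LY_ext (Prod.ext (le_antisymm h2.1 h1.1) (le_antisymm h1.2 h2.2))
  sup y z := ⟨(min y.1.1 z.1.1, max y.1.2 z.1.2), h.join y.2 z.2⟩
  inf y z := ⟨(max y.1.1 z.1.1, min y.1.2 z.1.2), h.meet y.2 z.2⟩
  le_sup_left y z := ⟨min_le_left _ _, le_max_left _ _⟩
  le_sup_right y z := ⟨min_le_right _ _, le_max_right _ _⟩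
  sup_le a b c h1 h2 := ⟨le_min h1.1 h2.1, max_le h1.2 h2.2⟩
  inf_le_left y z := ⟨le_max_left _ _, min_le_left _ _⟩
  inf_le_right y z := ⟨le_max_right _ _, min_le_right _ _⟩
  le_inf a b c h1 h2 := ⟨max_le h1.1 h2.1, le_min h1.2 h2.2⟩

lemma LY_le (h : Cuts m n g ρ σ up Y) (y z : LY h) : y ≤ z ↔ z.1.1 ≤ y.1.1 ∧ y.1.2 ≤ z.1.2 := Iff.rfl

lemma Cuts.finite (h : Cuts m n g ρ σ up Y) : Y.Finite := by
  apply Set.Finite.subset (Set.finite_Icc ((0 : ℕ), (0 : ℕ)) (m, n))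
  rintro ⟨i, j⟩ hy
  obtain ⟨⟨h1, h2, h3, h4⟩, h5⟩ := (h.mem i j).1 hy
  exact ⟨⟨Nat.zero_le _, Nat.zero_le _⟩, ⟨h2, h4⟩⟩

noncomputable instance (h : Cuts m n g ρ σ up Y) : Fintype (LY h) := by
  have := h.finite.to_subtype
  have : Finite (LY h) := Finite.of_injective (fun y : LY h => (⟨y.1, y.2⟩ : Y)) (fun y z e => LY_ext (congrArg Subtype.val e))
  exact Fintype.ofFinite _

lemma Cuts.ladder (h : Cuts m n g ρ σ up Y) {i j p q : ℕ} (hy : (i, j) ∈ Y) (hz : (p, q) ∈ Y) (h1 : i ≤ p) (h2 : j ≤ q) :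
    (i, q) ∈ Y ∧ (p, j) ∈ Y := by
  have a := h.join hy hz
  have b := h.meet hy hz
  simp only [min_eq_left h1, max_eq_right h2, max_eq_right h1, min_eq_left h2] at a b
  exact ⟨a, b⟩

lemma ceps_row (y : ℕ × ℕ) (a : Fin m) : ceps m n g ρ σ up y (Sum.inl a) ≠ 0 ↔ y.1 = a.1 + 1 := by
  simp [ceps, eq_comm]

lemma ceps_col (y : ℕ × ℕ) (a : Fin n) : ceps m n g ρ σ up y (Sum.inr (Sum.inl a)) ≠ 0 ↔ y.2 = a.1 + 1 := by
  simp [ceps, eq_comm]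

lemma ceps_cross (y : ℕ × ℕ) (c : Fin (g-1)) : ceps m n g ρ σ up y (Sum.inr (Sum.inr c)) ≠ 0 ↔
    (up (c.1+1) = true ∧ y.1 ≤ ρ (c.1+1) ∧ y.2 ≤ σ (c.1+1)) ∨
      (up (c.1+1) = false ∧ ρ (c.1+1) < y.1 ∧ σ (c.1+1) < y.2) := by
  simp only [ceps]
  split_ifs with h
  · simp only [h, iff_true]; norm_num
  · simp [h]

lemma Cuts.interval (h : Cuts m n g ρ σ up Y) (e : EE m n g) : ∃ b t : LY h, b ≤ t ∧
    (∀ y : LY h, ceps m n g ρ σ up y.1 e ≠ 0 ↔ b ≤ y ∧ y ≤ t) ∧ ∀ y, b ≤ y ∨ y ≤ t := by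
  have hsup1 : ∀ y z : LY h, (y ⊔ z).1.1 = min y.1.1 z.1.1 := fun _ _ => rfl
  have hsup2 : ∀ y z : LY h, (y ⊔ z).1.2 = max y.1.2 z.1.2 := fun _ _ => rfl
  have hinf1 : ∀ y z : LY h, (y ⊓ z).1.1 = max y.1.1 z.1.1 := fun _ _ => rfl
  have hinf2 : ∀ y z : LY h, (y ⊓ z).1.2 = min y.1.2 z.1.2 := fun _ _ => rfl
  rcases e with a | b | c
  · have ha := a.2
    simp only [ceps_row]
    obtain ⟨j1, hj1⟩ := h.rowne (a.1+1) (by omega) (by omega)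
    apply interval_of
    · exact ⟨⟨_, hj1⟩, rfl⟩
    · intro y z hy hz; rw [hsup1]; omega
    · intro y z hy hz; rw [hinf1]; omega
    · intro y b t hb ht h1 h2; rw [LY_le] at h1 h2; omega
    · rintro ⟨⟨p, q⟩, hy⟩
      simp only [LY_le]
      rcases le_total p (a.1+1) with h1 | h1
      · rcases le_total j1 q with h2 | h2
        · exact ⟨⟨_, hj1⟩, rfl, Or.inl ⟨h1, h2⟩⟩
        · exact ⟨⟨_, (h.ladder hy hj1 h1 h2).2⟩, rfl, Or.inl ⟨h1, le_rfl⟩⟩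
      · rcases le_total q j1 with h2 | h2
        · exact ⟨⟨_, hj1⟩, rfl, Or.inr ⟨h1, h2⟩⟩
        · exact ⟨⟨_, (h.ladder hj1 hy h1 h2).1⟩, rfl, Or.inr ⟨h1, le_rfl⟩⟩
  · have hb := b.2
    simp only [ceps_col]
    obtain ⟨j1, hj1⟩ := h.colne (b.1+1) (by omega) (by omega)
    apply interval_of
    · exact ⟨⟨_, hj1⟩, rfl⟩
    · intro y z hy hz; rw [hsup2]; omega
    · intro y z hy hz; rw [hinf2]; omega
    · intro y b t hb ht h1 h2; rw [LY_le] at h1 h2; omega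
    · rintro ⟨⟨p, q⟩, hy⟩
      simp only [LY_le]
      rcases le_total q (b.1+1) with h1 | h1
      · rcases le_total j1 p with h2 | h2
        · exact ⟨⟨_, hj1⟩, rfl, Or.inr ⟨h2, h1⟩⟩
        · exact ⟨⟨_, (h.ladder hy hj1 h2 h1).1⟩, rfl, Or.inr ⟨le_rfl, h1⟩⟩
      · rcases le_total p j1 with h2 | h2
        · exact ⟨⟨_, hj1⟩, rfl, Or.inl ⟨h2, h1⟩⟩
        · exact ⟨⟨_, (h.ladder hj1 hy h2 h1).2⟩, rfl, Or.inl ⟨le_rfl, h1⟩⟩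
  · have hc := c.2
    simp only [ceps_cross]
    obtain ⟨k1, k2⟩ := h.corner (c.1+1) (by omega) (by omega)
    cases hup : up (c.1+1)
    · have k3 := k2 hup
      simp only [Bool.false_eq_true, false_and, true_and, false_or]
      apply interval_of
      · exact ⟨⟨_, k3⟩, by simp⟩
      · intro y z hy hz; rw [hsup1, hsup2]; omega
      · intro y z hy hz; rw [hinf1, hinf2]; omega
      · intro y b t hb ht h1 h2; rw [LY_le] at h1 h2; omega
      · rintro ⟨⟨p, q⟩, hy⟩
        have := (((h.mem p q).1 hy).2 (c.1+1) (by omega) (by omega)).2 hup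
        simp only [LY_le]
        by_cases h1 : ρ (c.1+1) < p ∧ σ (c.1+1) < q
        · exact ⟨⟨_, hy⟩, h1, Or.inl ⟨le_rfl, le_rfl⟩⟩
        · exact ⟨⟨_, k3⟩, by simp, by simp only; omega⟩
    · have k3 := k1 hup
      simp only [reduceCtorEq, false_and, true_and, or_false]
      apply interval_of
      · exact ⟨⟨_, k3⟩, by simp⟩
      · intro y z hy hz; rw [hsup1, hsup2]; omega
      · intro y z hy hz; rw [hinf1, hinf2]; omega
      · intro y b t hb ht h1 h2; rw [LY_le] at h1 h2; omega
      · rintro ⟨⟨p, q⟩, hy⟩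
        have := (((h.mem p q).1 hy).2 (c.1+1) (by omega) (by omega)).1 hup
        simp only [LY_le]
        by_cases h1 : p ≤ ρ (c.1+1) ∧ q ≤ σ (c.1+1)
        · exact ⟨⟨_, hy⟩, h1, Or.inl ⟨le_rfl, le_rfl⟩⟩
        · exact ⟨⟨_, k3⟩, by simp, by simp only; omega⟩

theorem Cuts.straight (h : Cuts m n g ρ σ up Y) :
    Straight (cwt m n g ρ σ up) (fun y : LY h => ceps m n g ρ σ up y.1) where
  pos y := ceps_nonneg _
  ne y := by
    intro h0
    obtain ⟨⟨h1, h2, h3, h4⟩, _⟩ := (h.mem y.1.1 y.1.2).1 y.2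
    have := (ceps_row (m := m) (n := n) (g := g) (ρ := ρ) (σ := σ) (up := up) y.1 ⟨y.1.1 - 1, by omega⟩).2 (by simp only; omega)
    exact this (congrFun h0 _)
  wt0 y := h.cwt_ceps y.2
  top w hw hw0 hne := by
    rw [h.cwt_zero_iff] at hw0
    obtain ⟨i, j, hij, h1, h2, h3⟩ := h.peel w hw hw0 hne
    refine ⟨⟨(i, j), hij⟩, h1, ?_⟩
    intro y hy
    obtain ⟨⟨k1, k2, k3, k4⟩, _⟩ := (h.mem y.1.1 y.1.2).1 y.2
    rw [LY_le]
    constructor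
    · have h5 := (ceps_row (m := m) (n := n) (g := g) (ρ := ρ) (σ := σ) (up := up) y.1 ⟨y.1.1 - 1, by omega⟩).2 (by simp only; omega)
      have h6 := ceps_nonneg (m := m) (n := n) (g := g) (ρ := ρ) (σ := σ) (up := up) y.1 (Sum.inl ⟨y.1.1 - 1, by omega⟩)
      have h7 : ceps m n g ρ σ up y.1 _ ≤ _ := hy (Sum.inl ⟨y.1.1 - 1, by omega⟩)
      have := h2 ⟨y.1.1 - 1, by omega⟩ (by simp only [Pi.zero_apply] at h6; omega)
      simp only at this ⊢
      omega
    · have h5 := (ceps_col (m := m) (n := n) (g := g) (ρ := ρ) (σ := σ) (up := up) y.1 ⟨y.1.2 - 1, by omega⟩).2 (by simp only; omega)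
      have h6 := ceps_nonneg (m := m) (n := n) (g := g) (ρ := ρ) (σ := σ) (up := up) y.1 (Sum.inr (Sum.inl ⟨y.1.2 - 1, by omega⟩))
      have h7 : ceps m n g ρ σ up y.1 _ ≤ _ := hy (Sum.inr (Sum.inl ⟨y.1.2 - 1, by omega⟩))
      have := h3 ⟨y.1.2 - 1, by omega⟩ (by simp only [Pi.zero_apply] at h6; omega)
      simp only at this ⊢
      omega
  up N y t hN hy := by
    obtain ⟨⟨k1, k2, k3, k4⟩, _⟩ := (h.mem y.1.1 y.1.2).1 y.2
    have key : ∀ e, ceps m n g ρ σ up y.1 e ≠ 0 → ∃ z : LY h, N z ≠ 0 ∧ ceps m n g ρ σ up z.1 e ≠ 0 := by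
      intro e he
      by_contra hcon
      push Not at hcon
      have h1 : ceps m n g ρ σ up y.1 e ≤ _ := hy e
      have h6 : 0 ≤ ceps m n g ρ σ up y.1 e := ceps_nonneg y.1 e
      rw [Finset.sum_apply, Finset.sum_eq_zero] at h1
      · omega
      · intro z _
        by_cases hz : N z = 0
        · simp [hz]
        · simp [hcon z hz]
    rw [LY_le]
    constructor
    · obtain ⟨z, hz, hz'⟩ := key (Sum.inl ⟨y.1.1 - 1, by omega⟩) (by rw [ceps_row]; simp only; omega)
      rw [ceps_row] at hz'
      have := (hN z hz).1
      simp only at hz'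
      omega
    · obtain ⟨z, hz, hz'⟩ := key (Sum.inr (Sum.inl ⟨y.1.2 - 1, by omega⟩)) (by rw [ceps_col]; simp only; omega)
      rw [ceps_col] at hz'
      have := (hN z hz).2
      simp only at hz'
      omega

theorem Cuts.alpha_cases (h : Cuts m n g ρ σ up Y) {k : Type} [Field k] (α : Fin g → ℤ)
    (hex : ∀ u, cwt m n g ρ σ up u = 0 → Ex2 k (cwt m n g ρ σ up) α u)
    (hz : ∀ e, ∃ f : EE m n g → ℤ, 0 ≤ f ∧ cwt m n g ρ σ up f = α ∧ f e = 0) :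
    α = 0 ∨ α = cwt m n g ρ σ up (-1) := by
  classical
  have hs := h.straight
  set ε := (fun y : LY h => ceps m n g ρ σ up y.1) with hε
  have H1 : ∀ m' : EE m n g → ℤ, 0 ≤ m' → cwt m n g ρ σ up m' = 0 → m' ≠ 0 → ∃ y, ε y ≤ m' := by
    intro w hw hw0 hne
    obtain ⟨y0, hy0, _⟩ := hs.top w hw hw0 hne
    exact ⟨y0, hy0⟩
  have hD : ∀ u : EE m n g → ℤ, cwt m n g ρ σ up u = 0 → (∃ e, 0 ≤ u e) → kk ε u = 0 := by
    rintro u hu ⟨e, he⟩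
    obtain ⟨b, t, hbt, h1, h2⟩ := h.interval e
    exact hs.kk_zero (fun y => ceps_le_one _) u hu e he b t hbt h1 h2
  have hstar := star_count ε hs.pos (fun y => ceps_le_one _) hs.ne hs.wt0 H1 hD
    (fun u hu T hT => koszul_pfun ε hs.pos hs.wt0 H1 hex u hu T hT) hz
  set α' : ℕ → ℤ := fun v => if hv : v < g then α ⟨v, hv⟩ else 0 with hα'
  have hU : StarU (cinc m n g ρ σ up) α' (Finset.Ico 0 g) := by
    intro w hw0 _ hb
    have := hstar w (by
      funext v
      exact hb v.1 (by simp))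
    have conv : ∀ (β : Fin g → ℤ) (β' : ℕ → ℤ), (∀ v : Fin g, β' v.1 = β v) →
        FB (cinc m n g ρ σ up) (Finset.Ico 0 g) w β' = (Finset.Icc 0 w).filter (fun f => cwt m n g ρ σ up f = β) := by
      intro β β' hβ
      unfold FB
      ext f
      simp only [Finset.mem_filter, Finset.mem_Ico, Nat.zero_le, true_and]
      apply and_congr_right
      intro _
      constructor
      · intro hf; funext v; rw [← hβ v]; exact hf v.1 v.2
      · intro hf v hv
        have := congrFun hf ⟨v, hv⟩
        rw [← hβ] at this
        exact this
    rw [conv α α' (fun v => by simp [hα']), conv 0 0 (fun v => rfl)]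
    convert this
  rcases h.pnet.main hU with h1 | h1
  · left
    funext v
    have := h1 v.1 v.2
    simpa [hα'] using this
  · right
    funext v
    have := h1 v.1 v.2
    simp only [hα', dif_pos v.2] at this
    exact this

end cuts2

section toricladder
variable {m n g : ℕ} {ρ σ : ℕ → ℕ} {up : ℕ → Bool} {Y : Set (ℕ × ℕ)}

lemma Cuts.ceps_swap (h : Cuts m n g ρ σ up Y) {i p q j : ℕ} (hip : i < p) (hqj : q < j)
    (h1 : (i, q) ∈ Y) (h2 : (p, j) ∈ Y) :
    ceps m n g ρ σ up (i, q) + ceps m n g ρ σ up (p, j) = ceps m n g ρ σ up (i, j) + ceps m n g ρ σ up (p, q) := by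
  funext e
  rcases e with a | b | c
  · simp only [Pi.add_apply, ceps]
  · simp only [Pi.add_apply, ceps]; rw [add_comm]
  · simp only [Pi.add_apply, ceps]
    have hc := c.2
    have a1 := ((h.mem i q).1 h1).2 (c.1+1) (by omega) (by omega)
    have a2 := ((h.mem p j).1 h2).2 (c.1+1) (by omega) (by omega)
    cases hup : up (c.1+1)
    · have b1 := a1.2 hup
      have b2 := a2.2 hup
      simp only [Bool.false_eq_true, false_and, true_and, false_or]
      split_ifs <;> omega
    · have b1 := a1.1 hup
      have b2 := a2.1 hup
      simp only [reduceCtorEq, false_and, true_and, or_false]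
      split_ifs <;> omega

/-- weight of a monomial -/
noncomputable def WW (m n g : ℕ) (ρ σ : ℕ → ℕ) (up : ℕ → Bool) (Y : Set (ℕ × ℕ)) : (Y →₀ ℕ) →+ (EE m n g → ℤ) :=
  Finsupp.liftAddHom (fun y => multiplesHom _ (ceps m n g ρ σ up y.1))

lemma WW_single (y : Y) (c : ℕ) : WW m n g ρ σ up Y (Finsupp.single y c) = c • ceps m n g ρ σ up y.1 := by
  simp [WW]

lemma WW_nonneg (d : Y →₀ ℕ) : 0 ≤ WW m n g ρ σ up Y d := by
  induction d using Finsupp.induction_linear with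
  | zero => simp
  | add f g hf hg => rw [map_add]; exact add_nonneg hf hg
  | single y c => rw [WW_single]; exact nsmul_nonneg (ceps_nonneg _) _

lemma zz_nsmul {k : Type} [Field k] {E : Type} [Fintype E] {v : E → ℤ} (hv : 0 ≤ v) (c : ℕ) : zz k (c • v) = zz k v ^ c := by
  induction c with
  | zero => simp [zz_zero]
  | succ c ih => rw [succ_nsmul, zz_add (nsmul_nonneg hv c) hv, ih, pow_succ]

/-- the toric map -/
noncomputable def phi (k : Type) [Field k] (m n g : ℕ) (ρ σ : ℕ → ℕ) (up : ℕ → Bool) (Y : Set (ℕ × ℕ)) :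
    MvPolynomial Y k →ₐ[k] MvPolynomial (EE m n g) k :=
  MvPolynomial.aeval (fun y : Y => zz k (ceps m n g ρ σ up y.1))

variable {k : Type} [Field k]

lemma phi_X (y : Y) : phi k m n g ρ σ up Y (MvPolynomial.X y) = zz k (ceps m n g ρ σ up y.1) := by
  simp [phi]

lemma phi_monomial (d : Y →₀ ℕ) : phi k m n g ρ σ up Y (MvPolynomial.monomial d 1) = zz k (WW m n g ρ σ up Y d) := by
  induction d using Finsupp.induction_linear with
  | zero => rw [map_zero, zz_zero]; exact map_one _
  | add f g hf hg =>
    rw [map_add, zz_add (WW_nonneg _) (WW_nonneg _), ← hf, ← hg, ← map_mul, MvPolynomial.monomial_mul, one_mul]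
  | single y c =>
    rw [WW_single, zz_nsmul (ceps_nonneg _), ← phi_X, ← map_pow, MvPolynomial.X_pow_eq_monomial]

lemma Cuts.phi_minor (h : Cuts m n g ρ σ up Y) (p : MvPolynomial Y k) (hp : p ∈ minorIdeal k 2 Y) :
    phi k m n g ρ σ up Y p = 0 := by
  have : minorIdeal k 2 Y ≤ RingHom.ker (phi k m n g ρ σ up Y).toRingHom := by
    unfold minorIdeal
    rw [Ideal.span_le]
    rintro f ⟨r, c, hr, hc, hm, rfl⟩
    show phi k m n g ρ σ up Y _ = 0
    have hr' : r 0 < r 1 := hr (by decide)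
    have hc' : c 0 < c 1 := hc (by decide)
    simp only [minorPoly, Matrix.det_fin_two, Matrix.of_apply, map_sub, map_mul, phi_X]
    rw [← zz_add (ceps_nonneg _) (ceps_nonneg _), ← zz_add (ceps_nonneg _) (ceps_nonneg _),
      h.ceps_swap hr' hc' (hm 0 0) (hm 1 1), sub_self]
  exact this hp

lemma minor_rel {i p q j : ℕ} (hip : i < p) (hqj : q < j) (h1 : (i, q) ∈ Y) (h2 : (p, j) ∈ Y) (h3 : (i, j) ∈ Y)
    (h4 : (p, q) ∈ Y) :
    (Ideal.Quotient.mk (minorIdeal k 2 Y) (MvPolynomial.X ⟨(i, q), h1⟩)) * Ideal.Quotient.mk _ (MvPolynomial.X ⟨(p, j), h2⟩)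
     = Ideal.Quotient.mk _ (MvPolynomial.X ⟨(i, j), h3⟩) * Ideal.Quotient.mk _ (MvPolynomial.X ⟨(p, q), h4⟩) := by
  rw [← map_mul, ← map_mul, Ideal.Quotient.eq]
  apply Ideal.subset_span
  refine ⟨![i, p], ![q, j], ?_, ?_, ?_, ?_⟩
  · intro a b hab; fin_cases a <;> fin_cases b <;> simp_all
  · intro a b hab; fin_cases a <;> fin_cases b <;> simp_all
  · intro u v; fin_cases u <;> fin_cases v <;> simp_all
  · simp [minorPoly, Matrix.det_fin_two]

/-- class of a monomial -/
noncomputable def mcl (k : Type) [Field k] (Y : Set (ℕ × ℕ)) (d : Y →₀ ℕ) : LadderRing k 2 Y :=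
  Ideal.Quotient.mk _ (MvPolynomial.monomial d 1)

lemma mcl_add (d d' : Y →₀ ℕ) : mcl k Y (d + d') = mcl k Y d * mcl k Y d' := by
  unfold mcl
  rw [← map_mul, MvPolynomial.monomial_mul, one_mul]

lemma exists_sub (d : Y →₀ ℕ) (y : Y) (hy : d y ≠ 0) : ∃ d1, d = Finsupp.single y 1 + d1 :=
  ⟨d - Finsupp.single y 1, by
    ext z
    by_cases hz : y = z
    · subst hz; simp; omega
    · simp [hz]⟩

lemma WW_supp (d : Y →₀ ℕ) (e : EE m n g) (he : WW m n g ρ σ up Y d e ≠ 0) : ∃ y : Y, d y ≠ 0 ∧ ceps m n g ρ σ up y.1 e ≠ 0 := by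
  by_contra hcon
  push Not at hcon
  apply he
  simp only [WW, Finsupp.liftAddHom_apply, Finsupp.sum, Finset.sum_apply, multiplesHom_apply]
  apply Finset.sum_eq_zero
  intro y hy
  simp [hcon y (Finsupp.mem_support_iff.1 hy)]

lemma Cuts.pull (h : Cuts m n g ρ σ up Y) {i j : ℕ} (hij : (i, j) ∈ Y) (d : Y →₀ ℕ)
    (hle : ceps m n g ρ σ up (i, j) ≤ WW m n g ρ σ up Y d)
    (h1 : ∀ a : Fin m, WW m n g ρ σ up Y d (Sum.inl a) ≠ 0 → i ≤ a.1 + 1)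
    (h2 : ∀ b : Fin n, WW m n g ρ σ up Y d (Sum.inr (Sum.inl b)) ≠ 0 → b.1 + 1 ≤ j) :
    ∃ d1, WW m n g ρ σ up Y d = ceps m n g ρ σ up (i, j) + WW m n g ρ σ up Y d1 ∧
      mcl k Y d = mcl k Y (Finsupp.single ⟨(i, j), hij⟩ 1) * mcl k Y d1 := by
  obtain ⟨⟨k1, k2, k3, k4⟩, _⟩ := (h.mem i j).1 hij
  have direct : d ⟨(i, j), hij⟩ ≠ 0 → ∃ d1, WW m n g ρ σ up Y d = ceps m n g ρ σ up (i, j) + WW m n g ρ σ up Y d1 ∧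
      mcl k Y d = mcl k Y (Finsupp.single ⟨(i, j), hij⟩ 1) * mcl k Y d1 := by
    intro hd
    obtain ⟨d1, rfl⟩ := exists_sub d _ hd
    exact ⟨d1, by rw [map_add, WW_single, one_smul], mcl_add _ _⟩
  have hpos : ∀ e, ceps m n g ρ σ up (i, j) e ≠ 0 → WW m n g ρ σ up Y d e ≠ 0 := by
    intro e he
    have a1 : 0 ≤ ceps m n g ρ σ up (i, j) e := ceps_nonneg _ e
    have a2 : ceps m n g ρ σ up (i, j) e ≤ WW m n g ρ σ up Y d e := hle e
    omega
  have sub : ∀ (y : Y), d y ≠ 0 → ∀ e, ceps m n g ρ σ up y.1 e ≠ 0 → WW m n g ρ σ up Y d e ≠ 0 := by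
    intro y hy e he
    obtain ⟨d1, rfl⟩ := exists_sub d _ hy
    rw [map_add, WW_single, one_smul]
    have a1 : 0 ≤ ceps m n g ρ σ up y.1 e := ceps_nonneg _ e
    have a2 : 0 ≤ WW m n g ρ σ up Y d1 e := WW_nonneg _ e
    simp only [Pi.add_apply]
    omega
  obtain ⟨⟨⟨i', q⟩, hy1⟩, hd1, he1⟩ := WW_supp d _ (hpos (Sum.inl ⟨i - 1, by omega⟩) (by rw [ceps_row]; simp only; omega))
  obtain ⟨⟨⟨p, j'⟩, hy2⟩, hd2, he2⟩ := WW_supp d _ (hpos (Sum.inr (Sum.inl ⟨j - 1, by omega⟩)) (by rw [ceps_col]; simp only; omega))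
  rw [ceps_row] at he1
  rw [ceps_col] at he2
  simp only at he1 he2
  obtain rfl : i' = i := by omega
  obtain rfl : j' = j := by omega
  obtain ⟨⟨l1, l2, l3, l4⟩, _⟩ := (h.mem _ _).1 hy1
  obtain ⟨⟨r1, r2, r3, r4⟩, _⟩ := (h.mem _ _).1 hy2
  have hq : q ≤ j' := by
    have := h2 ⟨q - 1, by omega⟩ (sub _ hd1 _ (by rw [ceps_col]; simp only; omega))
    simp only at this; omega
  have hp : i' ≤ p := by
    have := h1 ⟨p - 1, by omega⟩ (sub _ hd2 _ (by rw [ceps_row]; simp only; omega))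
    simp only at this; omega
  rcases hq.eq_or_lt with rfl | hq
  · exact direct hd1
  rcases hp.eq_or_lt with rfl | hp
  · exact direct hd2
  have hpq : (p, q) ∈ Y := (h.ladder hy1 hy2 hp.le hq.le).2
  obtain ⟨d1, rfl⟩ := exists_sub d _ hd1
  have hd2' : d1 ⟨(p, j'), hy2⟩ ≠ 0 := by
    intro h0
    apply hd2
    rw [Finsupp.add_apply, h0, Finsupp.single_apply, if_neg]
    intro he
    have := congrArg (fun z => z.1.1) he
    simp only at this
    omega
  obtain ⟨d2, rfl⟩ := exists_sub d1 _ hd2'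
  refine ⟨Finsupp.single ⟨(p, q), hpq⟩ 1 + d2, ?_, ?_⟩
  · simp only [map_add, WW_single, one_smul]
    rw [← add_assoc, ← add_assoc, h.ceps_swap hp hq hy1 hy2]
  · rw [mcl_add, mcl_add, mcl_add, ← mul_assoc, ← mul_assoc]
    congr 1
    exact minor_rel hp hq hy1 hy2 hij hpq

lemma Cuts.WW_wt (h : Cuts m n g ρ σ up Y) (d : Y →₀ ℕ) : cwt m n g ρ σ up (WW m n g ρ σ up Y d) = 0 := by
  induction d using Finsupp.induction_linear with
  | zero => simp
  | add f g hf hg => rw [map_add, map_add, hf, hg, add_zero]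
  | single y c => rw [WW_single, map_nsmul, h.cwt_ceps y.2, smul_zero]

lemma Cuts.ceps_pos (h : Cuts m n g ρ σ up Y) {y : ℕ × ℕ} (hy : y ∈ Y) : 0 < ∑ e, ceps m n g ρ σ up y e := by
  apply Finset.sum_pos'
  · intro e _; exact ceps_nonneg y e
  · obtain ⟨⟨h1, h2, h3, h4⟩, _⟩ := (h.mem y.1 y.2).1 hy
    have := (ceps_row (m := m) (n := n) (g := g) (ρ := ρ) (σ := σ) (up := up) y ⟨y.1 - 1, by omega⟩).2 (by simp only; omega)
    exact ⟨_, Finset.mem_univ _, lt_of_le_of_ne (ceps_nonneg y _) (Ne.symm this)⟩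

lemma Cuts.mcl_eq (h : Cuts m n g ρ σ up Y) (N : ℕ) (d d' : Y →₀ ℕ) (hd : WW m n g ρ σ up Y d = WW m n g ρ σ up Y d')
    (hN : (∑ e, WW m n g ρ σ up Y d e).toNat = N) : mcl k Y d = mcl k Y d' := by
  induction N using Nat.strong_induction_on generalizing d d' with
  | _ N ih =>
    by_cases hne : WW m n g ρ σ up Y d = 0
    · have hz : ∀ d : Y →₀ ℕ, WW m n g ρ σ up Y d = 0 → d = 0 := by
        intro d hd
        ext y
        by_contra hy
        obtain ⟨d1, rfl⟩ := exists_sub d _ hy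
        rw [map_add, WW_single, one_smul] at hd
        have h1 := h.ceps_pos y.2
        rw [Finset.sum_eq_zero] at h1
        · omega
        · intro e _
          have h2 := congrFun hd e
          have h3 : 0 ≤ ceps m n g ρ σ up y.1 e := ceps_nonneg _ e
          have h4 : 0 ≤ WW m n g ρ σ up Y d1 e := WW_nonneg _ e
          simp only [Pi.add_apply, Pi.zero_apply] at h2
          omega
      rw [hz d hne, hz d' (hd ▸ hne)]
    · obtain ⟨i, j, hij, h1, h2, h3⟩ := h.peel _ (WW_nonneg d) ((h.cwt_zero_iff _).1 (h.WW_wt d)) hne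
      obtain ⟨d1, e1, f1⟩ := h.pull (k := k) hij d h1 h2 h3
      obtain ⟨d2, e2, f2⟩ := h.pull (k := k) hij d' (hd ▸ h1) (hd ▸ h2) (hd ▸ h3)
      rw [f1, f2]
      congr 1
      refine ih _ ?_ d1 d2 (by rw [e1, e2] at hd; exact add_left_cancel hd) rfl
      rw [← hN, e1]
      simp only [Pi.add_apply, Finset.sum_add_distrib]
      have p1 := h.ceps_pos hij
      have p2 : 0 ≤ ∑ e, WW m n g ρ σ up Y d1 e := Finset.sum_nonneg (fun e _ => WW_nonneg d1 e)
      omega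

open Classical in
/-- inverse on monomials -/
noncomputable def thet (k : Type) [Field k] (m n g : ℕ) (ρ σ : ℕ → ℕ) (up : ℕ → Bool) (Y : Set (ℕ × ℕ)) (w : EE m n g →₀ ℕ) :
    LadderRing k 2 Y :=
  if hw : ∃ d, toN (WW m n g ρ σ up Y d) = w then mcl k Y hw.choose else 0

lemma Cuts.thet_WW (h : Cuts m n g ρ σ up Y) (d : Y →₀ ℕ) :
    thet k m n g ρ σ up Y (toN (WW m n g ρ σ up Y d)) = mcl k Y d := by
  have hw : ∃ d', toN (WW m n g ρ σ up Y d') = toN (WW m n g ρ σ up Y d) := ⟨d, rfl⟩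
  unfold thet
  rw [dif_pos hw]
  refine h.mcl_eq _ _ _ ?_ rfl
  have := congrArg ofN hw.choose_spec
  rwa [ofN_toN (WW_nonneg _), ofN_toN (WW_nonneg _)] at this

lemma Cuts.phi_inj (h : Cuts m n g ρ σ up Y) (p : MvPolynomial Y k) (hp : phi k m n g ρ σ up Y p = 0) :
    p ∈ minorIdeal k 2 Y := by
  let Θ : MvPolynomial (EE m n g) k →ₗ[k] LadderRing k 2 Y :=
    (MvPolynomial.basisMonomials (EE m n g) k).constr k (thet k m n g ρ σ up Y)
  have hΘ : ∀ w, Θ (MvPolynomial.monomial w 1) = thet k m n g ρ σ up Y w := by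
    intro w
    have := (MvPolynomial.basisMonomials (EE m n g) k).constr_basis k (thet k m n g ρ σ up Y) w
    rwa [MvPolynomial.coe_basisMonomials] at this
  have key : Θ ∘ₗ (phi k m n g ρ σ up Y).toLinearMap = (Ideal.Quotient.mkₐ k (minorIdeal k 2 Y)).toLinearMap := by
    apply (MvPolynomial.basisMonomials Y k).ext
    intro d
    simp only [MvPolynomial.coe_basisMonomials, LinearMap.comp_apply, AlgHom.toLinearMap_apply]
    rw [phi_monomial, zz_pos (WW_nonneg _), hΘ, h.thet_WW]
    rfl
  have := LinearMap.congr_fun key p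
  simp only [LinearMap.comp_apply, AlgHom.toLinearMap_apply, hp, map_zero] at this
  exact Ideal.Quotient.eq_zero_iff_mem.1 this.symm

lemma Cuts.exists_WW (h : Cuts m n g ρ σ up Y) (w : EE m n g → ℤ) (hw : 0 ≤ w) (hw0 : cwt m n g ρ σ up w = 0) :
    ∃ d, WW m n g ρ σ up Y d = w := by
  classical
  obtain ⟨N, hN⟩ := h.straight.exists_rep _ w rfl hw hw0
  refine ⟨∑ y : LY h, Finsupp.single (⟨y.1, y.2⟩ : Y) (N y), ?_⟩
  rw [← hN.2, map_sum]
  simp only [WW_single]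

theorem Cuts.toric (h : Cuts m n g ρ σ up Y) (k : Type) [Field k] :
    ∃ (i1 : Algebra (LadderRing k 2 Y) (MvPolynomial (EE m n g) k))
      (_ : @IsScalarTower k (LadderRing k 2 Y) (MvPolynomial (EE m n g) k) Algebra.toSMul Algebra.toSMul Algebra.toSMul),
      Toric k (cwt m n g ρ σ up) (LadderRing k 2 Y) := by
  let f : LadderRing k 2 Y →+* MvPolynomial (EE m n g) k :=
    Ideal.Quotient.lift (minorIdeal k 2 Y) (phi k m n g ρ σ up Y).toRingHom h.phi_minor
  have hf : ∀ p, f (Ideal.Quotient.mk _ p) = phi k m n g ρ σ up Y p := fun p => rfl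
  refine ⟨f.toAlgebra, ?_, ?_⟩
  · let _ := f.toAlgebra
    apply IsScalarTower.of_algebraMap_eq
    intro x
    show _ = f (Ideal.Quotient.mk _ (MvPolynomial.C x))
    rw [hf]
    exact ((phi k m n g ρ σ up Y).commutes x).symm
  · let _ := f.toAlgebra
    refine ⟨?_, ?_⟩
    · show Function.Injective f
      rw [injective_iff_map_eq_zero]
      intro a ha
      obtain ⟨p, rfl⟩ := Ideal.Quotient.mk_surjective a
      rw [hf] at ha
      exact Ideal.Quotient.eq_zero_iff_mem.2 (h.phi_inj p ha)
    · intro p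
      show _ ↔ ∃ r, f r = p
      constructor
      · intro hp
        refine HomW.induction (wt := cwt m n g ρ σ up) (β := 0) (M := fun p => ∃ r, f r = p) ⟨0, map_zero f⟩ ?_ ?_ p hp
        · rintro _ _ _ _ ⟨a, rfl⟩ ⟨b, rfl⟩
          exact ⟨a + b, map_add f a b⟩
        · intro c v hv hv0
          obtain ⟨d, rfl⟩ := h.exists_WW v hv hv0
          refine ⟨Ideal.Quotient.mk _ (c • MvPolynomial.monomial d 1), ?_⟩
          rw [hf, map_smul, phi_monomial]
      · rintro ⟨r, rfl⟩
        obtain ⟨p, rfl⟩ := Ideal.Quotient.mk_surjective r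
        rw [hf]
        induction p using MvPolynomial.induction_on' with
        | monomial d a =>
          have : MvPolynomial.monomial d a = a • (MvPolynomial.monomial d 1 : MvPolynomial Y k) := by
            rw [MvPolynomial.smul_monomial, smul_eq_mul, mul_one]
          rw [this, map_smul, phi_monomial]
          exact (HomW.zz (h.WW_wt d)).smul a
        | add p q hp hq => rw [map_add]; exact hp.add hq

end toricladder

section geometry
variable {m n : ℕ} {Y : Set (ℕ × ℕ)}

lemma disc (hY : IsLadder m n Y) (hconn : TConnected m n 2 Y) (P : ℕ → ℕ → Prop)
    (hP : ∀ i j p q, i < p → j < q → (i, j) ∈ Y → (i, q) ∈ Y → (p, j) ∈ Y → (p, q) ∈ Y →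
      (P i j ∧ P i q ∧ P p j ∧ P p q) ∨ (¬ P i j ∧ ¬ P i q ∧ ¬ P p j ∧ ¬ P p q))
    (i j p q : ℕ) (h1 : (i, j) ∈ Y) (h2 : (p, q) ∈ Y) (h3 : P i j) (h4 : ¬ P p q) : False := by
  apply hconn
  have lad : ∀ Q : ℕ → ℕ → Prop, (∀ i j p q, i < p → j < q → (i, j) ∈ Y → (i, q) ∈ Y → (p, j) ∈ Y → (p, q) ∈ Y →
      (Q i j ∧ Q i q ∧ Q p j ∧ Q p q) ∨ (¬ Q i j ∧ ¬ Q i q ∧ ¬ Q p j ∧ ¬ Q p q)) →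
      IsLadder m n {y | y ∈ Y ∧ Q y.1 y.2} := by
    intro Q hQ
    refine ⟨fun y hy => hY.1 y hy.1, ?_⟩
    rintro i j p q ⟨a1, a2⟩ ⟨b1, b2⟩ hip hjq
    obtain ⟨c1, c2⟩ := hY.2 i j p q a1 b1 hip hjq
    rcases hip.eq_or_lt with rfl | hip
    · exact ⟨⟨b1, b2⟩, ⟨a1, a2⟩⟩
    rcases hjq.eq_or_lt with rfl | hjq
    · exact ⟨⟨a1, a2⟩, ⟨b1, b2⟩⟩
    rcases hQ i j p q hip hjq a1 c1 c2 b1 with hh | hh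
    · exact ⟨⟨c1, hh.2.1⟩, ⟨c2, hh.2.2.1⟩⟩
    · exact absurd a2 hh.1
  refine ⟨{y | y ∈ Y ∧ P y.1 y.2}, {y | y ∈ Y ∧ ¬ P y.1 y.2}, ⟨(i, j), h1, h3⟩, ⟨(p, q), h2, h4⟩, lad P hP,
    lad (fun i j => ¬ P i j) ?_, ?_, ?_, ?_⟩
  · intro i j p q a b c d e f
    rcases hP i j p q a b c d e f with hh | hh
    · right; tauto
    · left; tauto
  · ext y; simp only [Set.mem_inter_iff, Set.mem_setOf_eq, Set.mem_empty_iff_false, iff_false]; tauto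
  · ext y; simp only [Set.mem_union, Set.mem_setOf_eq]; tauto
  · rintro M ⟨r, c, hr, hc, hm, rfl⟩
    have hr' : r 0 < r 1 := hr (by decide)
    have hc' : c 0 < c 1 := hc (by decide)
    rcases hP _ _ _ _ hr' hc' (hm 0 0) (hm 0 1) (hm 1 0) (hm 1 1) with hh | hh
    · left
      rintro y ⟨u, v, rfl⟩
      refine ⟨hm u v, ?_⟩
      fin_cases u <;> fin_cases v
      · exact hh.1
      · exact hh.2.1
      · exact hh.2.2.1
      · exact hh.2.2.2
    · right
      rintro y ⟨u, v, rfl⟩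
      refine ⟨hm u v, ?_⟩
      fin_cases u <;> fin_cases v
      · exact hh.1
      · exact hh.2.1
      · exact hh.2.2.1
      · exact hh.2.2.2

lemma disc_col (hY : IsLadder m n Y) (hconn : TConnected m n 2 Y) (d a : ℕ)
    (hl : ∀ x y, (x, y) ∈ Y → y < d → a ≤ x) (hr : ∀ x y, (x, y) ∈ Y → d < y → x < a)
    (i j p q : ℕ) (h1 : (i, j) ∈ Y) (h2 : (p, q) ∈ Y) (h3 : j < d ∨ (j = d ∧ a ≤ i)) (h4 : ¬ (q < d ∨ (q = d ∧ a ≤ p))) : False := by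
  refine disc hY hconn (fun x y => y < d ∨ (y = d ∧ a ≤ x)) ?_ i j p q h1 h2 h3 h4
  intro i j p q hip hjq a1 a2 a3 a4
  have l1 := hl _ _ a1
  have l2 := hl _ _ a2
  have l3 := hl _ _ a3
  have l4 := hl _ _ a4
  have r1 := hr _ _ a1
  have r2 := hr _ _ a2
  have r3 := hr _ _ a3
  have r4 := hr _ _ a4
  clear hl hr a1 a2 a3 a4 h1 h2 h3 h4
  omega

lemma disc_row (hY : IsLadder m n Y) (hconn : TConnected m n 2 Y) (d a : ℕ)
    (hl : ∀ x y, (x, y) ∈ Y → x < d → a ≤ y) (hr : ∀ x y, (x, y) ∈ Y → d < x → y < a)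
    (i j p q : ℕ) (h1 : (i, j) ∈ Y) (h2 : (p, q) ∈ Y) (h3 : i < d ∨ (i = d ∧ a ≤ j)) (h4 : ¬ (p < d ∨ (p = d ∧ a ≤ q))) : False := by
  refine disc hY hconn (fun x y => x < d ∨ (x = d ∧ a ≤ y)) ?_ i j p q h1 h2 h3 h4
  intro i j p q hip hjq a1 a2 a3 a4
  have l1 := hl _ _ a1
  have l2 := hl _ _ a2
  have l3 := hl _ _ a3
  have l4 := hl _ _ a4
  have r1 := hr _ _ a1
  have r2 := hr _ _ a2
  have r3 := hr _ _ a3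
  have r4 := hr _ _ a4
  clear hl hr a1 a2 a3 a4 h1 h2 h3 h4
  omega

lemma upper_se (hY : IsLadder m n Y) {c d : ℕ} (h : IsUpperCorner Y (c, d)) {i j : ℕ} (hij : (i, j) ∈ Y) :
    i ≤ c ∨ j ≤ d := by
  by_contra hcon
  push Not at hcon
  obtain ⟨h1, h2, h3, h4⟩ := h
  simp only at h1 h2 h3 h4
  have a := (hY.2 (c+1) d i j h2 hij (by omega) (by omega)).1
  exact h4 (hY.2 c (d+1) (c+1) j h3 a (by omega) (by omega)).2

lemma lower_nw (hY : IsLadder m n Y) {c d : ℕ} (h : IsLowerCorner Y (c, d)) {i j : ℕ} (hij : (i, j) ∈ Y) :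
    c ≤ i ∨ d ≤ j := by
  by_contra hcon
  push Not at hcon
  obtain ⟨h1, h2, h3, h4⟩ := h
  simp only at h1 h2 h3 h4
  have a := (hY.2 i j (c-1) d hij h2 (by omega) (by omega)).2
  exact h4 (hY.2 (c-1) j c (d-1) a h3 (by omega) (by omega)).1

lemma grid {i j : ℕ} (hY : IsLadder m n Y) (h : (i, j) ∈ Y) : 1 ≤ i ∧ i ≤ m ∧ 1 ≤ j ∧ j ≤ n := hY.1 _ h

lemma miss_cases (hS : StdLadder m n Y) {i j : ℕ} (hg : 1 ≤ i ∧ i ≤ m ∧ 1 ≤ j ∧ j ≤ n) (h : (i, j) ∉ Y) :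
    ((∀ q, (i, q) ∈ Y → q < j) ∧ (∀ p, (p, j) ∈ Y → p < i)) ∨ ((∀ q, (i, q) ∈ Y → j < q) ∧ (∀ p, (p, j) ∈ Y → i < p)) := by
  obtain ⟨hY, _, _, hrow, hcol⟩ := hS
  obtain ⟨q0, hq0⟩ := hrow i hg.1 hg.2.1
  obtain ⟨p0, hp0⟩ := hcol j hg.2.2.1 hg.2.2.2
  have key : ∀ q p, (i, q) ∈ Y → (p, j) ∈ Y → (q < j ∧ p < i) ∨ (j < q ∧ i < p) := by
    intro q p hq hp
    have n1 : q ≠ j := by rintro rfl; exact h hq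
    have n2 : p ≠ i := by rintro rfl; exact h hp
    rcases lt_or_gt_of_ne n1 with h1 | h1 <;> rcases lt_or_gt_of_ne n2 with h2 | h2
    · exact Or.inl ⟨h1, h2⟩
    · exact absurd (hY.2 i q p j hq hp h2.le h1.le).1 h
    · exact absurd (hY.2 p j i q hp hq h2.le h1.le).2 h
    · exact Or.inr ⟨h1, h2⟩
  rcases key q0 p0 hq0 hp0 with h1 | h1
  · left
    exact ⟨fun q hq => by have := key q p0 hq hp0; omega, fun p hp => by have := key q0 p hq0 hp; omega⟩
  · right
    exact ⟨fun q hq => by have := key q p0 hq hp0; omega, fun p hp => by have := key q0 p hq0 hp; omega⟩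

/-- a 2-connected ladder has no diagonal break -/
lemma no_break (hY : IsLadder m n Y) (hconn : TConnected m n 2 Y) (i j : ℕ) (h1 : (i, j + 1) ∈ Y) (h2 : (i + 1, j) ∈ Y)
    (hse : ∀ x y, (x, y) ∈ Y → ¬ (i < x ∧ j < y)) (hnw : ∀ x y, (x, y) ∈ Y → ¬ (x ≤ i ∧ y ≤ j)) : False := by
  refine disc hY hconn (fun x y => x ≤ i) ?_ i (j+1) (i+1) j h1 h2 le_rfl (by omega)
  intro i' j' p q hip hjq a1 a2 a3 a4
  have l1 := hse _ _ a1
  have l2 := hse _ _ a2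
  have l3 := hse _ _ a3
  have l4 := hse _ _ a4
  have r1 := hnw _ _ a1
  have r2 := hnw _ _ a2
  have r3 := hnw _ _ a3
  have r4 := hnw _ _ a4
  clear hse hnw a1 a2 a3 a4 h1 h2
  omega

lemma miss_se (hS : StdLadder m n Y) (hconn : TConnected m n 2 Y) (N : ℕ) (i j : ℕ) (hN : i + j = N)
    (hg : 1 ≤ i ∧ i ≤ m ∧ 1 ≤ j ∧ j ≤ n) (h : (i, j) ∉ Y)
    (hq : ∀ q, (i, q) ∈ Y → q < j) (hp : ∀ p, (p, j) ∈ Y → p < i) : ∃ c d, IsUpperCorner Y (c, d) ∧ c < i ∧ d < j := by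
  induction N using Nat.strong_induction_on generalizing i j with
  | _ N ih =>
    obtain ⟨q0, hq0⟩ := hS.2.2.2.1 i hg.1 hg.2.1
    obtain ⟨p0, hp0⟩ := hS.2.2.2.2 j hg.2.2.1 hg.2.2.2
    have hY := hS.1
    have g1 := grid hY hq0
    have g2 := grid hY hp0
    have b1 := hq _ hq0
    have b2 := hp _ hp0
    obtain ⟨i, rfl⟩ : ∃ i', i = i' + 1 := ⟨i - 1, by omega⟩
    obtain ⟨j, rfl⟩ : ∃ j', j = j' + 1 := ⟨j - 1, by omega⟩
    by_cases c1 : (i, j + 1) ∈ Y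
    swap
    · rcases miss_cases hS (by omega) c1 with ⟨e1, e2⟩ | ⟨e1, e2⟩
      · obtain ⟨c, d, hc, _, _⟩ := ih (i + (j+1)) (by omega) i (j+1) rfl (by omega) c1 e1 e2
        exact ⟨c, d, hc, by omega, by omega⟩
      · have := e2 _ hp0; omega
    by_cases c2 : (i + 1, j) ∈ Y
    swap
    · rcases miss_cases hS (by omega) c2 with ⟨e1, e2⟩ | ⟨e1, e2⟩
      · obtain ⟨c, d, hc, _, _⟩ := ih (i + 1 + j) (by omega) (i+1) j rfl (by omega) c2 e1 e2
        exact ⟨c, d, hc, by omega, by omega⟩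
      · have := e1 _ hq0; omega
    by_cases c3 : (i, j) ∈ Y
    · exact ⟨i, j, ⟨c3, c2, c1, h⟩, by omega, by omega⟩
    · exfalso
      rcases miss_cases hS (by omega) c3 with ⟨e1, e2⟩ | ⟨e1, e2⟩
      · have := e1 _ c1; omega
      · refine no_break hY hconn i j c1 c2 ?_ ?_
        · rintro x y hxy ⟨h1, h2⟩
          have := hq y (hY.2 (i+1) j x y c2 hxy (by omega) (by omega)).1
          omega
        · rintro x y hxy ⟨h1, h2⟩
          have := e1 y (hY.2 x y i (j+1) hxy c1 (by omega) (by omega)).2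
          omega

lemma miss_nw (hS : StdLadder m n Y) (hconn : TConnected m n 2 Y) (N : ℕ) (i j : ℕ) (hN : m + n = N + (i + j))
    (hg : 1 ≤ i ∧ i ≤ m ∧ 1 ≤ j ∧ j ≤ n) (h : (i, j) ∉ Y)
    (hq : ∀ q, (i, q) ∈ Y → j < q) (hp : ∀ p, (p, j) ∈ Y → i < p) : ∃ c d, IsLowerCorner Y (c, d) ∧ i < c ∧ j < d := by
  induction N using Nat.strong_induction_on generalizing i j with
  | _ N ih =>
    obtain ⟨q0, hq0⟩ := hS.2.2.2.1 i hg.1 hg.2.1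
    obtain ⟨p0, hp0⟩ := hS.2.2.2.2 j hg.2.2.1 hg.2.2.2
    have hY := hS.1
    have g1 := grid hY hq0
    have g2 := grid hY hp0
    have b1 := hq _ hq0
    have b2 := hp _ hp0
    by_cases c1 : (i, j + 1) ∈ Y
    swap
    · rcases miss_cases hS (by omega) c1 with ⟨e1, e2⟩ | ⟨e1, e2⟩
      · have := e1 _ hq0; omega
      · obtain ⟨c, d, hc, _, _⟩ := ih (N - 1) (by omega) i (j+1) (by omega) (by omega) c1 e1 e2
        exact ⟨c, d, hc, by omega, by omega⟩
    by_cases c2 : (i + 1, j) ∈ Y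
    swap
    · rcases miss_cases hS (by omega) c2 with ⟨e1, e2⟩ | ⟨e1, e2⟩
      · have := e2 _ hp0; omega
      · obtain ⟨c, d, hc, _, _⟩ := ih (N - 1) (by omega) (i+1) j (by omega) (by omega) c2 e1 e2
        exact ⟨c, d, hc, by omega, by omega⟩
    by_cases c3 : (i + 1, j + 1) ∈ Y
    · exact ⟨i + 1, j + 1, ⟨c3, c1, c2, h⟩, by omega, by omega⟩
    · exfalso
      rcases miss_cases hS (by omega) c3 with ⟨e1, e2⟩ | ⟨e1, e2⟩
      · refine no_break hY hconn i j c1 c2 ?_ ?_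
        · rintro x y hxy ⟨h1, h2⟩
          have := e1 y (hY.2 (i+1) j x y c2 hxy (by omega) (by omega)).1
          omega
        · rintro x y hxy ⟨h1, h2⟩
          have := hq y (hY.2 x y i (j+1) hxy c1 (by omega) (by omega)).2
          omega
      · have := e1 _ c2; omega

lemma cuts_of_chain (hS : StdLadder m n Y) (hconn : TConnected m n 2 Y) (g : ℕ) (r q : ℕ → ℕ) (hg : 0 < g)
    (r0 : r 0 = m) (q0 : q 0 = 1) (rg : r g = 1) (qg : q g = n) (hr : ∀ v, v < g → r (v+1) < r v)
    (hq : ∀ v, v < g → q v < q (v+1))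
    (hcor : ∀ l, 0 < l → l < g → IsLowerCorner Y (r l, q l) ∨ IsUpperCorner Y (r l, q l))
    (hall : ∀ z, IsLowerCorner Y z ∨ IsUpperCorner Y z → ∃ l, 0 < l ∧ l < g ∧ z = (r l, q l))
    (hex : ∀ z, IsLowerCorner Y z → IsUpperCorner Y z → False) :
    ∃ (ρ σ : ℕ → ℕ) (up : ℕ → Bool), Cuts m n g ρ σ up Y := by
  classical
  have hY := hS.1
  set up : ℕ → Bool := fun l => decide (IsUpperCorner Y (r l, q l)) with hup
  have upt : ∀ l, up l = true ↔ IsUpperCorner Y (r l, q l) := fun l => by simp [hup]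
  have upf : ∀ l, 0 < l → l < g → (up l = false ↔ IsLowerCorner Y (r l, q l)) := by
    intro l hl hl'
    have := hcor l hl hl'
    have := hex (r l, q l)
    simp only [hup, decide_eq_false_iff_not]
    tauto
  obtain ⟨ρ, hρ⟩ : ∃ ρ : ℕ → ℕ, ∀ l, ρ l = if 0 < l ∧ (g ≤ l ∨ up l = false) then r l - 1 else r l := ⟨_, fun l => rfl⟩
  obtain ⟨σ, hσ⟩ : ∃ σ : ℕ → ℕ, ∀ l, σ l = if l < g ∧ (l = 0 ∨ up l = false) then q l - 1 else q l := ⟨_, fun l => rfl⟩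
  have hone := grid hY hS.2.1
  have htwo := grid hY hS.2.2.1
  have rpos : ∀ l, l ≤ g → 1 ≤ r l := by
    intro l hl
    rcases hl.eq_or_lt with rfl | hl
    · omega
    · have := hr l hl; omega
  have qpos : ∀ l, l ≤ g → 1 ≤ q l := by
    intro l hl
    rcases Nat.eq_zero_or_pos l with rfl | h0
    · omega
    · have := hq (l-1) (by omega); rw [show l - 1 + 1 = l by omega] at this; omega
  have ρu : ∀ l, 0 < l → l < g → up l = true → ρ l = r l := by
    intro l h1 h2 h3; rw [hρ, if_neg]; rw [h3]; simp; omega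
  have ρl : ∀ l, 0 < l → l < g → up l = false → ρ l + 1 = r l := by
    intro l h1 h2 h3; rw [hρ, if_pos ⟨h1, Or.inr h3⟩]; have := rpos l h2.le; omega
  have σu : ∀ l, 0 < l → l < g → up l = true → σ l = q l := by
    intro l h1 h2 h3; rw [hσ, if_neg]; rw [h3]; simp; omega
  have σl : ∀ l, 0 < l → l < g → up l = false → σ l + 1 = q l := by
    intro l h1 h2 h3; rw [hσ, if_pos ⟨h2, Or.inr h3⟩]; have := qpos l h2.le; omega
  have ρ0 : ρ 0 = m := by rw [hρ]; simp [r0]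
  have σ0 : σ 0 = 0 := by rw [hσ]; simp [hg, q0]
  have ρg : ρ g = 0 := by rw [hρ]; simp [hg, rg]
  have σg : σ g = n := by rw [hσ]; simp [qg]
  have A : ∀ v, v < g → ρ v + (if 0 < v ∧ up v = false then 1 else 0) = r v := by
    intro v hv
    rcases Nat.eq_zero_or_pos v with rfl | h0
    · simp [ρ0, r0]
    · cases hu : up v
      · simp [h0, ρl v h0 hv hu]
      · simp [ρu v h0 hv hu]
  have A' : ∀ v, v < g → ρ (v+1) + 1 = r (v+1) + (if v + 1 < g ∧ up (v+1) = true then 1 else 0) := by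
    intro v hv
    rcases (show v + 1 ≤ g from hv).eq_or_lt with h0 | h0
    · rw [if_neg (by omega), h0, ρg, rg]
    · cases hu : up (v+1)
      · simp [ρl (v+1) (by omega) h0 hu]
      · simp [h0, ρu (v+1) (by omega) h0 hu]
  have B : ∀ v, v < g → σ v + 1 = q v + (if 0 < v ∧ up v = true then 1 else 0) := by
    intro v hv
    rcases Nat.eq_zero_or_pos v with rfl | h0
    · simp [σ0, q0]
    · cases hu : up v
      · simp [σl v h0 hv hu]
      · simp [h0, σu v h0 hv hu]
  have B' : ∀ v, v < g → σ (v+1) + (if v + 1 < g ∧ up (v+1) = false then 1 else 0) = q (v+1) := by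
    intro v hv
    rcases (show v + 1 ≤ g from hv).eq_or_lt with h0 | h0
    · rw [if_neg (by omega), h0, σg, qg, add_zero]
    · cases hu : up (v+1)
      · simp [h0, σl (v+1) (by omega) h0 hu]
      · simp [σu (v+1) (by omega) h0 hu]
  refine ⟨ρ, σ, up, ⟨hg, by omega, by omega, ρ0, σ0, ρg, σg, ?_, ?_, ?_, ?_, ?_, ?_, hS.2.2.2.1, hS.2.2.2.2⟩⟩
  · intro v hv
    have := A v hv; have := A' v hv; have := hr v hv
    split_ifs at * <;> omega
  · intro v hv
    have := B v hv; have := B' v hv; have := hq v hv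
    split_ifs at * <;> omega
  · intro v hv
    have := A v hv; have := A' v hv; have := hr v hv
    split_ifs at * <;> omega
  · intro v hv
    have := B v hv; have := B' v hv; have := hq v hv
    split_ifs at * <;> omega
  · intro i j
    constructor
    · intro hij
      refine ⟨grid hY hij, fun l hl hl' => ⟨fun hu => ?_, fun hu => ?_⟩⟩
      · have := upper_se hY ((upt l).1 hu) hij
        rw [ρu l hl hl' hu, σu l hl hl' hu]; omega
      · have := lower_nw hY ((upf l hl hl').1 hu) hij
        have := ρl l hl hl' hu; have := σl l hl hl' hu; omega
    · rintro ⟨hgr, hall'⟩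
      by_contra hcon
      rcases miss_cases hS hgr hcon with ⟨e1, e2⟩ | ⟨e1, e2⟩
      · obtain ⟨c, d, h1, h2, h3⟩ := miss_se hS hconn _ i j rfl hgr hcon e1 e2
        obtain ⟨l, hl, hl', hz⟩ := hall _ (Or.inr h1)
        obtain ⟨rfl, rfl⟩ := Prod.mk.inj hz
        have hu := (upt l).2 h1
        apply (hall' l hl hl').1 hu
        rw [ρu l hl hl' hu, σu l hl hl' hu]
        exact ⟨h2, h3⟩
      · obtain ⟨c, d, h1, h2, h3⟩ := miss_nw hS hconn (m + n - (i + j)) i j (by omega) hgr hcon e1 e2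
        obtain ⟨l, hl, hl', hz⟩ := hall _ (Or.inl h1)
        obtain ⟨rfl, rfl⟩ := Prod.mk.inj hz
        have hu := (upf l hl hl').2 h1
        apply (hall' l hl hl').2 hu
        have := ρl l hl hl' hu; have := σl l hl hl' hu
        omega
  · intro l hl hl'
    constructor
    · intro hu
      rw [ρu l hl hl' hu, σu l hl hl' hu]
      exact ((upt l).1 hu).1
    · intro hu
      rw [ρl l hl hl' hu, σl l hl hl' hu]
      exact ((upf l hl hl').1 hu).1

theorem exists_cuts (hS : StdLadder m n Y) (hconn : TConnected m n 2 Y) (hcorner : ∃ p, IsLowerCorner Y p)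
    (hthin : ∀ p q : ℕ × ℕ, IsLowerCorner Y p → IsUpperCorner Y q → q.1 < p.1 ∨ q.2 < p.2) :
    ∃ (g : ℕ) (ρ σ : ℕ → ℕ) (up : ℕ → Bool), Cuts m n g ρ σ up Y := by
  classical
  have hY := hS.1
  -- bounds for corners
  have ub : ∀ c d, IsUpperCorner Y (c, d) → (1 < c ∧ c < m) ∧ 1 < d ∧ d < n := by
    intro c d hc
    have g1 := grid hY hc.1
    have g2 := grid hY hc.2.1
    have g3 := grid hY hc.2.2.1
    simp only at g1 g2 g3
    refine ⟨⟨?_, by omega⟩, ?_, by omega⟩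
    · by_contra h1
      refine disc_row hY hconn c (d+1) ?_ ?_ c (d+1) c d hc.2.2.1 hc.1 (by omega) (by omega)
      · intro x y hxy hx; have := grid hY hxy; omega
      · intro x y hxy hx; have := upper_se hY hc hxy; omega
    · by_contra h1
      refine disc_col hY hconn d (c+1) ?_ ?_ (c+1) d c d hc.2.1 hc.1 (by omega) (by omega)
      · intro x y hxy hx; have := grid hY hxy; omega
      · intro x y hxy hx; have := upper_se hY hc hxy; omega
  have lb : ∀ c d, IsLowerCorner Y (c, d) → (1 < c ∧ c < m) ∧ 1 < d ∧ d < n := by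
    intro c d hc
    have g1 := grid hY hc.1
    have g2 := grid hY hc.2.1
    have g3 := grid hY hc.2.2.1
    simp only at g1 g2 g3
    refine ⟨⟨by omega, ?_⟩, by omega, ?_⟩
    · by_contra h1
      refine disc_row hY hconn c d ?_ ?_ c d c (d-1) hc.1 hc.2.2.1 (by omega) (by omega)
      · intro x y hxy hx; have := lower_nw hY hc hxy; omega
      · intro x y hxy hx; have := grid hY hxy; omega
    · by_contra h1
      refine disc_col hY hconn d c ?_ ?_ c d (c-1) d hc.1 hc.2.1 (by omega) (by omega)
      · intro x y hxy hx; have := lower_nw hY hc hxy; omega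
      · intro x y hxy hx; have := grid hY hxy; omega
  -- mixed
  have mix : ∀ a b c d, IsLowerCorner Y (a, b) → IsUpperCorner Y (c, d) → (c < a ∧ b < d) ∨ (a < c ∧ d < b) := by
    intro a b c d hl hu
    have t := hthin _ _ hl hu
    have s := upper_se hY hu hl.1
    simp only at t s
    by_contra hcon
    by_cases h1 : d = b
    · subst h1
      refine disc_col hY hconn d a ?_ ?_ a d c d hl.1 hu.1 (by omega) (by omega)
      · intro x y hxy hx; have := lower_nw hY hl hxy; omega
      · intro x y hxy hx; have := upper_se hY hu hxy; omega
    · have h2 : c = a := by omega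
      subst h2
      refine disc_row hY hconn c b ?_ ?_ c b c d hl.1 hu.1 (by omega) (by omega)
      · intro x y hxy hx; have := lower_nw hY hl hxy; omega
      · intro x y hxy hx; have := upper_se hY hu hxy; omega
  set K : ℕ × ℕ → Prop := fun z => (IsLowerCorner Y z ∨ IsUpperCorner Y z) ∨ z = (m, 1) ∨ z = (1, n) with hK
  obtain ⟨⟨a0, b0⟩, hab⟩ := hcorner
  have hab' := lb _ _ hab
  have chain : ∀ x y x' y', K (x, y) → K (x', y') → (x < x' → y' < y) ∧ (x = x' → y = y') := by
    intro x y x' y' h1 h2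
    rcases h1 with (h1 | h1) | h1 | h1
    · have := lb _ _ h1
      rcases h2 with (h2 | h2) | h2 | h2
      · have e1 := lower_nw hY h1 h2.2.1
        have e2 := lower_nw hY h1 h2.2.2.1
        have e3 := lower_nw hY h2 h1.2.1
        have e4 := lower_nw hY h2 h1.2.2.1
        have := lb _ _ h2
        simp only at e1 e2 e3 e4
        omega
      · have := mix _ _ _ _ h1 h2; omega
      · obtain ⟨z1, z2⟩ := Prod.mk.inj h2; omega
      · obtain ⟨z1, z2⟩ := Prod.mk.inj h2; omega
    · have := ub _ _ h1
      rcases h2 with (h2 | h2) | h2 | h2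
      · have := mix _ _ _ _ h2 h1; omega
      · have e1 := upper_se hY h1 h2.2.1
        have e2 := upper_se hY h1 h2.2.2.1
        have e3 := upper_se hY h2 h1.2.1
        have e4 := upper_se hY h2 h1.2.2.1
        simp only at e1 e2 e3 e4
        omega
      · obtain ⟨z1, z2⟩ := Prod.mk.inj h2; omega
      · obtain ⟨z1, z2⟩ := Prod.mk.inj h2; omega
    · obtain ⟨z3, z4⟩ := Prod.mk.inj h1
      rcases h2 with (h2 | h2) | h2 | h2
      · have := lb _ _ h2; omega
      · have := ub _ _ h2; omega
      · obtain ⟨z1, z2⟩ := Prod.mk.inj h2; omega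
      · obtain ⟨z1, z2⟩ := Prod.mk.inj h2; omega
    · obtain ⟨z3, z4⟩ := Prod.mk.inj h1
      rcases h2 with (h2 | h2) | h2 | h2
      · have := lb _ _ h2; omega
      · have := ub _ _ h2; omega
      · obtain ⟨z1, z2⟩ := Prod.mk.inj h2; omega
      · obtain ⟨z1, z2⟩ := Prod.mk.inj h2; omega
  set T : Finset ℕ := (Finset.Icc 1 m).filter (fun x => ∃ y, K (x, y)) with hT
  have K1 : K (m, 1) := Or.inr (Or.inl rfl)
  have K2 : K (1, n) := Or.inr (Or.inr rfl)
  have hmT : m ∈ T := by rw [hT, Finset.mem_filter, Finset.mem_Icc]; exact ⟨by omega, 1, K1⟩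
  have h1T : 1 ∈ T := by rw [hT, Finset.mem_filter, Finset.mem_Icc]; exact ⟨by omega, n, K2⟩
  have hTn : ∀ x ∈ T, 1 ≤ x ∧ x ≤ m ∧ ∃ y, K (x, y) := by
    intro x hx; rw [hT, Finset.mem_filter, Finset.mem_Icc] at hx; exact ⟨hx.1.1, hx.1.2, hx.2⟩
  have hcard : 1 < T.card := Finset.one_lt_card.2 ⟨m, hmT, 1, h1T, by omega⟩
  obtain ⟨g, hg⟩ : ∃ g, T.card = g + 1 := ⟨T.card - 1, by omega⟩
  set t := T.orderEmbOfFin hg with ht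
  have htm : ∀ v, t v ∈ T := fun v => T.orderEmbOfFin_mem hg v
  have htr : ∀ x ∈ T, ∃ v, t v = x := by
    intro x hx
    have : x ∈ Set.range t := by rw [ht, Finset.range_orderEmbOfFin]; exact hx
    exact this
  have hf : ∃ f : ℕ → ℕ, ∀ x ∈ T, K (x, f x) := by
    choose! f hf using fun x (hx : x ∈ T) => (hTn x hx).2.2
    exact ⟨f, hf⟩
  obtain ⟨f, hf⟩ := hf
  obtain ⟨r, hr⟩ : ∃ r : ℕ → ℕ, ∀ l, r l = t ⟨g - l, by omega⟩ := ⟨_, fun l => rfl⟩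
  have rT : ∀ l, r l ∈ T := fun l => by rw [hr]; exact htm _
  have rstep : ∀ v, v < g → r (v+1) < r v := by
    intro v hv
    rw [hr, hr]
    apply t.strictMono
    rw [Fin.lt_def]
    simp only
    omega
  have rsur : ∀ x ∈ T, ∃ l, l ≤ g ∧ r l = x := by
    intro x hx
    obtain ⟨v, hv⟩ := htr x hx
    refine ⟨g - v.1, by omega, ?_⟩
    rw [hr, ← hv]
    congr 1
    apply Fin.ext
    simp only
    have := v.2
    omega
  have r0 : r 0 = m := by
    obtain ⟨l, hl, hx⟩ := rsur m hmT
    rcases Nat.eq_zero_or_pos l with rfl | h0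
    · exact hx
    · exfalso
      have h1 : r l < r 0 := by
        rw [hr, hr]; apply t.strictMono; rw [Fin.lt_def]; simp only; omega
      have := hTn _ (rT 0)
      omega
  have rg : r g = 1 := by
    obtain ⟨l, hl, hx⟩ := rsur 1 h1T
    rcases hl.eq_or_lt with rfl | h0
    · exact hx
    · exfalso
      have h1 : r g < r l := by
        rw [hr, hr]; apply t.strictMono; rw [Fin.lt_def]; simp only; omega
      have := hTn _ (rT g)
      omega
  obtain ⟨ρ, σ, up, hc⟩ := cuts_of_chain hS hconn g r (fun l => f (r l)) (by omega) r0
    (by simp only [r0]; exact (chain _ _ _ _ (hf m hmT) K1).2 rfl) rg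
    (by simp only [rg]; exact (chain _ _ _ _ (hf 1 h1T) K2).2 rfl) rstep
    (fun v hv => (chain _ _ _ _ (hf _ (rT (v+1))) (hf _ (rT v))).1 (rstep v hv))
    (by
      intro l hl hl'
      have hlt : r g < r l := by
        rw [hr, hr]; apply t.strictMono; rw [Fin.lt_def]; simp only; omega
      have hlt' : r l < r 0 := by
        rw [hr, hr]; apply t.strictMono; rw [Fin.lt_def]; simp only; omega
      rcases hf _ (rT l) with h1 | h1 | h1
      · exact h1
      · have := congrArg Prod.fst h1; simp only at this; omega
      · have := congrArg Prod.fst h1; simp only at this; omega)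
    (by
      rintro ⟨x, y⟩ hz
      have hb : 1 < x ∧ x < m := by
        rcases hz with hz | hz
        · exact (lb _ _ hz).1
        · exact (ub _ _ hz).1
      have hKz : K (x, y) := Or.inl hz
      have hxT : x ∈ T := by rw [hT, Finset.mem_filter, Finset.mem_Icc]; exact ⟨by omega, y, hKz⟩
      obtain ⟨l, hl, rfl⟩ := rsur x hxT
      refine ⟨l, ?_, ?_, ?_⟩
      · rcases Nat.eq_zero_or_pos l with rfl | h0
        · omega
        · exact h0
      · rcases hl.eq_or_lt with rfl | h0
        · omega
        · exact h0
      · rw [(chain _ _ _ _ hKz (hf _ hxT)).2 rfl])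
    (by
      rintro ⟨x, y⟩ h1 h2
      have := mix _ _ _ _ h1 h2
      omega)
  exact ⟨g, ρ, σ, up, hc⟩

end geometry

/-- **Thin Ladder Theorem.** Let `Y` be a two-sided `2`-connected ladder
such that every lower inside corner `(a,b)` and upper inside corner `(c,d)` satisfy
`a > c` or `b > d`. Then `R_2(Y)` has at most two semidualizing modules up to
isomorphism: among any three semidualizing modules, two are isomorphic. -/
theorem thinLadder_semidualizing (m n : ℕ) (k : Type) [Field k]
    (Y : Set (ℕ × ℕ)) (hY : StdLadder m n Y) (hconn : TConnected m n 2 Y)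
    (htwo : TwoSided Y)
    (hthin : ∀ p q : ℕ × ℕ, IsLowerCorner Y p → IsUpperCorner Y q →
      q.1 < p.1 ∨ q.2 < p.2)
    (C : Fin 3 → ModuleCat.{0} (LadderRing k 2 Y))
    (hC : ∀ i, IsSemidualizing (C i)) :
    ∃ i j, i ≠ j ∧ Nonempty (C i ≅ C j) := by
  classical
  obtain ⟨g, ρ, σ, up, h⟩ := exists_cuts hY hconn htwo.2.1 hthin
  obtain ⟨i1, i2, hT⟩ := h.toric k
  have hfin : Finite Y := h.finite.to_subtype
  have hnoeth : IsNoetherianRing (LadderRing k 2 Y) := inferInstance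
  have hdom : IsDomain (LadderRing k 2 Y) := hT.inj.isDomain (algebraMap (LadderRing k 2 Y) (MvPolynomial (EE m n g) k))
  have key : ∀ i, ∃ α, (α = 0 ∨ α = cwt m n g ρ σ up (-1)) ∧ Nonempty (Sa hT α ≃ₗ[LadderRing k 2 Y] C i) := by
    intro i
    obtain ⟨h1, h2, h3⟩ := hC i
    obtain ⟨α, ⟨e⟩, hz⟩ := exists_Sa hT (C i) h1 h2 h3
    exact ⟨α, h.alpha_cases (k := k) α (fun u hu => Ex2_of_semidualizing hT (C i) e h2.1 h2.2 h3 u hu) hz, ⟨e⟩⟩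
  choose α hα hS using key
  obtain ⟨i, j, hij, he⟩ := Fintype.exists_ne_map_eq_of_card_lt (fun i => decide (α i = 0)) (by simp)
  have he' : α i = α j := by
    have : (α i = 0) ↔ (α j = 0) := by simpa using he
    rcases hα i with hi | hi <;> rcases hα j with hj | hj
    · rw [hi, hj]
    · rw [hi, this.1 hi]
    · rw [hj, this.2 hj]
    · rw [hi, hj]
  obtain ⟨e1⟩ := hS i
  obtain ⟨e2⟩ := hS j
  rw [← he'] at e2
  exact ⟨i, j, hij, ⟨(e1.symm.trans e2).toModuleIso⟩⟩

end LadderDet
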